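/- arXiv:2412.05867 — 2 statements merged into one kernel-verified Lean document; each statement's English description precedes it below -/
import Mathlib

section
/- Let K ⊂ ℂ be an imaginary quadratic field with ring of integers O and nontrivial automorphism σ (complex conjugation). Let 𝔣 be a nonzero ideal of O with σ(𝔣) = 𝔣 such that every prime ideal of O that is ramified in K/ℚ divides 𝔣. Let φ be a function from nonzero ideals of O to ℂ such that: φ(𝔞𝔟) = φ(𝔞)φ(𝔟) for all nonzero ideals 𝔞, 𝔟; φ(𝔞) = 0 exactly when 𝔞 is not coprime to 𝔣; φ(𝔞)·conj(φ(𝔞)) = N𝔞 for every nonzero ideal 𝔞 coprime to 𝔣; and there is a function ε₁ : (O/𝔣)^× → ℂ^× with φ(wO) = ε₁(w mod 𝔣)·w for every w ∈ O coprime to 𝔣. Define κ₁(n) = φ(nO)/n for rational integers n coprime to 𝔣. Then the following are equivalent: (1) φ(σ(𝔞)) = conj(φ(𝔞)) for every nonzero ideal 𝔞; (2) κ₁(n) ∈ {1, −1} for every rational integer n coprime to 𝔣, and for every rational prime p coprime to 𝔣 one has κ₁(p) = 1 if p splits in K and κ₁(p) = −1 if p is inert in K. -/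
open NumberField

theorem jacobiSym_neg_four_mul_sub_one (D : ℕ) (hD : 0 < D) :
    jacobiSym (-D) (4 * D - 1) = -1 := by
  have hodd : Odd (4 * D - 1) := ⟨2 * D - 1, by omega⟩
  have h4 : jacobiSym D (4 * D - 1) = 1 := by
    have h : jacobiSym (4 * D) (4 * D - 1) = 1 := by
      rw [jacobiSym.mod_left' (a₂ := 1), jacobiSym.one_left]
      refine Int.modEq_iff_dvd.2 ⟨-1, ?_⟩
      push_cast [Nat.cast_sub (show 1 ≤ 4 * D by omega)]
      ring
    rwa [jacobiSym.mul_left, jacobiSym.at_four hodd, one_mul] at h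
  rw [jacobiSym.neg _ hodd, h4, mul_one, ZMod.χ₄_nat_three_mod_four (by omega)]

/-- If `q ≡ -p` modulo `4 * D`, then `-D` has opposite Jacobi symbols modulo `p` and `q`. -/
theorem jacobiSym_neg_mul_eq_neg_one {D p q : ℕ} (hD : 0 < D) (hp : Odd p) (hq : Odd q)
    (hpD : p.Coprime D) (h : 4 * D ∣ q + p) :
    jacobiSym (-D) q * jacobiSym (-D) p = -1 := by
  have : NeZero p := ⟨hp.pos.ne'⟩
  have : NeZero q := ⟨hq.pos.ne'⟩
  have : NeZero (4 * D - 1) := ⟨by omega⟩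
  have hodd : Odd (4 * D - 1) := ⟨2 * D - 1, by omega⟩
  rw [← jacobiSym.mul_right, jacobiSym.mod_right _ (hq.mul hp)]
  have hmod : q * p % (4 * (-D : ℤ).natAbs) = (p ^ 2 * (4 * D - 1)) % (4 * (-D : ℤ).natAbs) := by
    rw [Int.natAbs_neg, Int.natAbs_natCast]
    change _ ≡ _ [MOD _]
    rw [Nat.modEq_iff_dvd]
    obtain ⟨k, hk⟩ := h
    refine ⟨p ^ 2 - p * k, ?_⟩
    have hk' : (q : ℤ) + p = 4 * D * k := by exact_mod_cast hk
    push_cast [Nat.cast_sub (show 1 ≤ 4 * D by omega)]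
    linear_combination (-p : ℤ) * hk'
  rw [hmod, ← jacobiSym.mod_right _ (hp.pow.mul hodd), jacobiSym.mul_right,
    jacobiSym_neg_four_mul_sub_one D hD, jacobiSym.pow_right, jacobiSym.sq_one, one_mul]
  rwa [Int.neg_gcd, Int.gcd_natCast_natCast, Nat.gcd_comm]

theorem exists_prime_dvd_add_of_jacobiSym {D m p : ℕ} (hD : 0 < D) (hm : 0 < m) (hp : Odd p)
    (hpm : p.Coprime m) (h : jacobiSym (-D) p = -1) :
    ∃ q : ℕ, q.Prime ∧ q ≠ 2 ∧ m ∣ q + p ∧ jacobiSym (-D) q = 1 := by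
  have : NeZero p := ⟨hp.pos.ne'⟩
  have hpD : p.Coprime D := by
    by_contra hc
    have := (jacobiSym.eq_zero_iff_not_coprime (a := (-D : ℤ)) (b := p)).2 (by
      rwa [Int.neg_gcd, Int.gcd_natCast_natCast, Nat.gcd_comm])
    omega
  have hco : p.Coprime (4 * D * m) :=
    Nat.Coprime.mul_right (Nat.Coprime.mul_right
      (Nat.Coprime.pow_right 2 (Nat.coprime_two_right.2 hp)) hpD) hpm
  obtain ⟨q, hq2, hq, hmod⟩ := Nat.forall_exists_prime_gt_and_zmodEq 2 (q := 4 * D * m)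
    (a := -p) (by positivity) (by
      rw [IsCoprime.neg_left_iff]; exact Nat.isCoprime_iff_coprime.2 hco)
  have hdvd : 4 * D * m ∣ q + p := by
    have := hmod.symm.dvd
    rw [sub_neg_eq_add] at this
    exact_mod_cast this
  refine ⟨q, hq, hq2.ne', (Dvd.intro_left _ rfl).trans hdvd, ?_⟩
  have := jacobiSym_neg_mul_eq_neg_one hD hp (hq.odd_of_ne_two hq2.ne') hpD
    ((Dvd.intro _ rfl).trans hdvd)
  rw [h] at this
  omega

theorem exists_prime_dvd_add_two {D m : ℕ} (hD : D % 8 = 3) (hm : Odd m) :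
    ∃ q : ℕ, q.Prime ∧ q ≠ 2 ∧ m ∣ q + 2 ∧ jacobiSym (-D) q = 1 := by
  have hDo : Odd D := Nat.odd_iff.2 (by omega)
  obtain ⟨N, hN⟩ : ∃ N, N = m * D := ⟨_, rfl⟩
  have hNo : Odd N := hN ▸ hm.mul hDo
  obtain ⟨q, hq2, hq, hmod⟩ := Nat.forall_exists_prime_gt_and_zmodEq 2 (q := 4 * N)
    (a := 3 * N ^ 2 - 2) (by have := hNo.pos; positivity) (by
      obtain ⟨k, rfl⟩ := hNo
      have h1 : IsCoprime (3 * ((2 * k + 1 : ℕ) : ℤ) ^ 2 - 2) 2 :=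
        ⟨1, -(6 * k ^ 2 + 6 * k), by push_cast; ring⟩
      have h2 : IsCoprime (3 * ((2 * k + 1 : ℕ) : ℤ) ^ 2 - 2) ((2 * k + 1 : ℕ) : ℤ) :=
        ⟨k, 1 - 3 * k * (2 * k + 1), by push_cast; ring⟩
      have h3 := (h1.mul_right h1).mul_right h2
      push_cast at h3 ⊢
      exact h3)
  have hdvd : (4 * N : ℤ) ∣ q - (3 * N ^ 2 - 2) := by exact_mod_cast hmod.symm.dvd
  have hqo := hq.odd_of_ne_two hq2.ne'
  have h4 : q % 4 = 1 := by
    obtain ⟨k, rfl⟩ := hNo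
    obtain ⟨c, hc⟩ := hdvd
    have : (q : ℤ) = 4 * ((2 * k + 1) * c + 3 * k ^ 2 + 3 * k) + 1 := by
      push_cast at hc; linear_combination hc
    omega
  have hN2 : N ∣ q + 2 := by
    obtain ⟨c, hc⟩ := hdvd
    have : (N : ℤ) ∣ q + 2 := ⟨4 * c + 3 * N, by linear_combination hc⟩
    exact_mod_cast this
  refine ⟨q, hq, hq2.ne', (hN ▸ Dvd.intro _ rfl : m ∣ N).trans hN2, ?_⟩
  rw [jacobiSym.neg _ hqo, ZMod.χ₄_nat_one_mod_four h4, one_mul,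
    ← jacobiSym.quadratic_reciprocity_one_mod_four h4 hDo,
    jacobiSym.mod_left' (a₂ := -2), jacobiSym.at_neg_two hDo,
    ZMod.χ₈'_nat_eq_if_mod_eight]
  · simp [hD]; omega
  · refine Int.modEq_iff_dvd.2 ?_
    have : (D : ℤ) ∣ q + 2 := by
      exact_mod_cast (hN ▸ Dvd.intro_left _ rfl : D ∣ N).trans hN2
    rw [show (-2 - q : ℤ) = -(q + 2) by ring]
    exact this.neg_right

theorem intCast_dvd_intCast_of_fixed {F : Type*} [Field F] [NumberField F]
    {σ : 𝓞 F ≃+* 𝓞 F}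
    (hfix : ∀ x, σ x = x → ∃ n : ℤ, x = n) {m n : ℤ} (h : (m : 𝓞 F) ∣ n) : m ∣ n := by
  obtain ⟨x, hx⟩ := h
  rcases eq_or_ne m 0 with rfl | hm
  · rw [Int.cast_zero, zero_mul, Int.cast_eq_zero] at hx
    exact hx ▸ dvd_rfl
  have hσx : σ x = x := by
    refine mul_left_cancel₀ (Int.cast_ne_zero.2 hm : (m : 𝓞 F) ≠ 0) ?_
    rw [← hx, ← map_intCast σ m, ← map_mul, ← hx, map_intCast]
  obtain ⟨k, rfl⟩ := hfix x hσx
  exact ⟨k, by exact_mod_cast hx⟩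

theorem ideal_map_map_of_involutive {R : Type*} [CommRing R] {σ : R ≃+* R}
    (hinv : ∀ x, σ (σ x) = x) (I : Ideal R) : Ideal.map σ (Ideal.map σ I) = I := by
  ext x
  rw [← hinv x, Ideal.apply_mem_of_equiv_iff (f := σ), Ideal.apply_mem_of_equiv_iff (f := σ), hinv]

theorem map_eq_of_span_eq_mul {F : Type*} [Field F] [NumberField F]
    {σ : 𝓞 F ≃+* 𝓞 F} (hinv : ∀ x, σ (σ x) = x)
    (hfix : ∀ x, σ x = x → ∃ n : ℤ, x = n) {p : ℕ} (hp : p.Prime) {P Q : Ideal (𝓞 F)}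
    (hP : P.IsPrime) (hQ : Q.IsPrime) (hPQ : P ≠ Q) (h : Ideal.span {(p : 𝓞 F)} = P * Q) :
    Ideal.map σ P = Q := by
  have hp0 : Ideal.span {(p : 𝓞 F)} ≠ ⊥ := by
    simpa using hp.ne_zero
  have hP0 : P ≠ ⊥ := by
    rintro rfl
    exact hp0 (h.trans (Ideal.bot_mul Q))
  have hQ0 : Q ≠ ⊥ := by
    rintro rfl
    exact hp0 (h.trans (Ideal.mul_bot P))
  have hPm := hP.isMaximal hP0
  have hQm := hQ.isMaximal hQ0
  have key (I : Ideal (𝓞 F)) (hI : I.IsPrime) (hpI : (p : 𝓞 F) ∈ I) :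
      Ideal.map σ I = P ∨ Ideal.map σ I = Q := by
    have hprime : (Ideal.map σ I).IsPrime := Ideal.map_isPrime_of_equiv (F' := 𝓞 F ≃+* 𝓞 F) σ
    have hle : P * Q ≤ Ideal.map σ I := by
      rw [← h, Ideal.span_singleton_le_iff_mem, ← map_natCast σ p]
      exact Ideal.mem_map_of_mem σ hpI
    rcases hprime.mul_le.1 hle with h | h
    · exact .inl (hPm.eq_of_le hprime.ne_top h).symm
    · exact .inr (hQm.eq_of_le hprime.ne_top h).symm
  have hpPQ : (p : 𝓞 F) ∈ P * Q := by
    rw [← h]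
    exact Ideal.mem_span_singleton_self _
  have hpP : (p : 𝓞 F) ∈ P := (Ideal.mul_le_left : P * Q ≤ P) hpPQ
  have hpQ : (p : 𝓞 F) ∈ Q := (Ideal.mul_le_right : P * Q ≤ Q) hpPQ
  have hmap := ideal_map_map_of_involutive hinv
  refine (key P hP hpP).resolve_left fun hσP ↦ ?_
  have hσQ : Ideal.map σ Q = Q := by
    refine (key Q hQ hpQ).resolve_left fun h ↦ hPQ ?_
    exact hσP.symm.trans ((congrArg (Ideal.map σ) h.symm).trans (hmap Q))
  obtain ⟨x, hxP, hxQ⟩ : ∃ x ∈ P, x ∉ Q := by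
    by_contra! hc
    exact hPQ (hPm.eq_of_le hQ.ne_top hc)
  obtain ⟨n, hn⟩ := hfix (x * σ x) (by rw [map_mul, hinv, mul_comm])
  have hnP : (n : 𝓞 F) ∈ P := by
    rw [← hn]
    exact P.mul_mem_right _ hxP
  have hpn : (p : ℤ) ∣ n := by
    by_contra hc
    obtain ⟨u, v, huv⟩ := (Nat.prime_iff_prime_int.1 hp).coprime_iff_not_dvd.2 hc
    refine hP.one_notMem ?_
    have : (1 : 𝓞 F) = u * p + v * n := by exact_mod_cast congrArg (Int.cast (R := 𝓞 F)) huv.symm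
    rw [this]
    exact P.add_mem (P.mul_mem_left _ hpP) (P.mul_mem_left _ hnP)
  have hnQ : x * σ x ∈ Q := by
    obtain ⟨k, rfl⟩ := hpn
    rw [hn]
    push_cast
    exact Q.mul_mem_right _ hpQ
  refine (hQ.mem_or_mem hnQ).elim hxQ fun hx ↦ hxQ ?_
  rwa [← hσQ, Ideal.apply_mem_of_equiv_iff] at hx

theorem exists_span_eq_mul_map {F : Type*} [Field F] [NumberField F]
    {σ : 𝓞 F ≃+* 𝓞 F} {s : 𝓞 F} {D : ℕ}
    (hs : s ^ 2 = -D) (hσs : σ s = -s) {q : ℕ} (hq : q.Prime) (hq2 : q ≠ 2)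
    (hJ : jacobiSym (-D) q = 1) :
    ∃ P : Ideal (𝓞 F), P ≠ ⊥ ∧ Ideal.span {(q : 𝓞 F)} = P * Ideal.map σ P := by
  have : Fact q.Prime := ⟨hq⟩
  obtain ⟨a, ha⟩ : ∃ a : ℤ, (q : ℤ) ∣ a ^ 2 + D := by
    obtain ⟨b, hb⟩ := ZMod.isSquare_of_jacobiSym_eq_one hJ
    obtain ⟨a, rfl⟩ := ZMod.intCast_surjective b
    refine ⟨a, (ZMod.intCast_zmod_eq_zero_iff_dvd _ q).1 ?_⟩
    push_cast at hb ⊢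
    linear_combination -hb
  have hqD : ¬ (q : ℤ) ∣ D := by
    intro h
    rw [jacobiSym.eq_zero_iff.2 ⟨hq.ne_zero, ?_⟩] at hJ
    · exact zero_ne_one hJ
    · rw [Int.neg_gcd, Int.gcd_natCast_natCast, Nat.gcd_eq_right (by exact_mod_cast h)]
      exact hq.ne_one
  have hqZ := Nat.prime_iff_prime_int.1 hq
  have hq2a : ¬ (q : ℤ) ∣ 2 * a := by
    intro h
    rcases hqZ.dvd_or_dvd h with h | h
    · exact hq2 ((Nat.prime_dvd_prime_iff_eq hq Nat.prime_two).1 (by exact_mod_cast h))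
    · exact hqD ((dvd_add_right (h.pow two_ne_zero)).1 ha)
  obtain ⟨u, v, huv⟩ := hqZ.coprime_iff_not_dvd.2 hq2a
  obtain ⟨c, hc⟩ := ha
  have huv' : (u * q + v * (2 * a) : 𝓞 F) = 1 := by
    exact_mod_cast congrArg (Int.cast (R := 𝓞 F)) huv
  have hc' : (a ^ 2 + D : 𝓞 F) = q * c := by
    exact_mod_cast congrArg (Int.cast (R := 𝓞 F)) hc
  refine ⟨Ideal.span {(q : 𝓞 F), a + s}, ?_, ?_⟩
  · rw [Ne, Ideal.span_eq_bot]
    intro h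
    exact hq.ne_zero (by exact_mod_cast h q (by simp))
  · rw [Ideal.map_span, Set.image_pair, map_natCast, map_add, map_intCast, hσs,
      ← sub_eq_add_neg, Ideal.span_pair_mul_span_pair]
    refine le_antisymm ?_ ?_
    · rw [Ideal.span_singleton_le_iff_mem]
      have h : (q : 𝓞 F) = u * (q * q) + v * (q * (a - s)) + v * ((a + s) * q) := by
        linear_combination (-q : 𝓞 F) * huv'
      refine Set.mem_of_eq_of_mem h (add_mem (add_mem ?_ ?_) ?_) <;>
        exact Ideal.mul_mem_left _ _ (Ideal.subset_span (by simp))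
    · rw [Ideal.span_le]
      rintro x (rfl | rfl | rfl | rfl)
      · exact Ideal.mem_span_singleton.2 (dvd_mul_right _ _)
      · exact Ideal.mem_span_singleton.2 (dvd_mul_right _ _)
      · exact Ideal.mem_span_singleton.2 (dvd_mul_left _ _)
      · exact Ideal.mem_span_singleton.2 ⟨c, by linear_combination hc' - hs⟩

theorem jacobiSym_eq_neg_one_of_isPrime {F : Type*} [Field F] [NumberField F]
    {σ : 𝓞 F ≃+* 𝓞 F}
    (hfix : ∀ x, σ x = x → ∃ n : ℤ, x = n) {s : 𝓞 F} {D : ℕ} (hD : Squarefree D)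
    (hs : s ^ 2 = -D) (hσs : σ s = -s) {p : ℕ} (hp : p.Prime) (hp2 : p ≠ 2)
    (hpO : (Ideal.span {(p : 𝓞 F)}).IsPrime) : jacobiSym (-D) p = -1 := by
  have : Fact p.Prime := ⟨hp⟩
  have hpO' : Prime (p : 𝓞 F) :=
    (Ideal.span_singleton_prime (by exact_mod_cast hp.ne_zero)).1 hpO
  have hpZ := Nat.prime_iff_prime_int.1 hp
  have hdvd {m n : ℤ} (h : (m : 𝓞 F) ∣ n) : m ∣ n := intCast_dvd_intCast_of_fixed hfix h
  have hpD : ¬ (p : ℤ) ∣ D := by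
    intro h
    have h1 : (p : 𝓞 F) ∣ s ^ 2 := by
      rw [hs, dvd_neg]
      exact_mod_cast (Nat.cast_dvd_cast (α := 𝓞 F) (by exact_mod_cast h : p ∣ D))
    obtain ⟨t, ht⟩ := hpO'.dvd_of_dvd_pow h1
    have h2 : ((p * p : ℤ) : 𝓞 F) ∣ (D : ℤ) := by
      push_cast
      exact ⟨-t ^ 2, by linear_combination hs - (s + p * t) * ht⟩
    have h3 := hD p (by exact_mod_cast hdvd h2)
    exact hp.ne_one (Nat.isUnit_iff.1 h3)
  rcases jacobiSym.eq_one_or_neg_one (a := -D) (b := p) (by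
    rw [Int.neg_gcd, Int.gcd_natCast_natCast, Nat.gcd_comm]
    exact (hp.coprime_iff_not_dvd).2 (by exact_mod_cast hpD)) with hJ | hJ
  · exfalso
    obtain ⟨b, hb⟩ := ZMod.isSquare_of_jacobiSym_eq_one hJ
    obtain ⟨a, rfl⟩ := ZMod.intCast_surjective b
    have ha : (p : ℤ) ∣ a ^ 2 + D := by
      refine (ZMod.intCast_zmod_eq_zero_iff_dvd _ p).1 ?_
      push_cast at hb ⊢
      linear_combination -hb
    have ha' : (p : 𝓞 F) ∣ (a + s) * (a - s) := by
      rw [show (a + s) * (a - s) = ((a ^ 2 + D : ℤ) : 𝓞 F) by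
        push_cast; linear_combination -hs]
      exact_mod_cast (Int.cast_dvd_cast (α := 𝓞 F) _ _ ha)
    have h2a : (p : 𝓞 F) ∣ (a + s) + (a - s) := by
      rcases hpO'.dvd_or_dvd ha' with h | h
      · refine dvd_add h ?_
        have := map_dvd σ h
        rwa [map_natCast, map_add, map_intCast, hσs, ← sub_eq_add_neg] at this
      · refine dvd_add ?_ h
        have := map_dvd σ h
        rwa [map_natCast, map_sub, map_intCast, hσs, sub_neg_eq_add] at this
    have h2a' : (p : ℤ) ∣ 2 * a := by
      refine hdvd ?_
      push_cast
      rwa [show (a + s) + (a - s) = 2 * a by ring] at h2a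
    rcases hpZ.dvd_or_dvd h2a' with h | h
    · exact hp2 ((Nat.prime_dvd_prime_iff_eq hp Nat.prime_two).1 (by exact_mod_cast h))
    · exact hpD ((dvd_add_right (h.pow two_ne_zero)).1 ha)
  · exact hJ

theorem mod_eight_eq_three_of_isPrime_two {F : Type*} [Field F] [NumberField F]
    {σ : 𝓞 F ≃+* 𝓞 F} (hinv : ∀ x, σ (σ x) = x)
    (hfix : ∀ x, σ x = x → ∃ n : ℤ, x = n) {s : 𝓞 F} {D : ℕ} (hD : Squarefree D)
    (hs : s ^ 2 = -D) (hσs : σ s = -s)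
    (h2O : (Ideal.span {(2 : 𝓞 F)}).IsPrime) : D % 8 = 3 := by
  have h2 : Prime (2 : 𝓞 F) := (Ideal.span_singleton_prime two_ne_zero).1 h2O
  have hdvd {m n : ℤ} (h : (m : 𝓞 F) ∣ n) : m ∣ n := intCast_dvd_intCast_of_fixed hfix h
  obtain ⟨α, hα⟩ : (2 : 𝓞 F) ∣ s + D := by
    refine h2.dvd_of_dvd_pow (n := 2) ?_
    obtain ⟨l, hl⟩ : 2 ∣ D * D - D := by
      rw [← Nat.mul_sub_one]; exact (Nat.even_mul_pred_self D).two_dvd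
    have hl' : (D : 𝓞 F) * D = D + 2 * l := by
      have := Nat.le_mul_self D
      exact_mod_cast (by omega : D * D = D + 2 * l)
    exact ⟨l + s * D, by linear_combination hs + hl'⟩
  have hασ : 2 * σ α = -s + D := by
    rw [← hσs, ← map_natCast σ D, ← map_add, hα, map_mul, map_ofNat]
  have h4 : 4 * (α * σ α) = D ^ 2 + D := by
    linear_combination -2 * σ α * hα - (s + D) * (-hασ) - hs
  obtain ⟨k, hk⟩ : (4 : ℤ) ∣ D ^ 2 + D := by
    refine hdvd ?_
    push_cast
    exact ⟨_, h4.symm⟩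
  have hD4 : D % 4 ≠ 0 := by
    intro h
    have := hD 2 (by omega)
    simp at this
  have hD3 : D % 4 = 3 := by
    have hm : ((D : ℤ) ^ 2 + D) % 4 = 0 := by omega
    have : (D : ℤ) % 4 = 0 ∨ (D : ℤ) % 4 = 1 ∨ (D : ℤ) % 4 = 2 ∨ (D : ℤ) % 4 = 3 := by omega
    rcases this with h | h | h | h <;> simp [pow_two, Int.add_emod, Int.mul_emod, h] at hm <;> omega
  by_contra hc
  have hk2 : (2 : ℤ) ∣ k := by
    obtain ⟨j, hj⟩ : ∃ j : ℤ, (D : ℤ) = 8 * j + 7 := ⟨D / 8, by omega⟩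
    rw [hj] at hk
    exact ⟨8 * j ^ 2 + 15 * j + 7, by linarith⟩
  have hkα : α * σ α = k := by
    refine mul_left_cancel₀ (by norm_num : (4 : 𝓞 F) ≠ 0) ?_
    rw [h4]
    exact_mod_cast congrArg (Int.cast (R := 𝓞 F)) hk
  have h2α : (2 : 𝓞 F) ∣ α + σ α := by
    have h : (2 : 𝓞 F) ∣ α * σ α := by
      rw [hkα]
      exact_mod_cast Int.cast_dvd_cast (α := 𝓞 F) _ _ hk2
    have hσ2 : σ 2 = 2 := map_ofNat σ 2
    rcases h2.dvd_or_dvd h with h | h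
    · exact dvd_add h (hσ2 ▸ map_dvd σ h)
    · exact dvd_add (hinv α ▸ hσ2 ▸ map_dvd σ h) h
  have hsum : α + σ α = D := by
    refine mul_left_cancel₀ (two_ne_zero (α := 𝓞 F)) ?_
    linear_combination -hα + hασ
  rw [hsum] at h2α
  have : (2 : ℤ) ∣ D := hdvd (by exact_mod_cast h2α)
  omega
theorem exists_ringOfIntegers_im_ne_zero (K : IntermediateField ℚ ℂ) [NumberField ↥K]
    (himag : ∃ x : ↥K, (x : ℂ).im ≠ 0) :
    ∃ y : 𝓞 ↥K, ((y : ↥K) : ℂ).im ≠ 0 := by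
  by_contra! h
  obtain ⟨x, hx⟩ := himag
  obtain ⟨a, b, -, rfl⟩ := IsFractionRing.div_surjective (A := 𝓞 ↥K) x
  refine hx ?_
  have ha : ((a : ↥K) : ℂ) = ((((a : ↥K) : ℂ).re : ℝ) : ℂ) := Complex.ext (by simp) (by simp [h])
  have hb : ((b : ↥K) : ℂ) = ((((b : ↥K) : ℂ).re : ℝ) : ℂ) := Complex.ext (by simp) (by simp [h])
  change (((a : ↥K) / (b : ↥K) : ↥K) : ℂ).im = 0
  push_cast
  rw [ha, hb, ← Complex.ofReal_div, Complex.ofReal_im]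

theorem conj_conj_ringOfIntegers {K : IntermediateField ℚ ℂ} {σ : 𝓞 ↥K ≃+* 𝓞 ↥K}
    (hσ : ∀ x : 𝓞 ↥K, ((σ x : ↥K) : ℂ) = starRingEnd ℂ ((x : ↥K) : ℂ)) (x : 𝓞 ↥K) :
    σ (σ x) = x := by
  apply RingOfIntegers.ext
  apply Subtype.ext
  rw [hσ, hσ, Complex.conj_conj]

theorem eq_intCast_of_conj_eq {K : IntermediateField ℚ ℂ} [NumberField ↥K]
    {σ : 𝓞 ↥K ≃+* 𝓞 ↥K} (hdeg : Module.finrank ℚ ↥K = 2)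
    (himag : ∃ x : ↥K, (x : ℂ).im ≠ 0)
    (hσ : ∀ x : 𝓞 ↥K, ((σ x : ↥K) : ℂ) = starRingEnd ℂ ((x : ↥K) : ℂ)) (x : 𝓞 ↥K)
    (hx : σ x = x) : ∃ n : ℤ, x = n := by
  have him : ((x : ↥K) : ℂ).im = 0 := by
    rw [← Complex.conj_eq_iff_im, ← hσ, hx]
  obtain ⟨y, hy⟩ := himag
  have hli : LinearIndependent ℚ ![(1 : ↥K), y] := by
    rw [LinearIndependent.pair_iff]
    intro a b hab
    have h : ((a : ℂ) + b * y) = 0 := by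
      have := congrArg (fun z : ↥K ↦ (z : ℂ)) hab
      simpa [Algebra.smul_def] using this
    have hb : b = 0 := by
      have := congrArg Complex.im h
      simpa [hy] using this
    subst hb
    simpa using h
  have hspan := hli.span_eq_top_of_card_eq_finrank' (by simp [hdeg])
  have hmem : (x : ↥K) ∈ Submodule.span ℚ (Set.range ![(1 : ↥K), y]) := hspan ▸ Submodule.mem_top
  rw [Matrix.range_cons, Matrix.range_cons, Matrix.range_empty, Set.union_empty,
    Set.singleton_union, Submodule.mem_span_pair] at hmem
  obtain ⟨a, b, hab⟩ := hmem
  have h : ((a : ℂ) + b * y) = ((x : ↥K) : ℂ) := by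
    have := congrArg (fun z : ↥K ↦ (z : ℂ)) hab
    simpa [Algebra.smul_def] using this
  have hb : b = 0 := by
    have := congrArg Complex.im h
    simpa [hy, him] using this
  subst hb
  have hxa : (x : ↥K) = algebraMap ℚ ↥K a := by
    rw [← hab]
    simp [Algebra.smul_def]
  have hint : IsIntegral ℤ (algebraMap ℚ ↥K a) := hxa ▸ x.isIntegral_coe
  rw [isIntegral_algebraMap_iff (algebraMap ℚ ↥K).injective] at hint
  obtain ⟨n, rfl⟩ := IsIntegrallyClosed.isIntegral_iff.1 hint
  refine ⟨n, RingOfIntegers.ext ?_⟩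
  rw [hxa]
  simp

theorem exists_sq_eq_neg_squarefree {K : IntermediateField ℚ ℂ} [NumberField ↥K]
    {σ : 𝓞 ↥K ≃+* 𝓞 ↥K} (hdeg : Module.finrank ℚ ↥K = 2)
    (himag : ∃ x : ↥K, (x : ℂ).im ≠ 0)
    (hσ : ∀ x : 𝓞 ↥K, ((σ x : ↥K) : ℂ) = starRingEnd ℂ ((x : ↥K) : ℂ)) :
    ∃ (D : ℕ) (s : 𝓞 ↥K), Squarefree D ∧ s ^ 2 = -D ∧ σ s = -s := by
  obtain ⟨y, hy⟩ := exists_ringOfIntegers_im_ne_zero K himag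
  have hinv := conj_conj_ringOfIntegers hσ
  obtain ⟨δ, hδ⟩ : ∃ δ, δ = y - σ y := ⟨_, rfl⟩
  have hσδ : σ δ = -δ := by rw [hδ, map_sub, hinv, neg_sub]
  obtain ⟨n, hn⟩ := eq_intCast_of_conj_eq hdeg himag hσ (δ ^ 2) (by rw [map_pow, hσδ, neg_sq])
  obtain ⟨r, hr, hδr⟩ : ∃ r : ℝ, r ≠ 0 ∧ ((δ : ↥K) : ℂ) = r * Complex.I := by
    refine ⟨2 * ((y : ↥K) : ℂ).im, by simpa using hy, ?_⟩
    rw [hδ]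
    push_cast
    rw [hσ, Complex.sub_conj]
    push_cast
    ring
  have hnr : (n : ℝ) = - r ^ 2 := by
    have h1 := congrArg (fun z : 𝓞 ↥K ↦ ((z : ↥K) : ℂ)) hn
    simp only [map_pow, map_intCast] at h1
    push_cast at h1
    rw [hδr, mul_pow, Complex.I_sq] at h1
    have h2 : ((n : ℝ) : ℂ) = ((-r ^ 2 : ℝ) : ℂ) := by
      push_cast
      rw [← h1]; ring
    exact_mod_cast h2
  have hn0 : n < 0 := by
    have : (n : ℝ) < 0 := by rw [hnr]; have := pow_pos (abs_pos.2 hr) 2; simp at this ⊢; positivity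
    exact_mod_cast this
  obtain ⟨D, c, hDc, hD⟩ := Nat.sq_mul_squarefree n.natAbs
  have hc : c ≠ 0 := by
    rintro rfl
    omega
  have hnD : (n : ↥K) = -(c ^ 2 * D) := by
    have : n = -(c ^ 2 * D : ℕ) := by rw [hDc]; omega
    rw [this]
    push_cast
    ring
  have hcK : (c : ↥K) ≠ 0 := by exact_mod_cast hc
  have hsq : ((δ : ↥K) / c) ^ 2 = -D := by
    have h1 := congrArg (fun z : 𝓞 ↥K ↦ (z : ↥K)) hn
    simp only [map_pow, map_intCast] at h1
    rw [div_pow, h1, hnD]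
    field_simp
  have hint : IsIntegral ℤ ((δ : ↥K) / c) := by
    refine IsIntegral.of_pow two_pos ?_
    rw [hsq]
    have := isIntegral_algebraMap (R := ℤ) (A := ↥K) (x := (-D : ℤ))
    simpa using this
  obtain ⟨s, hs⟩ : ∃ s : 𝓞 ↥K, (s : ↥K) = δ / c := ⟨⟨_, hint⟩, rfl⟩
  refine ⟨D, s, hD, RingOfIntegers.ext ?_, RingOfIntegers.ext (Subtype.ext ?_)⟩
  · have h : ((s ^ 2 : 𝓞 ↥K) : ↥K) = (s : ↥K) ^ 2 := rfl
    rw [h, hs, hsq]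
    simp
  · have h : ((-s : 𝓞 ↥K) : ↥K) = -(s : ↥K) := rfl
    rw [hσ, h, hs]
    push_cast
    simp [hδr, neg_div]

theorem span_singleton_sup_eq_top_iff {R : Type*} [CommRing R] (I : Ideal R) (w : R) :
    Ideal.span {w} ⊔ I = ⊤ ↔ IsUnit (Ideal.Quotient.mk I w) := by
  rw [Ideal.eq_top_iff_one, Ideal.mem_span_singleton_sup]
  constructor
  · rintro ⟨r, f, hf, h⟩
    refine IsUnit.of_mul_eq_one (Ideal.Quotient.mk I r) ?_
    have := congrArg (Ideal.Quotient.mk I) h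
    rw [map_add, map_mul, map_one, Ideal.Quotient.eq_zero_iff_mem.2 hf, add_zero] at this
    rw [mul_comm, this]
  · rintro ⟨u, hu⟩
    obtain ⟨r, hr⟩ := Ideal.Quotient.mk_surjective (↑u⁻¹ : R ⧸ I)
    refine ⟨r, 1 - r * w, ?_, by ring⟩
    rw [← Ideal.Quotient.eq_zero_iff_mem, map_sub, map_mul, hr, ← hu]
    simp

theorem exists_nat_prime_mem {F : Type*} [Field F] [NumberField F] {P : Ideal (𝓞 F)}
    (hP : P.IsPrime) (hP0 : P ≠ ⊥) : ∃ p : ℕ, p.Prime ∧ (p : 𝓞 F) ∈ P := by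
  obtain ⟨p, hp⟩ := CharP.exists (𝓞 F ⧸ P)
  have hmem (n : ℕ) : (n : 𝓞 F) ∈ P ↔ p ∣ n := by
    rw [← Ideal.Quotient.eq_zero_iff_mem, map_natCast, CharP.cast_eq_zero_iff (𝓞 F ⧸ P) p]
  refine ⟨p, (CharP.char_is_prime_or_zero (𝓞 F ⧸ P) p).resolve_right ?_, (hmem p).2 dvd_rfl⟩
  rintro rfl
  have := (hmem _).1 (Ideal.absNorm_mem P)
  rw [zero_dvd_iff, Ideal.absNorm_eq_zero_iff] at this
  exact hP0 this

/-- A prime of a quadratic field containing a non-inert rational prime `p` is a factor of a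
factorization of `p` into two primes of norm `p`. -/
theorem exists_span_eq_mul_of_not_isPrime {F : Type*} [Field F] [NumberField F]
    (hdeg : Module.finrank ℚ F = 2) {p : ℕ} (hp : p.Prime) {P : Ideal (𝓞 F)} (hP : P.IsPrime)
    (hpP : (p : 𝓞 F) ∈ P) (hp' : ¬ (Ideal.span {(p : 𝓞 F)}).IsPrime) :
    ∃ Q : Ideal (𝓞 F), Q.IsPrime ∧ Ideal.span {(p : 𝓞 F)} = P * Q ∧ Ideal.absNorm P = p := by
  obtain ⟨Q, hQ⟩ := Ideal.dvd_iff_le.2 ((Ideal.span_singleton_le_iff_mem P).2 hpP)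
  have hN : Ideal.absNorm P * Ideal.absNorm Q = p ^ 2 := by
    rw [← map_mul, ← hQ, Ideal.absNorm_span_natCast, RingOfIntegers.rank, hdeg]
  rw [Nat.Prime.mul_eq_prime_sq_iff hp] at hN
  · refine ⟨Q, Ideal.isPrime_of_irreducible_absNorm ?_, hQ, hN.1⟩
    rw [hN.2]
    exact hp
  · rw [Ne, Ideal.absNorm_eq_one_iff]
    exact hP.ne_top
  · rw [Ne, Ideal.absNorm_eq_one_iff]
    rintro rfl
    rw [← Ideal.one_eq_top, mul_one] at hQ
    exact hp' (hQ ▸ hP)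

/-- If `p` is inert and coprime to a nonzero ideal `I`, some split prime is `-p` modulo `I`. -/
theorem exists_split_prime_add_mem {F : Type*} [Field F] [NumberField F] {σ : 𝓞 F ≃+* 𝓞 F}
    (hinv : ∀ x, σ (σ x) = x) (hfix : ∀ x, σ x = x → ∃ n : ℤ, x = n)
    {s : 𝓞 F} {D : ℕ} (hD : Squarefree D) (hs : s ^ 2 = -D) (hσs : σ s = -s)
    {I : Ideal (𝓞 F)} {p : ℕ} (hp : p.Prime)
    (hpI : Ideal.span {(p : 𝓞 F)} ⊔ I = ⊤) (hpO : (Ideal.span {(p : 𝓞 F)}).IsPrime) :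
    ∃ q : ℕ, q.Prime ∧ (q + p : 𝓞 F) ∈ I ∧
      ∃ P : Ideal (𝓞 F), P ≠ ⊥ ∧ Ideal.span {(q : 𝓞 F)} = P * Ideal.map σ P := by
  have hpO' : Prime (p : 𝓞 F) :=
    (Ideal.span_singleton_prime (by exact_mod_cast hp.ne_zero)).1 hpO
  rw [Ideal.eq_top_iff_one, Ideal.mem_span_singleton_sup] at hpI
  obtain ⟨r, f, hf, hrf⟩ := hpI
  obtain ⟨m, hm⟩ := hfix (f * σ f) (by rw [map_mul, hinv, mul_comm])
  have hpf : ¬ (p : 𝓞 F) ∣ f := fun h ↦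
    hpO'.not_dvd_one (hrf ▸ dvd_add (dvd_mul_left _ _) h)
  have hpm : ¬ (p : ℤ) ∣ m := by
    intro h
    have h1 : (p : 𝓞 F) ∣ f * σ f := by
      rw [hm]
      exact_mod_cast Int.cast_dvd_cast (α := 𝓞 F) _ _ h
    rcases hpO'.dvd_or_dvd h1 with h | h
    · exact hpf h
    · have := map_dvd σ h
      rw [hinv, map_natCast] at this
      exact hpf this
  have hmI : (m : 𝓞 F) ∈ I := by
    rw [← hm]
    exact I.mul_mem_right _ hf
  have hpm' : p.Coprime m.natAbs :=
    hp.coprime_iff_not_dvd.2 (by rwa [← Int.natCast_dvd])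
  have hm0 : 0 < m.natAbs := by
    rw [Int.natAbs_pos]
    rintro rfl
    exact hpm (dvd_zero _)
  obtain ⟨q, hq, hq2, hdvd, hJ⟩ : ∃ q : ℕ, q.Prime ∧ q ≠ 2 ∧ m.natAbs ∣ q + p ∧
      jacobiSym (-D) q = 1 := by
    rcases eq_or_ne p 2 with rfl | hp2
    · exact exists_prime_dvd_add_two (mod_eight_eq_three_of_isPrime_two hinv hfix hD hs hσs
        (by exact_mod_cast hpO)) (Nat.coprime_two_left.1 hpm')
    · exact exists_prime_dvd_add_of_jacobiSym (Nat.pos_of_ne_zero hD.ne_zero) hm0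
        (hp.odd_of_ne_two hp2) hpm'
        (jacobiSym_eq_neg_one_of_isPrime hfix hD hs hσs hp hp2 hpO)
  refine ⟨q, hq, ?_, exists_span_eq_mul_map hs hσs hq hq2 hJ⟩
  obtain ⟨k, hk⟩ := Int.natAbs_dvd.1 (Int.natCast_dvd_natCast.2 hdvd)
  have : (q + p : 𝓞 F) = m * k := by exact_mod_cast congrArg (Int.cast (R := 𝓞 F)) hk
  rw [this]
  exact I.mul_mem_right _ hmI

/-- Equivariance of a Hecke-type character `φ` of an imaginary quadratic
field `K ⊂ ℂ` under complex conjugation is equivalent to the associated Dirichlet character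
`κ₁(n) = φ(nO)/n` being the quadratic character attached to `K/ℚ`. -/
theorem equivariant_iff_kappa_quadratic
    (K : IntermediateField ℚ ℂ) [NumberField ↥K]
    (hdeg : Module.finrank ℚ ↥K = 2) (himag : ∃ x : ↥K, (x : ℂ).im ≠ 0)
    -- σ is the nontrivial automorphism of K (complex conjugation), acting on 𝓞 K
    (σ : 𝓞 ↥K ≃+* 𝓞 ↥K)
    (hσ : ∀ x : 𝓞 ↥K, ((σ x : ↥K) : ℂ) = starRingEnd ℂ ((x : ↥K) : ℂ))
    -- 𝔣 is a nonzero ideal stable under conjugation, divisible by all ramified primes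
    (𝔣 : Ideal (𝓞 ↥K)) (h𝔣 : 𝔣 ≠ ⊥) (hσ𝔣 : Ideal.map σ 𝔣 = 𝔣)
    (hram : ∀ 𝔭 : Ideal (𝓞 ↥K), 𝔭.IsPrime → 𝔭 ≠ ⊥ →
      (∃ p : ℕ, p.Prime ∧ (p : 𝓞 ↥K) ∈ 𝔭 ^ 2) → 𝔭 ∣ 𝔣)
    -- φ is multiplicative on nonzero ideals
    (φ : Ideal (𝓞 ↥K) → ℂ)
    (hmul : ∀ 𝔞 𝔟 : Ideal (𝓞 ↥K), 𝔞 ≠ ⊥ → 𝔟 ≠ ⊥ → φ (𝔞 * 𝔟) = φ 𝔞 * φ 𝔟)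
    -- φ vanishes exactly on the nonzero ideals not coprime to 𝔣
    (hvanish : ∀ 𝔞 : Ideal (𝓞 ↥K), 𝔞 ≠ ⊥ → (φ 𝔞 = 0 ↔ ¬ 𝔞 ⊔ 𝔣 = ⊤))
    -- φ(𝔞) ⬝ conj (φ(𝔞)) = N𝔞 for 𝔞 coprime to 𝔣
    (hnorm : ∀ 𝔞 : Ideal (𝓞 ↥K), 𝔞 ≠ ⊥ → 𝔞 ⊔ 𝔣 = ⊤ →
      φ 𝔞 * starRingEnd ℂ (φ 𝔞) = (Ideal.absNorm 𝔞 : ℂ))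
    -- on principal ideals φ is given by a character ε₁ of (𝓞 K ⧸ 𝔣)ˣ
    (ε₁ : ((𝓞 ↥K) ⧸ 𝔣)ˣ → ℂˣ)
    (hε₁ : ∀ (w : 𝓞 ↥K) (hw : IsUnit (Ideal.Quotient.mk 𝔣 w)),
      φ (Ideal.span {w}) = (ε₁ hw.unit : ℂ) * ((w : ↥K) : ℂ)) :
    -- the equivalence
    (∀ 𝔞 : Ideal (𝓞 ↥K), 𝔞 ≠ ⊥ → φ (Ideal.map σ 𝔞) = starRingEnd ℂ (φ 𝔞)) ↔
    ((∀ n : ℤ, n ≠ 0 → Ideal.span {(n : 𝓞 ↥K)} ⊔ 𝔣 = ⊤ →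
        φ (Ideal.span {(n : 𝓞 ↥K)}) / (n : ℂ) = 1 ∨
        φ (Ideal.span {(n : 𝓞 ↥K)}) / (n : ℂ) = -1) ∧
      (∀ p : ℕ, p.Prime → Ideal.span {(p : 𝓞 ↥K)} ⊔ 𝔣 = ⊤ →
        ((∃ 𝔭 𝔮 : Ideal (𝓞 ↥K), 𝔭.IsPrime ∧ 𝔮.IsPrime ∧ 𝔭 ≠ 𝔮 ∧
            Ideal.span {(p : 𝓞 ↥K)} = 𝔭 * 𝔮) →
          φ (Ideal.span {(p : 𝓞 ↥K)}) / (p : ℂ) = 1) ∧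
        ((Ideal.span {(p : 𝓞 ↥K)}).IsPrime →
          φ (Ideal.span {(p : 𝓞 ↥K)}) / (p : ℂ) = -1))) := by
  have hinv := conj_conj_ringOfIntegers hσ
  have hfix := eq_intCast_of_conj_eq hdeg himag hσ
  have hcop_map {I : Ideal (𝓞 ↥K)} (h : I ⊔ 𝔣 = ⊤) : Ideal.map σ I ⊔ 𝔣 = ⊤ := by
    have := congrArg (Ideal.map σ) h
    rwa [Ideal.map_sup, hσ𝔣, Ideal.map_top] at this
  have hmap_ne {I : Ideal (𝓞 ↥K)} (h : I ≠ ⊥) : Ideal.map σ I ≠ ⊥ := by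
    intro h0
    apply h
    rw [← ideal_map_map_of_involutive hinv I, h0, Ideal.map_bot]
  have hmap_int (n : ℤ) : Ideal.map σ (Ideal.span {(n : 𝓞 ↥K)}) = Ideal.span {(n : 𝓞 ↥K)} := by
    rw [Ideal.map_span, Set.image_singleton, map_intCast]
  have hspan_ne {p : ℕ} (hp : p.Prime) : Ideal.span {(p : 𝓞 ↥K)} ≠ ⊥ := by
    simpa using hp.ne_zero
  constructor
  · intro heq
    have hpm (n : ℤ) (hn : n ≠ 0) (hco : Ideal.span {(n : 𝓞 ↥K)} ⊔ 𝔣 = ⊤) :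
        φ (Ideal.span {(n : 𝓞 ↥K)}) / (n : ℂ) = 1 ∨
        φ (Ideal.span {(n : 𝓞 ↥K)}) / (n : ℂ) = -1 := by
      have hne : Ideal.span {(n : 𝓞 ↥K)} ≠ ⊥ := by simpa using hn
      have h1 := heq _ hne
      rw [hmap_int] at h1
      have h2 := hnorm _ hne hco
      have hN : (Ideal.absNorm (Ideal.span {(n : 𝓞 ↥K)}) : ℂ) = (n : ℂ) ^ 2 := by
        have h : Ideal.span {(n : 𝓞 ↥K)} = Ideal.span {((n.natAbs : ℕ) : 𝓞 ↥K)} := by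
          rcases Int.natAbs_eq n with h | h
          · conv_lhs => rw [h, Int.cast_natCast]
          · conv_lhs => rw [h, Int.cast_neg, Int.cast_natCast, Ideal.span_singleton_neg]
        rw [h, Ideal.absNorm_span_natCast, RingOfIntegers.rank, hdeg]
        rw [Nat.cast_pow, Nat.cast_natAbs, ← Int.cast_pow, sq_abs, Int.cast_pow]
      rw [← h1, hN] at h2
      have hn' : (n : ℂ) ≠ 0 := by exact_mod_cast hn
      rw [← sq_eq_one_iff, div_pow, div_eq_one_iff_eq (pow_ne_zero 2 hn'), sq, h2]
    have hsplit {q : ℕ} (hq : q.Prime) (hco : Ideal.span {(q : 𝓞 ↥K)} ⊔ 𝔣 = ⊤)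
        {P : Ideal (𝓞 ↥K)} (hP : P ≠ ⊥) (h : Ideal.span {(q : 𝓞 ↥K)} = P * Ideal.map σ P) :
        φ (Ideal.span {(q : 𝓞 ↥K)}) / (q : ℂ) = 1 := by
      have h1 := hpm q (by exact_mod_cast hq.ne_zero) (by exact_mod_cast hco)
      rw [Int.cast_natCast, Int.cast_natCast] at h1
      refine h1.resolve_right fun h2 ↦ ?_
      rw [h, hmul _ _ hP (hmap_ne hP), heq P hP, Complex.mul_conj,
        div_eq_iff (by exact_mod_cast hq.ne_zero)] at h2
      have h3 : Complex.normSq (φ P) = -(q : ℝ) := by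
        have h4 : ((Complex.normSq (φ P) : ℝ) : ℂ) = ((-(q : ℝ) : ℝ) : ℂ) := by
          rw [h2]; push_cast; ring
        exact_mod_cast h4
      have h5 := Complex.normSq_nonneg (φ P)
      have h6 : (0 : ℝ) < q := by exact_mod_cast hq.pos
      linarith
    refine ⟨hpm, fun p hp hco ↦ ⟨?_, fun hpO ↦ ?_⟩⟩
    · rintro ⟨P, Q, hP, hQ, hPQ, h⟩
      refine hsplit hp hco (P := P) ?_ ?_
      · rintro rfl
        exact hspan_ne hp (h.trans (Ideal.bot_mul Q))
      · rw [map_eq_of_span_eq_mul hinv hfix hp hP hQ hPQ h, h]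
    · obtain ⟨D, s, hD, hs, hσs⟩ := exists_sq_eq_neg_squarefree hdeg himag hσ
      obtain ⟨q, hq, hqp, P, hP, hqP⟩ :=
        exists_split_prime_add_mem hinv hfix hD hs hσs hp hco hpO
      have hmk : Ideal.Quotient.mk 𝔣 (q : 𝓞 ↥K) = Ideal.Quotient.mk 𝔣 (-(p : 𝓞 ↥K)) := by
        rw [Ideal.Quotient.eq, sub_neg_eq_add]
        exact hqp
      have hup : IsUnit (Ideal.Quotient.mk 𝔣 (-(p : 𝓞 ↥K))) := by
        rwa [← span_singleton_sup_eq_top_iff, Ideal.span_singleton_neg]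
      have huq : IsUnit (Ideal.Quotient.mk 𝔣 (q : 𝓞 ↥K)) := hmk ▸ hup
      have h1 := hsplit hq ((span_singleton_sup_eq_top_iff _ _).2 huq) hP hqP
      have hqC : (q : ℂ) ≠ 0 := by exact_mod_cast hq.ne_zero
      have hpC : (p : ℂ) ≠ 0 := by exact_mod_cast hp.ne_zero
      have hunit : hup.unit = huq.unit := Units.ext hmk.symm
      have h2 := hε₁ _ huq
      have h3 := hε₁ _ hup
      rw [Ideal.span_singleton_neg, hunit] at h3
      rw [h2] at h1
      have hqK : (((q : 𝓞 ↥K) : ↥K) : ℂ) = q := by simp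
      have hpK : (((-p : 𝓞 ↥K) : ↥K) : ℂ) = -p := by simp
      rw [hqK, mul_div_assoc, div_self hqC, mul_one] at h1
      rw [h3, hpK, h1, one_mul, neg_div, div_self hpC]
  · rintro ⟨-, h2⟩ I hI
    have htop : φ ⊤ = 1 := by
      have h0 : φ ⊤ ≠ 0 := fun h ↦ (hvanish ⊤ top_ne_bot).1 h (top_sup_eq 𝔣)
      have h1 := hmul ⊤ ⊤ top_ne_bot top_ne_bot
      rw [Ideal.mul_top] at h1
      exact (mul_eq_left₀ h0).1 h1.symm
    have hprime (P : Ideal (𝓞 ↥K)) (hP : P.IsPrime) (hP0 : P ≠ ⊥) :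
        φ (Ideal.map σ P) = starRingEnd ℂ (φ P) := by
      by_cases hco : P ⊔ 𝔣 = ⊤
      · obtain ⟨p, hp, hpP⟩ := exists_nat_prime_mem hP hP0
        have hpC : (p : ℂ) ≠ 0 := by exact_mod_cast hp.ne_zero
        by_cases hpO : (Ideal.span {(p : 𝓞 ↥K)}).IsPrime
        · have hPp : Ideal.span {(p : 𝓞 ↥K)} = P :=
            (hpO.isMaximal (hspan_ne hp)).eq_of_le hP.ne_top
              ((Ideal.span_singleton_le_iff_mem P).2 hpP)
          have hσP : Ideal.map σ P = P := by
            have := hmap_int p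
            rwa [Int.cast_natCast, hPp] at this
          have h3 := (h2 p hp (hPp ▸ hco)).2 hpO
          rw [hPp, div_eq_iff hpC] at h3
          rw [hσP, h3]
          simp
        · obtain ⟨Q, hQ, hPQ, hN⟩ := exists_span_eq_mul_of_not_isPrime hdeg hp hP hpP hpO
          have hne : P ≠ Q := by
            rintro rfl
            have hdvd := hram P hP hP0 ⟨p, hp, by
              rw [sq, ← hPQ]
              exact Ideal.mem_span_singleton_self _⟩
            rw [sup_eq_left.2 (Ideal.dvd_iff_le.1 hdvd)] at hco
            exact hP.ne_top hco
          have hσP := map_eq_of_span_eq_mul hinv hfix hp hP hQ hne hPQ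
          have hpco : Ideal.span {(p : 𝓞 ↥K)} ⊔ 𝔣 = ⊤ := by
            rw [hPQ, ← hσP, ← Ideal.isCoprime_iff_sup_eq]
            exact (Ideal.isCoprime_iff_sup_eq.2 hco).mul_left
              (Ideal.isCoprime_iff_sup_eq.2 (hcop_map hco))
          have h3 := (h2 p hp hpco).1 ⟨P, Q, hP, hQ, hne, hPQ⟩
          rw [div_eq_iff hpC, one_mul, hPQ, ← hσP, hmul _ _ hP0 (hmap_ne hP0)] at h3
          have h4 := hnorm P hP0 hco
          rw [hN, ← h3] at h4
          have h0 : φ P ≠ 0 := fun h ↦ (hvanish P hP0).1 h hco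
          exact (mul_left_cancel₀ h0 h4).symm
      · rw [(hvanish P hP0).2 hco, (hvanish _ (hmap_ne hP0)).2, map_zero]
        intro h
        apply hco
        rw [← ideal_map_map_of_involutive hinv P]
        exact hcop_map h
    induction I using UniqueFactorizationMonoid.induction_on_prime with
    | h₁ => exact absurd rfl hI
    | h₂ J hJ =>
      rw [Ideal.isUnit_iff.1 hJ, Ideal.map_top, htop, map_one]
    | h₃ J P hJ hP ih =>
      have hP0 : P ≠ ⊥ := hP.ne_zero
      have hJ0 : J ≠ ⊥ := hJ
      rw [Ideal.map_mul, hmul _ _ (hmap_ne hP0) (hmap_ne hJ0), hmul _ _ hP0 hJ0, map_mul,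
        ih hJ0, hprime P (Ideal.isPrime_of_prime hP) hP0]
end

section
/- Let P be a finite set of rational primes and, for each p ∈ P, let α_p, β_p ∈ ℤ_p be algebraic over ℚ and not both zero. Fix a real number c < 1/2. Then there exists Q such that M(q, q^c) = 0 for every positive integer q > Q all of whose prime factors lie in P. -/
instance (p : Nat.Primes) : Fact (p : ℕ).Prime := ⟨p.2⟩

/-- `M(q, t)`: the number of pairs of rational integers `(u, v)` with
`uβ_p − vα_p ∈ qℤ_p` and `uβ_p − vα_p ≠ 0` for every `p ∈ P`, and `|u|, |v| ≤ t`. -/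
noncomputable def Mcount (P : Finset Nat.Primes) (α β : (p : Nat.Primes) → ℤ_[(p : ℕ)])
    (q : ℕ) (t : ℝ) : ℕ :=
  Set.ncard {uv : ℤ × ℤ |
    (∀ p ∈ P, (q : ℤ_[(p : ℕ)]) ∣
      ((uv.1 : ℤ_[(p : ℕ)]) * β p - (uv.2 : ℤ_[(p : ℕ)]) * α p)) ∧
    (∀ p ∈ P, (uv.1 : ℤ_[(p : ℕ)]) * β p - (uv.2 : ℤ_[(p : ℕ)]) * α p ≠ 0) ∧
    (|uv.1| : ℝ) ≤ t ∧ (|uv.2| : ℝ) ≤ t}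

namespace Roth

section Shift

open MvPolynomial

variable {σ R : Type*} [Fintype σ] [CommRing R]

/-- The substitution `X i ↦ X i + x i`. -/
noncomputable def shift (x : σ → R) : MvPolynomial σ R →ₐ[R] MvPolynomial σ R :=
  aeval fun i => X i + C (x i)

lemma coeff_shift_monomial (x : σ → R) (e τ : σ →₀ ℕ) (c : R) :
    coeff τ (shift x (monomial e c)) =
      c * ∏ i, ((e i).choose (τ i) * x i ^ (e i - τ i)) := by
  classical
  have h1 : shift x (monomial e c) = C c * ∏ i, (X i + C (x i)) ^ (e i) := by
    rw [shift, aeval_monomial, Finsupp.prod_fintype _ _ (by simp)]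
    rfl
  have h2 : ∏ i, (X i + C (x i) : MvPolynomial σ R) ^ (e i) =
      ∑ κ ∈ Fintype.piFinset fun i => Finset.range (e i + 1),
        monomial (Finsupp.equivFunOnFinite.symm κ)
          (∏ i, ((e i).choose (κ i) * x i ^ (e i - κ i))) := by
    simp_rw [add_pow]
    rw [Finset.prod_univ_sum]
    refine Finset.sum_congr rfl fun κ _ => ?_
    rw [monomial_eq, Finsupp.prod_fintype _ _ (by simp), map_prod, ← Finset.prod_mul_distrib]
    refine Finset.prod_congr rfl fun i _ => ?_
    simp only [Finsupp.equivFunOnFinite_symm_apply_apply, map_mul, map_pow, map_natCast]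
    ring
  rw [h1, h2, coeff_C_mul, coeff_sum]
  congr 1
  rw [Finset.sum_eq_single (τ : σ → ℕ)]
  · have : Finsupp.equivFunOnFinite.symm (τ : σ → ℕ) = τ := by ext; simp
    rw [this, coeff_monomial, if_pos rfl]
  · intro κ _ hκ
    rw [coeff_monomial, if_neg]
    rintro rfl
    exact hκ (by ext; simp)
  · intro h
    have : ∃ i, e i < τ i := by
      by_contra! hc
      exact h (by simpa [Fintype.mem_piFinset, Nat.lt_succ_iff] using hc)
    obtain ⟨i, hi⟩ := this
    rw [coeff_monomial]
    split_ifs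
    · exact Finset.prod_eq_zero (Finset.mem_univ i) (by simp [Nat.choose_eq_zero_of_lt hi])
    · rfl

lemma coeff_shift (x : σ → R) (f : MvPolynomial σ R) (τ : σ →₀ ℕ) :
    coeff τ (shift x f) =
      ∑ e ∈ f.support, coeff e f * ∏ i, ((e i).choose (τ i) * x i ^ (e i - τ i)) := by
  conv_lhs => rw [f.as_sum, map_sum, coeff_sum]
  exact Finset.sum_congr rfl fun e _ => coeff_shift_monomial x e τ _

omit [Fintype σ] in
lemma shift_shift (x y : σ → R) (f : MvPolynomial σ R) :
    shift x (shift y f) = shift (x + y) f := by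
  have : (shift x).comp (shift y) = shift (x + y) := by
    refine algHom_ext fun i => ?_
    simp [shift, add_assoc]
  rw [← this]; rfl

omit [Fintype σ] in
lemma shift_eq_zero_iff (x : σ → R) (f : MvPolynomial σ R) : shift x f = 0 ↔ f = 0 := by
  refine ⟨fun h => ?_, fun h => by simp [h]⟩
  have h1 := shift_shift (-x) x f
  have h2 : shift (0 : σ → R) f = f := by
    have : shift (0 : σ → R) = AlgHom.id R _ := algHom_ext fun i => by simp [shift]
    rw [this]; rfl
  rwa [h, map_zero, neg_add_cancel, h2, eq_comm] at h1

lemma exists_lt_of_prod_choose_ne_zero {e τ : σ →₀ ℕ} {x : σ → R}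
    (h : ∏ i, (((e i).choose (τ i) : R) * x i ^ (e i - τ i)) ≠ 0) (i : σ) : τ i ≤ e i := by
  by_contra! hi
  exact h (Finset.prod_eq_zero (Finset.mem_univ i) (by simp [Nat.choose_eq_zero_of_lt hi]))

lemma le_of_coeff_shift_ne_zero {x : σ → R} {f : MvPolynomial σ R} {τ : σ →₀ ℕ}
    (h : coeff τ (shift x f) ≠ 0) (i : σ) : τ i ≤ degreeOf i f := by
  rw [coeff_shift] at h
  obtain ⟨e, he, h⟩ := Finset.exists_ne_zero_of_sum_ne_zero h
  exact (exists_lt_of_prod_choose_ne_zero (right_ne_zero_of_mul h) i).trans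
    (degreeOf_le_iff.1 le_rfl e he)

/-- The Hasse derivative of multi-order `δ`. -/
noncomputable def hasseAux (δ : σ →₀ ℕ) (f : MvPolynomial σ R) : MvPolynomial σ R :=
  ∑ e ∈ f.support, monomial (e - δ) (coeff e f * ∏ i, ((e i).choose (δ i) : R))

lemma coeff_hasseAux (δ τ : σ →₀ ℕ) (f : MvPolynomial σ R) :
    coeff τ (hasseAux δ f) = (∏ i, ((τ i + δ i).choose (δ i) : R)) * coeff (τ + δ) f := by
  classical
  rw [hasseAux, coeff_sum, Finset.sum_eq_single (τ + δ)]
  · rw [coeff_monomial, if_pos (by simp)]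
    simp [mul_comm]
  · intro e _ he
    rw [coeff_monomial]
    split_ifs with h
    · have : ∃ i, e i < δ i := by
        by_contra! hc
        refine he ?_
        rw [← h, tsub_add_cancel_of_le]
        exact hc
      obtain ⟨i, hi⟩ := this
      rw [Finset.prod_eq_zero (Finset.mem_univ i), mul_zero]
      simp [Nat.choose_eq_zero_of_lt hi]
    · rfl
  · intro h
    simp [notMem_support_iff.1 h]

/-- The Hasse derivative of multi-order `δ`, as a linear map. -/
noncomputable def hasse (δ : σ →₀ ℕ) : MvPolynomial σ R →ₗ[R] MvPolynomial σ R where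
  toFun := hasseAux δ
  map_add' f g := by ext τ; simp [coeff_hasseAux, mul_add]
  map_smul' c f := by ext τ; simp [coeff_hasseAux]; ring

lemma coeff_hasse (δ τ : σ →₀ ℕ) (f : MvPolynomial σ R) :
    coeff τ (hasse δ f) = (∏ i, ((τ i + δ i).choose (δ i) : R)) * coeff (τ + δ) f :=
  coeff_hasseAux δ τ f

lemma hasse_monomial (δ e : σ →₀ ℕ) (c : R) :
    hasse δ (monomial e c) = monomial (e - δ) (c * ∏ i, ((e i).choose (δ i) : R)) := by
  classical
  by_cases hc : c = 0
  · simp [hc]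
  · change hasseAux δ _ = _
    rw [hasseAux, support_monomial, if_neg hc]
    simp

lemma degreeOf_hasse_le (δ : σ →₀ ℕ) (f : MvPolynomial σ R) (i : σ) :
    degreeOf i (hasse δ f) ≤ degreeOf i f := by
  rw [degreeOf_le_iff]
  intro τ hτ
  rw [mem_support_iff, coeff_hasse] at hτ
  have := (degreeOf_le_iff (n := i)).1 le_rfl _ (mem_support_iff.2 (right_ne_zero_of_mul hτ))
  exact le_trans (by simp) this

lemma coeff_shift_hasse (x : σ → R) (δ τ : σ →₀ ℕ) (f : MvPolynomial σ R) :
    coeff τ (shift x (hasse δ f)) =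
      (∏ i, ((τ i + δ i).choose (δ i) : R)) * coeff (τ + δ) (shift x f) := by
  induction f using MvPolynomial.induction_on' with
  | monomial e c =>
    rw [hasse_monomial, coeff_shift_monomial, coeff_shift_monomial, mul_assoc, mul_left_comm (∏ i, _) c,
      ← Finset.prod_mul_distrib, ← Finset.prod_mul_distrib]
    congr 1
    refine Finset.prod_congr rfl fun i _ => ?_
    have h := @Nat.choose_mul (e i) (τ i + δ i) (δ i) (by lia)
    rw [Nat.add_sub_cancel] at h
    have h' : ((e i).choose (τ i + δ i) * (τ i + δ i).choose (δ i) : R) =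
      (e i).choose (δ i) * (e i - δ i).choose (τ i) := by exact_mod_cast congrArg (Nat.cast (R := R)) h
    simp only [Finsupp.coe_tsub, Pi.sub_apply, Finsupp.coe_add, Pi.add_apply]
    rw [← mul_assoc, ← h', show e i - δ i - τ i = e i - (τ i + δ i) by lia]
    ring
  | add p q hp hq => simp only [map_add, coeff_add, hp, hq, mul_add]

lemma map_hasse {S : Type*} [CommRing S] (φ : R →+* S) (δ : σ →₀ ℕ) (f : MvPolynomial σ R) :
    map φ (hasse δ f) = hasse δ (map φ f) := by
  ext τ
  simp [coeff_map, coeff_hasse]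

omit [Fintype σ] in
lemma map_shift {S : Type*} [CommRing S] (φ : R →+* S) (x : σ → R) (f : MvPolynomial σ R) :
    map φ (shift x f) = shift (fun i => φ (x i)) (map φ f) := by
  induction f using MvPolynomial.induction_on with
  | C a => simp [shift]
  | add p q hp hq => simp only [map_add, hp, hq]
  | mul_X p i hp => simp only [map_mul, hp]; simp [shift]

end Shift

section Norm

open MvPolynomial

variable {σ : Type*}

/-- The sum of the absolute values of the coefficients. -/
noncomputable def l1 (f : MvPolynomial σ ℤ) : ℝ := ∑ e ∈ f.support, |((coeff e f : ℤ) : ℝ)|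

lemma l1_eq_sum {f : MvPolynomial σ ℤ} {s : Finset (σ →₀ ℕ)} (h : f.support ⊆ s) :
    l1 f = ∑ e ∈ s, |((coeff e f : ℤ) : ℝ)| :=
  Finset.sum_subset h fun e _ he => by simp [notMem_support_iff.1 he]

lemma l1_nonneg (f : MvPolynomial σ ℤ) : 0 ≤ l1 f := Finset.sum_nonneg fun _ _ => abs_nonneg _

@[simp] lemma l1_zero : l1 (0 : MvPolynomial σ ℤ) = 0 := by simp [l1]

lemma l1_add_le (f g : MvPolynomial σ ℤ) : l1 (f + g) ≤ l1 f + l1 g := by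
  classical
  rw [l1_eq_sum (support_add (p := f) (q := g)), l1_eq_sum (Finset.subset_union_left (s₂ := g.support)),
    l1_eq_sum (Finset.subset_union_right (s₁ := f.support)), ← Finset.sum_add_distrib]
  exact Finset.sum_le_sum fun e _ => by simp [abs_add_le]

lemma l1_sum_le {ι : Type*} (s : Finset ι) (f : ι → MvPolynomial σ ℤ) :
    l1 (∑ i ∈ s, f i) ≤ ∑ i ∈ s, l1 (f i) :=
  Finset.le_sum_of_subadditive l1 l1_zero.le l1_add_le s f

lemma l1_monomial (e : σ →₀ ℕ) (c : ℤ) : l1 (monomial e c) = |(c : ℝ)| := by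
  classical
  rw [l1_eq_sum (support_monomial_subset), Finset.sum_singleton]
  simp

lemma l1_mul_le (f g : MvPolynomial σ ℤ) : l1 (f * g) ≤ l1 f * l1 g := by
  have : f * g = ∑ a ∈ f.support, ∑ b ∈ g.support, monomial (a + b) (coeff a f * coeff b g) := by
    conv_lhs => rw [f.as_sum, g.as_sum, Finset.sum_mul_sum]
    simp [monomial_mul]
  rw [this, l1.eq_1 f, l1.eq_1 g, Finset.sum_mul_sum]
  refine (l1_sum_le _ _).trans (Finset.sum_le_sum fun a _ => ?_)
  refine (l1_sum_le _ _).trans (Finset.sum_le_sum fun b _ => ?_)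
  rw [l1_monomial]
  push_cast
  rw [abs_mul]

lemma l1_one : l1 (1 : MvPolynomial σ ℤ) = 1 := by
  have := l1_monomial (0 : σ →₀ ℕ) 1
  simpa using this

lemma l1_neg (f : MvPolynomial σ ℤ) : l1 (-f) = l1 f := by
  simp [l1]

lemma l1_prod_le {ι : Type*} (s : Finset ι) (f : ι → MvPolynomial σ ℤ) :
    l1 (∏ i ∈ s, f i) ≤ ∏ i ∈ s, l1 (f i) := by
  classical
  induction s using Finset.induction_on with
  | empty => simp [l1_one]
  | insert a s ha ih =>
    rw [Finset.prod_insert ha, Finset.prod_insert ha]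
    exact (l1_mul_le _ _).trans (mul_le_mul_of_nonneg_left ih (l1_nonneg _))

lemma l1_hasse_le [Fintype σ] (δ : σ →₀ ℕ) (f : MvPolynomial σ ℤ) (r : σ → ℕ)
    (hr : ∀ i, degreeOf i f ≤ r i) : l1 (hasse δ f) ≤ 2 ^ (∑ i, r i) * l1 f := by
  change l1 (hasseAux δ f) ≤ _
  rw [hasseAux, l1.eq_1 f, Finset.mul_sum]
  refine (l1_sum_le _ _).trans (Finset.sum_le_sum fun e he => ?_)
  rw [l1_monomial]
  push_cast
  rw [abs_mul, mul_comm]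
  refine mul_le_mul_of_nonneg_right ?_ (abs_nonneg _)
  rw [Finset.abs_prod, ← Finset.prod_pow_eq_pow_sum]
  refine Finset.prod_le_prod (fun _ _ => abs_nonneg _) fun i _ => ?_
  rw [abs_of_nonneg (by positivity)]
  calc ((e i).choose (δ i) : ℝ) ≤ 2 ^ (e i) := by exact_mod_cast Nat.choose_le_two_pow _ _
    _ ≤ 2 ^ r i := pow_le_pow_right₀ (by norm_num) ((degreeOf_le_iff.1 le_rfl e he).trans (hr i))

lemma l1_det_le {n : ℕ} (M : Matrix (Fin n) (Fin n) (MvPolynomial σ ℤ)) (B : ℝ)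
    (hM : ∀ i j, l1 (M i j) ≤ B) : l1 M.det ≤ n.factorial * B ^ n := by
  rw [Matrix.det_apply]
  refine (l1_sum_le _ _).trans ?_
  refine (Finset.sum_le_card_nsmul _ _ (B ^ n) fun π _ => ?_).trans ?_
  · have : l1 (Equiv.Perm.sign π • ∏ i, M (π i) i) = l1 (∏ i, M (π i) i) := by
      rcases Int.units_eq_one_or (Equiv.Perm.sign π) with h | h <;> simp [h, l1_neg]
    rw [this]
    refine (l1_prod_le _ _).trans ?_
    calc ∏ i, l1 (M (π i) i) ≤ ∏ _i : Fin n, B :=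
          Finset.prod_le_prod (fun _ _ => l1_nonneg _) fun i _ => hM _ _
      _ = B ^ n := by simp
  · simp [Fintype.card_perm]

end Norm

section Diagonal

open Polynomial

variable {K : Type*} [Field K]

/-- The operator multiplying the coefficient of degree `d` by `g d`. -/
noncomputable def diagOp (g : ℕ → K) : K[X] →ₗ[K] K[X] :=
  Polynomial.lsum fun d => (Polynomial.monomial d).comp (LinearMap.lsmul K K (g d))

lemma diagOp_monomial (g : ℕ → K) (d : ℕ) (a : K) :
    diagOp g (Polynomial.monomial d a) = Polynomial.monomial d (g d * a) := by
  simp [diagOp, Polynomial.lsum_apply]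

lemma coeff_diagOp (g : ℕ → K) (f : K[X]) (d : ℕ) : (diagOp g f).coeff d = g d * f.coeff d := by
  induction f using Polynomial.induction_on' with
  | add p q hp hq => simp [hp, hq, mul_add]
  | monomial n a =>
    rw [diagOp_monomial, Polynomial.coeff_monomial, Polynomial.coeff_monomial]
    split_ifs with h <;> simp [h]

lemma natDegree_diagOp_le (g : ℕ → K) (f : K[X]) : (diagOp g f).natDegree ≤ f.natDegree := by
  rw [Polynomial.natDegree_le_iff_coeff_eq_zero]
  intro N hN
  rw [coeff_diagOp, Polynomial.coeff_eq_zero_of_natDegree_lt hN, mul_zero]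

lemma coeff_prod_sum_of_natDegree_le {ι R : Type*} [CommRing R] (s : Finset ι) (f : ι → R[X])
    (d : ι → ℕ) (h : ∀ i ∈ s, (f i).natDegree ≤ d i) :
    (∏ i ∈ s, f i).coeff (∑ i ∈ s, d i) = ∏ i ∈ s, (f i).coeff (d i) := by
  classical
  induction s using Finset.induction_on with
  | empty => simp
  | insert a s ha ih =>
    rw [Finset.prod_insert ha, Finset.prod_insert ha, Finset.sum_insert ha,
      Polynomial.coeff_mul_add_eq_of_natDegree_le (h a (by simp)),
      ih fun i hi => h i (by simp [hi])]
    exact (Polynomial.natDegree_prod_le _ _).trans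
      (Finset.sum_le_sum fun i hi => h i (by simp [hi]))

lemma coeff_det_of_natDegree_le {l : ℕ} {R : Type*} [CommRing R] (M : Matrix (Fin l) (Fin l) R[X])
    (d : Fin l → ℕ) (h : ∀ i j, (M i j).natDegree ≤ d j) :
    M.det.coeff (∑ j, d j) = (Matrix.of fun i j => (M i j).coeff (d j)).det := by
  rw [Matrix.det_apply, Matrix.det_apply, Polynomial.finsetSum_coeff]
  refine Finset.sum_congr rfl fun π _ => ?_
  rw [Polynomial.coeff_smul, coeff_prod_sum_of_natDegree_le _ _ _ fun j _ => h _ j]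
  rfl

/-- The Wronskian criterion for diagonal operators on univariate polynomials. -/
theorem det_diagOp_ne_zero {l : ℕ} (g : Fin l → ℕ → K)
    (hg : ∀ d : Fin l → ℕ, Function.Injective d → (Matrix.of fun k j => g k (d j)).det ≠ 0)
    (ψ : Fin l → K[X]) (hψ : LinearIndependent K ψ) :
    (Matrix.of fun k j => diagOp (g k) (ψ j)).det ≠ 0 := by
  induction hN : ∑ j, (ψ j).natDegree using Nat.strong_induction_on generalizing ψ with
  | _ N ih =>
  by_cases hinj : Function.Injective fun j => (ψ j).natDegree
  · intro h0
    have h1 := coeff_det_of_natDegree_le (Matrix.of fun k j => diagOp (g k) (ψ j))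
      (fun j => (ψ j).natDegree) fun i j => natDegree_diagOp_le _ _
    rw [h0, Polynomial.coeff_zero] at h1
    have h2 : (Matrix.of fun k j => ((Matrix.of fun k j => diagOp (g k) (ψ j)) k j).coeff
        (ψ j).natDegree) = Matrix.of fun k j => (ψ j).leadingCoeff *
          (Matrix.of fun k j => g k (ψ j).natDegree) k j := by
      ext k j
      simp [coeff_diagOp, mul_comm]
    rw [h2, Matrix.det_mul_row] at h1
    refine mul_ne_zero ?_ (hg _ hinj) h1.symm
    exact Finset.prod_ne_zero_iff.2 fun j _ => Polynomial.leadingCoeff_ne_zero.2 (hψ.ne_zero j)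
  · obtain ⟨i, j, hij, hne⟩ : ∃ i j, (ψ i).natDegree = (ψ j).natDegree ∧ i ≠ j := by
      simpa [Function.Injective] using hinj
    set c : K := (ψ i).leadingCoeff / (ψ j).leadingCoeff with hc
    have hlj : (ψ j).leadingCoeff ≠ 0 := Polynomial.leadingCoeff_ne_zero.2 (hψ.ne_zero j)
    have hli : (ψ i).leadingCoeff ≠ 0 := Polynomial.leadingCoeff_ne_zero.2 (hψ.ne_zero i)
    have hc0 : c ≠ 0 := div_ne_zero hli hlj
    set ψ' : Fin l → K[X] := ψ + ((Pi.single i (-c) : Fin l → K) · • ψ j) with hψ'def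
    have hψ' : LinearIndependent K ψ' :=
      (linearIndependent_add_smul_iff (by simp [hne.symm])).2 hψ
    have hi' : ψ' i = ψ i - c • ψ j := by simp [ψ', sub_eq_add_neg]
    have hk' : ∀ k, k ≠ i → ψ' k = ψ k := fun k hk => by simp [ψ', hk]
    have hdeg : (ψ' i).natDegree < (ψ i).natDegree := by
      refine Polynomial.natDegree_lt_natDegree (hψ'.ne_zero i) ?_
      rw [hi']
      refine Polynomial.degree_sub_lt_left ?_ (hψ.ne_zero i) ?_
      · rw [Polynomial.degree_smul_of_smul_regular _ (IsSMulRegular.of_ne_zero hc0)]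
        exact (Polynomial.degree_eq_iff_natDegree_eq (hψ.ne_zero i)).2 (by
          rw [hij]) |>.trans (Polynomial.degree_eq_natDegree (hψ.ne_zero j)).symm
      · rw [Polynomial.smul_eq_C_mul, Polynomial.leadingCoeff_mul, Polynomial.leadingCoeff_C, hc,
          div_mul_cancel₀ _ hlj]
    have hlt : ∑ k, (ψ' k).natDegree < N := by
      rw [← hN]
      refine Finset.sum_lt_sum (fun k _ => ?_) ⟨i, Finset.mem_univ _, hdeg⟩
      by_cases hk : k = i
      · subst hk; exact hdeg.le
      · rw [hk' k hk]
    have hdet := ih _ hlt ψ' hψ' rfl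
    have hM : (Matrix.of fun k j => diagOp (g k) (ψ' j)) =
        (Matrix.of fun k j => diagOp (g k) (ψ j)).updateCol i fun k =>
          (Matrix.of fun k j => diagOp (g k) (ψ j)) k i +
            (Polynomial.C (-c)) • (Matrix.of fun k j => diagOp (g k) (ψ j)) k j := by
      ext1 k k'
      by_cases hk : k' = i
      · subst hk
        simp only [Matrix.of_apply, Matrix.updateCol_self]
        rw [hi', map_sub, map_smul, Polynomial.smul_eq_C_mul]
        simp [sub_eq_add_neg]
      · simp [hk, hk' k' hk]
    rwa [hM, Matrix.det_updateCol_add_smul_self _ hne] at hdet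

variable [CharZero K]

lemma det_choose_ne_zero {l : ℕ} (d : Fin l → ℕ) (hd : Function.Injective d) :
    (Matrix.of fun k j : Fin l => ((d j).choose k : K)).det ≠ 0 := by
  intro h0
  have h1 := Matrix.det_eval_matrixOfPolynomials_eq_det_vandermonde (fun j => (d j : K))
    (fun k : Fin l => descPochhammer K k) (fun k => descPochhammer_natDegree K k)
    (fun k => monic_descPochhammer K k)
  have h2 : (Matrix.of fun i j : Fin l => (descPochhammer K j).eval (d i : K)) =
      Matrix.of fun i j : Fin l => ((j : ℕ).factorial : K) *
        (Matrix.of fun k j : Fin l => ((d j).choose k : K)).transpose i j := by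
    ext i j
    simp [descPochhammer_eval_eq_descFactorial, Nat.descFactorial_eq_factorial_mul_choose]
  rw [h2, Matrix.det_mul_row, Matrix.det_transpose, h0, mul_zero] at h1
  exact (Matrix.det_vandermonde_ne_zero_iff.2 fun a b hab => hd (by exact_mod_cast hab)) h1

lemma det_pow_ne_zero {l : ℕ} (d : Fin l → ℕ) (hd : Function.Injective d) :
    (Matrix.of fun k j : Fin l => ((d j : K) ^ (k : ℕ))).det ≠ 0 := by
  have : (Matrix.of fun k j : Fin l => ((d j : K) ^ (k : ℕ))) =
      (Matrix.vandermonde fun j => (d j : K)).transpose := by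
    ext; simp [Matrix.vandermonde]
  rw [this, Matrix.det_transpose]
  exact Matrix.det_vandermonde_ne_zero_iff.2 fun a b hab => hd (by exact_mod_cast hab)

/-- The Wronskian of linearly independent univariate polynomials does not vanish. -/
theorem det_hasseDeriv_ne_zero {l : ℕ} (ψ : Fin l → K[X]) (hψ : LinearIndependent K ψ) :
    (Matrix.of fun k j : Fin l => Polynomial.hasseDeriv (k : ℕ) (ψ j)).det ≠ 0 := by
  intro h0
  refine det_diagOp_ne_zero (fun k d => (d.choose k : K)) (fun d hd => det_choose_ne_zero d hd)
    ψ hψ ?_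
  have : (Matrix.of fun k j : Fin l => diagOp (fun d => (d.choose k : K)) (ψ j)) =
      Matrix.of fun k j : Fin l => (Polynomial.X : K[X]) ^ (k : ℕ) *
        (Matrix.of fun k j : Fin l => Polynomial.hasseDeriv (k : ℕ) (ψ j)) k j := by
    ext k j d
    rw [Matrix.of_apply, Matrix.of_apply, Matrix.of_apply, coeff_diagOp,
      Polynomial.coeff_X_pow_mul', Polynomial.hasseDeriv_coeff]
    split_ifs with h
    · rw [Nat.sub_add_cancel h]
    · rw [Nat.choose_eq_zero_of_lt (not_le.1 h)]; simp
  rw [this, Matrix.det_mul_column, h0, mul_zero]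

end Diagonal

lemma exists_det_ne_zero_of_mem_span {l : ℕ} {D : Type*} [CommRing D] (M : Matrix (Fin l) (Fin l) D)
    (S : Fin l → Set (Fin l → D)) (hS : ∀ k, M k ∈ Submodule.span D (S k)) (hM : M.det ≠ 0) :
    ∃ N : Matrix (Fin l) (Fin l) D, (∀ k, N k ∈ S k) ∧ N.det ≠ 0 := by
  suffices h : ∀ t : Finset (Fin l), ∃ N : Matrix (Fin l) (Fin l) D,
      (∀ k ∈ t, N k ∈ S k) ∧ (∀ k ∉ t, N k = M k) ∧ N.det ≠ 0 by
    obtain ⟨N, h1, -, h3⟩ := h Finset.univ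
    exact ⟨N, fun k => h1 k (Finset.mem_univ k), h3⟩
  intro t
  induction t using Finset.induction_on with
  | empty => exact ⟨M, by simp, by simp, hM⟩
  | insert a t ha ih =>
    obtain ⟨N, h1, h2, h3⟩ := ih
    by_contra! hcon
    refine h3 ?_
    let φ : (Fin l → D) →ₗ[D] D :=
      (Matrix.detRowAlternating (R := D) (n := Fin l)).toMultilinearMap.toLinearMap N a
    have hφ : ∀ v, φ v = (N.updateRow a v).det := fun v => rfl
    have hker : Submodule.span D (S a) ≤ LinearMap.ker φ := by
      rw [Submodule.span_le]
      intro v hv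
      change φ v = 0
      rw [hφ]
      refine hcon _ (fun k hk => ?_) fun k hk => ?_
      · by_cases hka : k = a
        · subst hka; simpa using hv
        · rw [Matrix.updateRow_ne hka]
          exact h1 k ((Finset.mem_insert.1 hk).resolve_left hka)
      · rw [Matrix.updateRow_ne (fun h => hk (by simp [h]))]
        exact h2 k fun h => hk (by simp [h])
    have h4 : φ (N a) = 0 := hker (by rw [h2 a ha]; exact hS a)
    rwa [hφ, Matrix.updateRow_eq_self] at h4

section Wronskian

open MvPolynomial

variable {K : Type*} [Field K] {n : ℕ}

/-- The exponent of the image of the monomial `e` under `X i ↦ X ^ (B ^ i)`. -/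
def kron (B : ℕ) (e : Fin n →₀ ℕ) : ℕ := ∑ i, e i * B ^ (i : ℕ)

lemma kron_injective {B : ℕ} {e e' : Fin n →₀ ℕ} (he : ∀ i, e i < B) (he' : ∀ i, e' i < B)
    (h : kron B e = kron B e') : e = e' := by
  have h1 : finFunctionFinEquiv (fun i => (⟨e i, he i⟩ : Fin B)) =
      finFunctionFinEquiv (fun i => (⟨e' i, he' i⟩ : Fin B)) := by
    ext
    rw [finFunctionFinEquiv_apply, finFunctionFinEquiv_apply]
    exact h
  have h2 := finFunctionFinEquiv.injective h1
  ext i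
  simpa using congrArg (fun f => (f i : ℕ)) h2

/-- Kronecker substitution. -/
noncomputable def kronHom (K : Type*) [Field K] (n B : ℕ) :
    MvPolynomial (Fin n) K →ₐ[K] Polynomial K :=
  aeval fun i : Fin n => (Polynomial.X : Polynomial K) ^ B ^ (i : ℕ)

lemma kronHom_monomial (B : ℕ) (e : Fin n →₀ ℕ) (c : K) :
    kronHom K n B (monomial e c) = Polynomial.monomial (kron B e) c := by
  rw [kronHom, aeval_monomial, Finsupp.prod_fintype _ _ (by simp), ← Polynomial.C_mul_X_pow_eq_monomial]
  simp [kron, ← pow_mul, mul_comm, Finset.prod_pow_eq_pow_sum]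

/-- The Kronecker substitution twisted by a weight on the exponents. -/
noncomputable def kronTwist (B : ℕ) (w : (Fin n →₀ ℕ) → K) (f : MvPolynomial (Fin n) K) :
    Polynomial K := ∑ e ∈ f.support, Polynomial.monomial (kron B e) (w e * coeff e f)

lemma kronHom_eq (B : ℕ) (f : MvPolynomial (Fin n) K) :
    kronHom K n B f = ∑ e ∈ f.support, Polynomial.monomial (kron B e) (coeff e f) := by
  conv_lhs => rw [f.as_sum, map_sum]
  exact Finset.sum_congr rfl fun e _ => kronHom_monomial B e _

lemma coeff_kronHom {B : ℕ} {f : MvPolynomial (Fin n) K} (hf : ∀ i, degreeOf i f < B)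
    {e : Fin n →₀ ℕ} (he : ∀ i, e i < B) : (kronHom K n B f).coeff (kron B e) = coeff e f := by
  rw [kronHom_eq, Polynomial.finsetSum_coeff, Finset.sum_eq_single e]
  · simp
  · intro e' he' hne
    rw [Polynomial.coeff_monomial, if_neg]
    intro h
    exact hne (kron_injective (fun i => ((degreeOf_le_iff (n := i)).1 le_rfl _ he').trans_lt (hf i)) he h)
  · intro h
    simp [notMem_support_iff.1 h]

lemma kronHom_eq_zero {B : ℕ} {f : MvPolynomial (Fin n) K} (hf : ∀ i, degreeOf i f < B)
    (h : kronHom K n B f = 0) : f = 0 := by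
  ext e
  by_cases he : e ∈ f.support
  · rw [← coeff_kronHom hf fun i => ((degreeOf_le_iff (n := i)).1 le_rfl _ he).trans_lt (hf i), h]
    simp
  · simp [notMem_support_iff.1 he]

lemma kronTwist_pow (B k : ℕ) (f : MvPolynomial (Fin n) K) :
    kronTwist B (fun e => (kron B e : K) ^ k) f = diagOp (fun d => (d : K) ^ k) (kronHom K n B f) := by
  rw [kronHom_eq, map_sum, kronTwist]
  exact Finset.sum_congr rfl fun e _ => by rw [diagOp_monomial]

lemma kronTwist_choose (B : ℕ) (δ : Fin n →₀ ℕ) (f : MvPolynomial (Fin n) K) :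
    kronTwist B (fun e => ∏ i, ((e i).choose (δ i) : K)) f =
      Polynomial.X ^ kron B δ * kronHom K n B (hasse δ f) := by
  have h1 : hasse δ f = ∑ e ∈ f.support, monomial (e - δ) (coeff e f * ∏ i, ((e i).choose (δ i) : K)) := rfl
  rw [h1, map_sum, Finset.mul_sum, kronTwist]
  refine Finset.sum_congr rfl fun e _ => ?_
  rw [kronHom_monomial, Polynomial.X_pow_mul_monomial, mul_comm (coeff e f)]
  by_cases h : ∀ i, δ i ≤ e i
  · have h2 : kron B (e - δ) + kron B δ = kron B e := by
      rw [kron, kron, kron, ← Finset.sum_add_distrib]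
      refine Finset.sum_congr rfl fun i _ => ?_
      rw [← add_mul, Finsupp.tsub_apply, Nat.sub_add_cancel (h i)]
    rw [h2]
  · push Not at h
    obtain ⟨i, hi⟩ := h
    rw [Finset.prod_eq_zero (Finset.mem_univ i) (by simp [Nat.choose_eq_zero_of_lt hi])]
    simp

/-- The rows of twisted Kronecker substitutions depend linearly on the twist. -/
noncomputable def kronRow (B : ℕ) {l : ℕ} (φ : Fin l → MvPolynomial (Fin n) K) :
    ((Fin n →₀ ℕ) → K) →ₗ[K] (Fin l → Polynomial K) where
  toFun w j := kronTwist B w (φ j)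
  map_add' w w' := by
    ext1 j
    simp [kronTwist, add_mul, Finset.sum_add_distrib]
  map_smul' c w := by
    ext1 j
    simp [kronTwist, Finset.smul_sum, Polynomial.smul_monomial, mul_assoc]

/-- The span of the products of binomial coefficients of total order at most `k`. -/
def chooseSpan (K : Type*) [Field K] (n k : ℕ) : Submodule K ((Fin n →₀ ℕ) → K) :=
  Submodule.span K ((fun δ : Fin n →₀ ℕ => fun e => ∏ i, ((e i).choose (δ i) : K)) ''
    {δ | ∑ i, δ i ≤ k})

lemma mul_choose_eq (a d : ℕ) :
    (a : K) * (a.choose d : K) = d * (a.choose d : K) + (d + 1) * (a.choose (d + 1) : K) := by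
  have h := Nat.choose_succ_right_eq a d
  by_cases hd : d ≤ a
  · have h' : (a.choose (d + 1) : K) * (d + 1) = (a.choose d : K) * (a - d) := by
      rw [← Nat.cast_sub hd, ← Nat.cast_mul, ← h]; push_cast; ring
    linear_combination -h'
  · rw [Nat.choose_eq_zero_of_lt (not_le.1 hd), Nat.choose_eq_zero_of_lt (by omega)]
    simp

lemma mul_mem_chooseSpan (k : ℕ) (i : Fin n) (w : (Fin n →₀ ℕ) → K) (hw : w ∈ chooseSpan K n k) :
    (fun e => (e i : K) * w e) ∈ chooseSpan K n (k + 1) := by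
  let m : ((Fin n →₀ ℕ) → K) →ₗ[K] ((Fin n →₀ ℕ) → K) :=
    LinearMap.mulLeft K (fun e : Fin n →₀ ℕ => (e i : K))
  suffices h : chooseSpan K n k ≤ (chooseSpan K n (k + 1)).comap m from h hw
  rw [chooseSpan, Submodule.span_le]
  rintro _ ⟨δ, hδ, rfl⟩
  have hδ' : ∑ j, δ j ≤ k := hδ
  have h1 : m (fun e => ∏ j, ((e j).choose (δ j) : K)) =
      (δ i : K) • (fun e : Fin n →₀ ℕ => ∏ j, ((e j).choose (δ j) : K)) +
      ((δ i : K) + 1) • (fun e : Fin n →₀ ℕ =>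
        ∏ j, ((e j).choose ((δ + Finsupp.single i 1 : Fin n →₀ ℕ) j) : K)) := by
    ext e
    simp only [m, LinearMap.mulLeft_apply, Pi.mul_apply, Pi.add_apply, Pi.smul_apply, smul_eq_mul]
    rw [← Finset.mul_prod_erase _ _ (Finset.mem_univ i),
      ← Finset.mul_prod_erase _ (fun j => ((e j).choose ((δ + Finsupp.single i 1 : Fin n →₀ ℕ) j) : K))
        (Finset.mem_univ i)]
    have h2 : ∏ j ∈ Finset.univ.erase i, ((e j).choose ((δ + Finsupp.single i 1 : Fin n →₀ ℕ) j) : K) =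
        ∏ j ∈ Finset.univ.erase i, ((e j).choose (δ j) : K) := by
      refine Finset.prod_congr rfl fun j hj => ?_
      simp [(Finset.ne_of_mem_erase hj).symm]
    rw [h2]
    have h3 := mul_choose_eq (K := K) (e i) (δ i)
    simp only [Finsupp.add_apply, Finsupp.single_eq_same]
    linear_combination (∏ j ∈ Finset.univ.erase i, ((e j).choose (δ j) : K)) * h3
  change m _ ∈ chooseSpan K n (k + 1)
  rw [h1]
  refine Submodule.add_mem _ (Submodule.smul_mem _ _ ?_) (Submodule.smul_mem _ _ ?_)
  · exact Submodule.subset_span ⟨δ, hδ'.trans (Nat.le_succ k), rfl⟩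
  · refine Submodule.subset_span ⟨δ + Finsupp.single i 1, ?_, rfl⟩
    simp only [Set.mem_ofPred_eq, Finsupp.add_apply, Finset.sum_add_distrib]
    have : ∑ j, (Finsupp.single i 1 : Fin n →₀ ℕ) j = 1 := by
      simp [Finsupp.single_apply]
    omega

lemma pow_mem_chooseSpan (B k : ℕ) :
    (fun e : Fin n →₀ ℕ => (kron B e : K) ^ k) ∈ chooseSpan K n k := by
  induction k with
  | zero => exact Submodule.subset_span ⟨0, by simp, by simp⟩
  | succ k ih =>
    have : (fun e : Fin n →₀ ℕ => (kron B e : K) ^ (k + 1)) =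
        ∑ i : Fin n, ((B : K) ^ (i : ℕ)) • fun e : Fin n →₀ ℕ => (e i : K) * (kron B e : K) ^ k := by
      ext e
      rw [pow_succ, Finset.sum_apply]
      simp only [Pi.smul_apply, smul_eq_mul]
      conv_lhs => rw [kron]
      push_cast
      rw [Finset.mul_sum]
      refine Finset.sum_congr rfl fun i _ => ?_
      rw [kron]
      push_cast
      ring
    rw [this]
    exact Submodule.sum_mem _ fun i _ => Submodule.smul_mem _ _ (mul_mem_chooseSpan k i _ ih)

/-- Some generalised Wronskian of linearly independent polynomials does not vanish. -/
theorem exists_det_hasse_ne_zero [CharZero K] {l : ℕ} (φ : Fin l → MvPolynomial (Fin n) K)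
    (hφ : LinearIndependent K φ) :
    ∃ δ : Fin l → (Fin n →₀ ℕ), (∀ k, ∑ i, δ k i ≤ k) ∧
      (Matrix.of fun k j => hasse (δ k) (φ j)).det ≠ 0 := by
  obtain ⟨B, hB0, hB⟩ : ∃ B : ℕ, B - 1 < B ∧ ∀ j i, degreeOf i (φ j) < B := by
    refine ⟨∑ j, ∑ i, degreeOf i (φ j) + 1, by simp, fun j i => Nat.lt_succ_of_le ?_⟩
    exact (Finset.single_le_sum (f := fun i => degreeOf i (φ j)) (fun _ _ => Nat.zero_le _)
      (Finset.mem_univ i)).trans (Finset.single_le_sum (f := fun j => ∑ i, degreeOf i (φ j))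
      (fun _ _ => Nat.zero_le _) (Finset.mem_univ j))
  have hind : LinearIndependent K fun j => kronHom K n B (φ j) := by
    rw [Fintype.linearIndependent_iff] at hφ ⊢
    intro g hg
    refine hφ g (kronHom_eq_zero (B := B) (fun i => ?_) ?_)
    · refine lt_of_le_of_lt ?_ hB0
      rw [degreeOf_le_iff]
      intro e he
      obtain ⟨j, -, hj⟩ := Finset.exists_ne_zero_of_sum_ne_zero
        (by simpa [coeff_sum] using mem_support_iff.1 he :
          ∑ j, g j * coeff e (φ j) ≠ 0)
      exact ((degreeOf_le_iff (n := i)).1 le_rfl e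
        (mem_support_iff.2 (right_ne_zero_of_mul hj))).trans (Nat.le_pred_of_lt (hB j i))
    · simpa using hg
  have hdet := det_diagOp_ne_zero (fun (k : Fin l) d => (d : K) ^ (k : ℕ))
    (fun d hd => det_pow_ne_zero d hd) _ hind
  have hrow : ∀ k : Fin l, (Matrix.of fun (k : Fin l) j =>
      diagOp (fun d => (d : K) ^ (k : ℕ)) (kronHom K n B (φ j))) k ∈
      Submodule.span (Polynomial K) ((fun δ : Fin n →₀ ℕ => fun j =>
        kronHom K n B (hasse δ (φ j))) '' {δ | ∑ i, δ i ≤ (k : ℕ)}) := by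
    intro k
    have h1 : (Matrix.of fun (k : Fin l) j => diagOp (fun d => (d : K) ^ (k : ℕ)) (kronHom K n B (φ j))) k =
        kronRow B φ fun e => (kron B e : K) ^ (k : ℕ) := by
      ext1 j
      exact (kronTwist_pow B k (φ j)).symm
    rw [h1]
    suffices h : chooseSpan K n k ≤ ((Submodule.span (Polynomial K) ((fun δ : Fin n →₀ ℕ => fun j =>
        kronHom K n B (hasse δ (φ j))) '' {δ | ∑ i, δ i ≤ (k : ℕ)})).restrictScalars K).comap (kronRow B φ)
      from h (pow_mem_chooseSpan B k)
    rw [chooseSpan, Submodule.span_le]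
    rintro _ ⟨δ, hδ, rfl⟩
    change kronRow B φ _ ∈ Submodule.span (Polynomial K) _
    have h2 : kronRow B φ (fun e => ∏ i, ((e i).choose (δ i) : K)) =
        (Polynomial.X ^ kron B δ : Polynomial K) • fun j => kronHom K n B (hasse δ (φ j)) := by
      ext1 j
      exact kronTwist_choose B δ (φ j)
    rw [h2]
    exact Submodule.smul_mem _ _ (Submodule.subset_span ⟨δ, hδ, rfl⟩)
  obtain ⟨N, hN, hN0⟩ := exists_det_ne_zero_of_mem_span _ _ hrow hdet
  choose δ hδ hNδ using hN
  refine ⟨δ, hδ, fun h0 => hN0 ?_⟩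
  have : N = (kronHom K n B).toRingHom.mapMatrix (Matrix.of fun k j => hasse (δ k) (φ j)) := by
    ext1 k j
    rw [← hNδ k]
    rfl
  rw [this, ← RingHom.map_det, h0, map_zero]

end Wronskian

section Box

open MvPolynomial

variable {R : Type*} [CommRing R] {n : ℕ}

/-- The product of a polynomial in the variables `1, …, n` and a polynomial in the variable `0`. -/
noncomputable def box : MvPolynomial (Fin n) R →ₗ[R] Polynomial R →ₗ[R] MvPolynomial (Fin (n + 1)) R :=
  (LinearMap.mul R (MvPolynomial (Fin (n + 1)) R)).compl₁₂ (rename Fin.succ).toLinearMap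
    (Polynomial.aeval (X 0)).toLinearMap

lemma box_apply (u : MvPolynomial (Fin n) R) (v : Polynomial R) :
    box u v = rename Fin.succ u * Polynomial.aeval (X 0) v := rfl

lemma coeff_box (u : MvPolynomial (Fin n) R) (v : Polynomial R) (k : ℕ) (τ : Fin n →₀ ℕ) :
    coeff (Finsupp.cons k τ) (box u v) = coeff τ u * v.coeff k := by
  have h1 : finSuccEquiv R n (rename Fin.succ u) = Polynomial.C u := by
    induction u using MvPolynomial.induction_on with
    | C a => simp [finSuccEquiv_apply]
    | add p q hp hq => simp only [map_add, hp, hq]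
    | mul_X p i hp => simp only [map_mul, hp, rename_X, finSuccEquiv_X_succ]
  have h2 : finSuccEquiv R n (Polynomial.aeval (X 0) v) = v.map C := by
    induction v using Polynomial.induction_on' with
    | add p q hp hq => simp only [map_add, hp, hq, Polynomial.map_add]
    | monomial d a =>
      rw [Polynomial.aeval_monomial, map_mul, map_pow, finSuccEquiv_X_zero, Polynomial.map_monomial,
        ← Polynomial.C_mul_X_pow_eq_monomial]
      congr 1
      simp [finSuccEquiv_apply]
  rw [← finSuccEquiv_coeff_coeff, box_apply, map_mul, h1, h2, Polynomial.coeff_C_mul,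
    Polynomial.coeff_map, mul_comm, coeff_C_mul, mul_comm]

lemma shift_box (x : Fin (n + 1) → R) (u : MvPolynomial (Fin n) R) (v : Polynomial R) :
    shift x (box u v) = box (shift (fun i => x i.succ) u) (Polynomial.taylor (x 0) v) := by
  rw [box_apply, box_apply, map_mul]
  congr 1
  · induction u using MvPolynomial.induction_on with
    | C a => simp [shift]
    | add p q hp hq => simp only [map_add, hp, hq]
    | mul_X p i hp => simp only [map_mul, hp, rename_X]; simp [shift]
  · rw [Polynomial.taylor_apply, Polynomial.aeval_comp, ← Polynomial.aeval_algHom_apply]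
    simp [shift]

lemma hasse_box (k : ℕ) (δ : Fin n →₀ ℕ) (u : MvPolynomial (Fin n) R) (v : Polynomial R) :
    hasse (Finsupp.cons k δ) (box u v) = box (hasse δ u) (Polynomial.hasseDeriv k v) := by
  ext τ
  obtain ⟨a, τ', rfl⟩ : ∃ a τ', τ = Finsupp.cons a τ' := ⟨_, _, (Finsupp.cons_tail τ).symm⟩
  have h : Finsupp.cons a τ' + Finsupp.cons k δ = Finsupp.cons (a + k) (τ' + δ) := by
    ext i
    refine Fin.cases ?_ (fun i => ?_) i <;> simp
  rw [coeff_hasse, h, coeff_box, coeff_box, coeff_hasse, Polynomial.hasseDeriv_coeff,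
    Fin.prod_univ_succ]
  simp only [Finsupp.cons_zero, Finsupp.cons_succ]
  ring

lemma exists_sum_box {d : ℕ} (f : MvPolynomial (Fin (n + 1)) R) (hd : degreeOf 0 f ≤ d) :
    ∃ (φ : Fin (d + 1) → MvPolynomial (Fin n) R) (ψ : Fin (d + 1) → Polynomial R),
      f = ∑ j, box (φ j) (ψ j) := by
  refine ⟨fun j => (finSuccEquiv R n f).coeff j, fun j => Polynomial.X ^ (j : ℕ), ?_⟩
  ext τ
  obtain ⟨a, τ', rfl⟩ : ∃ a τ', τ = Finsupp.cons a τ' := ⟨_, _, (Finsupp.cons_tail τ).symm⟩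
  rw [coeff_sum]
  simp only [coeff_box, finSuccEquiv_coeff_coeff, Polynomial.coeff_X_pow]
  by_cases ha : a ≤ d
  · rw [Finset.sum_eq_single ⟨a, Nat.lt_succ_of_le ha⟩]
    · simp
    · intro b _ hb
      rw [if_neg (fun h => hb (Fin.ext h.symm)), mul_zero]
    · simp
  · have h1 : ∀ j : Fin (d + 1), a ≠ j := fun j h => ha (by omega)
    simp only [h1, if_false, mul_zero, Finset.sum_const_zero]
    rw [← notMem_support_iff]
    intro h
    exact ha ((by simpa using (degreeOf_le_iff (n := 0)).1 hd _ h))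

end Box

section Bilinear

variable {K M N T : Type*} [Field K] [AddCommGroup M] [Module K M] [AddCommGroup N] [Module K N]
  [AddCommGroup T] [Module K T]

lemma exists_sum_pred (β : M →ₗ[K] N →ₗ[K] T) {l : ℕ} (φ : Fin (l + 1) → M) (ψ : Fin (l + 1) → N)
    (h : ¬ LinearIndependent K φ) :
    ∃ (φ' : Fin l → M) (ψ' : Fin l → N), ∑ j, β (φ j) (ψ j) = ∑ j, β (φ' j) (ψ' j) := by
  obtain ⟨g, hg, i, hi⟩ := Fintype.not_linearIndependent_iff.1 h
  refine ⟨fun j => φ (i.succAbove j), fun j => ψ (i.succAbove j) - (g (i.succAbove j) / g i) • ψ i, ?_⟩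
  rw [Fin.sum_univ_succAbove _ i] at hg ⊢
  have h1 : φ i = -∑ j, (g (i.succAbove j) / g i) • φ (i.succAbove j) := by
    have := congrArg (fun x => (g i)⁻¹ • x) hg
    simp only [smul_add, smul_smul, inv_mul_cancel₀ hi, one_smul, smul_zero, Finset.smul_sum] at this
    rw [eq_neg_iff_add_eq_zero, ← this]
    simp only [div_eq_inv_mul]
  rw [h1]
  simp [map_sub, Finset.sum_sub_distrib]
  abel

lemma exists_linearIndependent_sum (β : M →ₗ[K] N →ₗ[K] T) (l : ℕ) (φ : Fin l → M)
    (ψ : Fin l → N) :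
    ∃ l' ≤ l, ∃ (φ' : Fin l' → M) (ψ' : Fin l' → N), LinearIndependent K φ' ∧
      LinearIndependent K ψ' ∧ ∑ j, β (φ j) (ψ j) = ∑ j, β (φ' j) (ψ' j) := by
  induction l with
  | zero => exact ⟨0, le_rfl, φ, ψ, linearIndependent_empty_type, linearIndependent_empty_type, rfl⟩
  | succ l ih =>
    by_cases h1 : LinearIndependent K φ
    · by_cases h2 : LinearIndependent K ψ
      · exact ⟨l + 1, le_rfl, φ, ψ, h1, h2, rfl⟩
      · obtain ⟨ψ', φ', h⟩ := exists_sum_pred β.flip ψ φ h2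
        obtain ⟨l', hl', φ'', ψ'', h3, h4, h5⟩ := ih φ' ψ'
        exact ⟨l', hl'.trans (Nat.le_succ l), φ'', ψ'', h3, h4, by rw [← h5]; exact h⟩
    · obtain ⟨φ', ψ', h⟩ := exists_sum_pred β φ ψ h1
      obtain ⟨l', hl', φ'', ψ'', h3, h4, h5⟩ := ih φ' ψ'
      exact ⟨l', hl'.trans (Nat.le_succ l), φ'', ψ'', h3, h4, by rw [← h5]; exact h⟩

end Bilinear

section Gauss

open Polynomial

lemma pow_rootMultiplicity_le {u v : ℤ} (huv : IsCoprime u v) (hv : v ≠ 0) {V : ℤ[X]} (hV : V ≠ 0)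
    {L : ℝ} (hL : ∀ d, |((V.coeff d : ℤ) : ℝ)| ≤ L) :
    ((max |u| |v| : ℤ) : ℝ) ^ (rootMultiplicity ((u : ℚ) / v) (V.map (Int.castRingHom ℚ))) ≤ L := by
  set k := rootMultiplicity ((u : ℚ) / v) (V.map (Int.castRingHom ℚ)) with hk
  have hprim : (C v * X - C u : ℤ[X]).IsPrimitive := by
    rw [isPrimitive_iff_isUnit_of_C_dvd]
    intro r hr
    rw [C_dvd_iff_dvd_coeff] at hr
    have h0 := hr 0
    have h1 := hr 1
    simp only [coeff_sub, coeff_C_mul, coeff_X_zero, coeff_X_one, coeff_C_zero, coeff_C_succ, mul_zero,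
      mul_one, zero_sub, sub_zero, dvd_neg] at h0 h1
    exact huv.isUnit_of_dvd' h0 h1
  have hprimk : ∀ k : ℕ, ((C v * X - C u : ℤ[X]) ^ k).IsPrimitive := by
    intro k
    induction k with
    | zero => simp
    | succ k ih => rw [pow_succ]; exact IsPrimitive.mul ih hprim
  have hdvd : (C v * X - C u : ℤ[X]) ^ k ∣ V := by
    rw [IsPrimitive.Int.dvd_iff_map_cast_dvd_map_cast _ _ (hprimk k)]
    have h1 := pow_rootMultiplicity_dvd (V.map (Int.castRingHom ℚ)) ((u : ℚ) / v)
    rw [← hk] at h1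
    have hv' : (v : ℚ) ≠ 0 := by exact_mod_cast hv
    have h2 : ((C v * X - C u : ℤ[X]) ^ k).map (Int.castRingHom ℚ) =
        C ((v : ℚ) ^ k) * (X - C ((u : ℚ) / v)) ^ k := by
      rw [C_pow, ← mul_pow, mul_sub, ← C_mul, mul_div_cancel₀ _ hv']
      simp
    rw [h2]
    exact (isUnit_C.2 (pow_ne_zero k hv').isUnit).mul_left_dvd.2 h1
  obtain ⟨Q, hQ⟩ := hdvd
  have hQ0 : Q ≠ 0 := by rintro rfl; simp at hQ; exact hV hQ
  rcases le_total |u| |v| with h | h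
  · rw [max_eq_right h]
    have h1 : V.leadingCoeff = v ^ k * Q.leadingCoeff := by
      rw [hQ, leadingCoeff_mul, leadingCoeff_pow]
      congr 2
      rw [sub_eq_add_neg, ← C_neg]
      exact leadingCoeff_linear hv
    have h2 := hL V.natDegree
    rw [coeff_natDegree, h1] at h2
    refine le_trans ?_ h2
    have h3 : (1 : ℝ) ≤ |(Q.leadingCoeff : ℝ)| := by
      exact_mod_cast Int.one_le_abs (leadingCoeff_ne_zero.2 hQ0)
    push_cast
    rw [abs_mul, abs_pow]
    exact le_mul_of_one_le_right (by positivity) h3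
  · rw [max_eq_left h]
    have hu : u ≠ 0 := by
      rintro rfl
      simp at h
      exact hv h
    have h0 : (C v * X - C u : ℤ[X]).trailingCoeff = -u := by
      have : (C v * X - C u : ℤ[X]).natTrailingDegree = 0 :=
        natTrailingDegree_eq_zero_of_constantCoeff_ne_zero (by simpa using hu)
      rw [trailingCoeff, this]
      simp
    have hpow : ∀ k : ℕ, ((C v * X - C u : ℤ[X]) ^ k).trailingCoeff = (-u) ^ k := by
      intro k
      induction k with
      | zero => simp [trailingCoeff]
      | succ k ih => rw [pow_succ, trailingCoeff_mul, ih, h0, pow_succ]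
    have h1 : V.trailingCoeff = (-u) ^ k * Q.trailingCoeff := by
      rw [hQ, trailingCoeff_mul, hpow]
    have h2 := hL V.natTrailingDegree
    change |((V.trailingCoeff : ℤ) : ℝ)| ≤ L at h2
    rw [h1] at h2
    refine le_trans ?_ h2
    have h3 : (1 : ℝ) ≤ |(Q.trailingCoeff : ℝ)| := by
      exact_mod_cast Int.one_le_abs (trailingCoeff_nonzero_iff_nonzero.2 hQ0)
    push_cast
    rw [abs_mul, abs_pow, abs_neg]
    exact le_mul_of_one_le_right (by positivity) h3

end Gauss

section Vanish

open MvPolynomial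

variable {σ R : Type*} [Fintype σ] [CommRing R]

/-- The polynomial `f` has no monomials of weight less than `a`. -/
def Van (w : σ → ℝ) (a : ℝ) (f : MvPolynomial σ R) : Prop :=
  ∀ τ : σ →₀ ℕ, ∑ i, τ i * w i < a → coeff τ f = 0

lemma Van.mul {w : σ → ℝ} {a b : ℝ} {f g : MvPolynomial σ R} (hf : Van w a f) (hg : Van w b g) :
    Van w (a + b) (f * g) := by
  classical
  intro τ hτ
  rw [coeff_mul]
  refine Finset.sum_eq_zero fun p hp => ?_
  rw [Finset.HasAntidiagonal.mem_antidiagonal] at hp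
  have h1 : ∑ i, (τ i : ℝ) * w i = ∑ i, (p.1 i : ℝ) * w i + ∑ i, (p.2 i : ℝ) * w i := by
    rw [← hp, ← Finset.sum_add_distrib]
    refine Finset.sum_congr rfl fun i _ => ?_
    simp [add_mul]
  by_cases h : ∑ i, (p.1 i : ℝ) * w i < a
  · rw [hf _ h, zero_mul]
  · rw [hg p.2 (by linarith), mul_zero]

lemma van_of_nonpos {w : σ → ℝ} (hw : ∀ i, 0 ≤ w i) {a : ℝ} (ha : a ≤ 0) (f : MvPolynomial σ R) :
    Van w a f := fun τ hτ => by
  have : 0 ≤ ∑ i, (τ i : ℝ) * w i := Finset.sum_nonneg fun i _ => mul_nonneg (by positivity) (hw i)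
  linarith

lemma Van.sum {ι : Type*} {w : σ → ℝ} {a : ℝ} {s : Finset ι} {f : ι → MvPolynomial σ R}
    (hf : ∀ i ∈ s, Van w a (f i)) : Van w a (∑ i ∈ s, f i) := fun τ hτ => by
  rw [coeff_sum]
  exact Finset.sum_eq_zero fun i hi => hf i hi τ hτ

lemma Van.prod {ι : Type*} {w : σ → ℝ} (hw : ∀ i, 0 ≤ w i) {a : ι → ℝ} {s : Finset ι}
    {f : ι → MvPolynomial σ R}
    (hf : ∀ i ∈ s, Van w (a i) (f i)) : Van w (∑ i ∈ s, a i) (∏ i ∈ s, f i) := by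
  classical
  induction s using Finset.induction_on with
  | empty => simpa using van_of_nonpos hw le_rfl _
  | insert i s hi ih =>
    rw [Finset.sum_insert hi, Finset.prod_insert hi]
    exact (hf i (by simp)).mul (ih fun j hj => hf j (by simp [hj]))

lemma Van.det {l : ℕ} {w : σ → ℝ} (hw : ∀ i, 0 ≤ w i) {a : Fin l → ℝ}
    {M : Matrix (Fin l) (Fin l) (MvPolynomial σ R)} (hM : ∀ i k, Van w (a k) (M i k)) :
    Van w (∑ k, a k) M.det := by
  rw [Matrix.det_apply]
  refine Van.sum fun π _ τ hτ => ?_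
  have := Van.prod hw (fun (k : Fin l) (_ : k ∈ Finset.univ) => hM (π k) k) τ hτ
  rcases Int.units_eq_one_or (Equiv.Perm.sign π) with h | h <;> simp [h, this]

end Vanish

section Degree

open MvPolynomial

lemma degreeOf_det_le {σ R : Type*} [CommRing R] {l : ℕ}
    (M : Matrix (Fin l) (Fin l) (MvPolynomial σ R)) (i : σ) (d : ℕ)
    (hM : ∀ j k, degreeOf i (M j k) ≤ d) : degreeOf i M.det ≤ l * d := by
  rw [Matrix.det_apply]
  refine (degreeOf_sum_le _ _ _).trans (Finset.sup_le fun π _ => ?_)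
  have h : degreeOf i (∏ k, M (π k) k) ≤ l * d := by
    refine (degreeOf_prod_le _ _ _).trans ?_
    simpa using Finset.sum_le_card_nsmul Finset.univ _ d fun k _ => hM (π k) k
  rcases Int.units_eq_one_or (Equiv.Perm.sign π) with h' | h' <;> simpa [h'] using h

lemma sum_max_ge {θ : ℝ} (h0 : 0 < θ) (h1 : θ ≤ 1) {r l : ℕ} (hr : 0 < r) (hl : l ≤ r + 1) :
    l * θ ^ 2 / 8 ≤ ∑ k : Fin l, max 0 (θ - (k : ℕ) / r) := by
  have hr' : (0 : ℝ) < r := by exact_mod_cast hr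
  set m := min l (⌊θ * r / 2⌋₊ + 1) with hm
  have h2 : (m : ℝ) * (θ / 2) ≤ ∑ k ∈ Finset.range l, max 0 (θ - k / r) := by
    have hsub : Finset.range m ⊆ Finset.range l := Finset.range_subset_range.2 (min_le_left _ _)
    refine le_trans ?_ (Finset.sum_le_sum_of_subset_of_nonneg hsub fun _ _ _ => le_max_left _ _)
    have : ∑ k ∈ Finset.range m, θ / 2 ≤ ∑ k ∈ Finset.range m, max 0 (θ - k / r) := by
      refine Finset.sum_le_sum fun k hk => le_trans ?_ (le_max_right _ _)
      have hk' : k ≤ ⌊θ * r / 2⌋₊ := by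
        have := Finset.mem_range.1 hk
        have := min_le_right l (⌊θ * r / 2⌋₊ + 1)
        omega
      have hk'' : (k : ℝ) ≤ θ * r / 2 := (Nat.le_floor_iff (by positivity)).1 hk'
      have : (k : ℝ) / r ≤ θ / 2 := by
        rw [div_le_iff₀ hr']; linarith
      linarith
    simpa using this
  have h3 : (l : ℝ) * θ / 4 ≤ m := by
    rw [hm, Nat.cast_min]
    refine le_min ?_ ?_
    · have : (0 : ℝ) ≤ l := by positivity
      nlinarith
    · have h4 := Nat.lt_floor_add_one (θ * r / 2)
      have h5 : (l : ℝ) ≤ 2 * r := by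
        have : l ≤ 2 * r := by omega
        exact_mod_cast this
      push_cast
      nlinarith
  rw [Fin.sum_univ_eq_sum_range (fun k : ℕ => max 0 (θ - (k : ℝ) / r)) l]
  nlinarith

end Degree

section RothLemma

open MvPolynomial

variable {n : ℕ}

lemma exists_wronskian_eq_box {f : MvPolynomial (Fin (n + 1)) ℤ} (hf : f ≠ 0) {d : ℕ}
    (hd : degreeOf 0 f ≤ d) :
    ∃ l : ℕ, 0 < l ∧ l ≤ d + 1 ∧ ∃ δ : Fin l → Fin n →₀ ℕ, (∀ i, ∑ j, δ i j ≤ d) ∧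
      ∃ (p : MvPolynomial (Fin n) ℚ) (q : Polynomial ℚ), p ≠ 0 ∧ q ≠ 0 ∧
        map (Int.castRingHom ℚ)
          (Matrix.of fun i k : Fin l => hasse (Finsupp.cons (k : ℕ) (δ i)) f).det = box p q := by
  set F := map (Int.castRingHom ℚ) f with hF
  have hF0 : F ≠ 0 := by
    rw [hF, ← map_zero (map (Int.castRingHom ℚ))]
    exact (map_injective _ Int.cast_injective).ne hf
  have hdF : degreeOf 0 F ≤ d := by
    rw [degreeOf_le_iff] at hd ⊢
    exact fun e he => hd e (support_map_subset _ _ he)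
  obtain ⟨φ₀, ψ₀, h0⟩ := exists_sum_box F hdF
  obtain ⟨l, hl, φ, ψ, hφ, hψ, h1⟩ := exists_linearIndependent_sum box _ φ₀ ψ₀
  have hFs : F = ∑ j, box (φ j) (ψ j) := h0.trans h1
  obtain ⟨δ, hδ, hdet⟩ := exists_det_hasse_ne_zero φ hφ
  refine ⟨l, ?_, hl, δ, fun i => (hδ i).trans (by have := i.2; omega), _, _, hdet,
    det_hasseDeriv_ne_zero ψ hψ, ?_⟩
  · rcases Nat.eq_zero_or_pos l with rfl | h
    · simp at hFs; exact absurd hFs hF0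
    · exact h
  · rw [box_apply, ← AlgHom.coe_toRingHom, ← AlgHom.coe_toRingHom, RingHom.map_det, RingHom.map_det,
      RingHom.map_det, ← Matrix.det_transpose (RingHom.mapMatrix _ (Matrix.of fun k j : Fin l => Polynomial.hasseDeriv (k : ℕ) (ψ j))),
      ← Matrix.det_mul]
    congr 1
    ext1 i k
    rw [Matrix.mul_apply]
    change map _ (hasse _ f) = ∑ j, rename Fin.succ (hasse (δ i) (φ j)) *
      Polynomial.aeval (X 0) (Polynomial.hasseDeriv (k : ℕ) (ψ j))
    rw [map_hasse, ← hF, hFs, map_sum]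
    exact Finset.sum_congr rfl fun j _ => by rw [hasse_box, box_apply]

lemma abs_coeff_le_l1 {σ : Type*} (f : MvPolynomial σ ℤ) (e : σ →₀ ℕ) :
    |((coeff e f : ℤ) : ℝ)| ≤ l1 f := by
  by_cases he : e ∈ f.support
  · exact Finset.single_le_sum (f := fun e => |((coeff e f : ℤ) : ℝ)|) (fun _ _ => abs_nonneg _) he
  · rw [notMem_support_iff.1 he]
    simpa using l1_nonneg f

lemma exists_factors {W : MvPolynomial (Fin (n + 1)) ℤ} {p : MvPolynomial (Fin n) ℚ}
    {q : Polynomial ℚ} (hp : p ≠ 0) (hq : q ≠ 0) (hW : map (Int.castRingHom ℚ) W = box p q) :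
    ∃ (U : MvPolynomial (Fin n) ℤ) (V : Polynomial ℤ) (a b : ℚ), a ≠ 0 ∧ b ≠ 0 ∧
      map (Int.castRingHom ℚ) U = C a * p ∧ V.map (Int.castRingHom ℚ) = Polynomial.C b * q ∧
      (∀ i, degreeOf i U ≤ degreeOf i.succ W) ∧ l1 U ≤ l1 W ∧
      ∀ d, |((V.coeff d : ℤ) : ℝ)| ≤ l1 W := by
  have hc : ∀ k τ, ((coeff (Finsupp.cons k τ) W : ℤ) : ℚ) = coeff τ p * q.coeff k := by
    intro k τ
    rw [← coeff_box, ← hW, coeff_map]; rfl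
  obtain ⟨τ, hτ⟩ := ne_zero_iff.1 hp
  have hk := Polynomial.leadingCoeff_ne_zero.2 hq
  set k := q.natDegree
  have hV : ∀ d, (∑ j ∈ Finset.range (k + 1), Polynomial.monomial j
      (coeff (Finsupp.cons j τ) W)).coeff d = coeff (Finsupp.cons d τ) W := by
    intro d
    rw [Polynomial.finsetSum_coeff]
    simp only [Polynomial.coeff_monomial]
    rw [Finset.sum_ite_eq']
    split_ifs with h
    · rfl
    · have h1 := hc d τ
      rw [Polynomial.coeff_eq_zero_of_natDegree_lt (by simpa using h), mul_zero] at h1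
      exact_mod_cast h1.symm
  refine ⟨(finSuccEquiv ℤ n W).coeff k, ∑ j ∈ Finset.range (k + 1), Polynomial.monomial j
      (coeff (Finsupp.cons j τ) W), q.coeff k, coeff τ p, hk, hτ, ?_, ?_,
      fun i => degreeOf_coeff_finSuccEquiv _ _ _, ?_, fun d => ?_⟩
  · ext e
    rw [coeff_map, finSuccEquiv_coeff_coeff, coeff_C_mul, mul_comm]
    exact hc k e
  · ext d
    rw [Polynomial.coeff_map, Polynomial.coeff_C_mul, hV]
    exact hc d τ
  · classical
    have hinj : Set.InjOn (fun e : Fin n →₀ ℕ => Finsupp.cons k e)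
        ((finSuccEquiv ℤ n W).coeff k).support := fun e _ e' _ h => Finsupp.cons_right_injective k h
    rw [l1.eq_1 ((finSuccEquiv ℤ n W).coeff k)]
    simp only [finSuccEquiv_coeff_coeff]
    rw [← Finset.sum_image (f := fun e => |((coeff e W : ℤ) : ℝ)|) hinj]
    refine Finset.sum_le_sum_of_subset_of_nonneg (fun e he => ?_) fun _ _ _ => abs_nonneg _
    obtain ⟨e', he', rfl⟩ := Finset.mem_image.1 he
    rw [mem_support_iff, finSuccEquiv_coeff_coeff] at he'
    exact mem_support_iff.2 he'
  · rw [hV]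
    exact abs_coeff_le_l1 _ _

/-- The conclusion of Roth's lemma for `n` variables, index bound `Θ` and parameter `δ`. -/
def RothBound (n : ℕ) (Θ δ : ℝ) : Prop :=
  ∀ (r : Fin n → ℕ) (u v : Fin n → ℤ) (A : ℝ) (f : MvPolynomial (Fin n) ℤ), 1 < A →
    (∀ i, 0 < r i) → (∀ i j, i < j → (r i : ℝ) ≤ δ * r j) → (∀ i, IsCoprime (u i) (v i)) →
    (∀ i, v i ≠ 0) → (∀ i, A ≤ ((max |u i| |v i| : ℤ) : ℝ) ^ r i) →
    (4 : ℝ) ^ (∑ i, r i) ≤ A ^ δ → f ≠ 0 → (∀ i, degreeOf i f ≤ r i) → l1 f ≤ A ^ δ →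
    ∃ τ : Fin n →₀ ℕ, ∑ i, (τ i : ℝ) * (1 / r i) < Θ ∧
      coeff τ (shift (fun i => (u i : ℚ) / v i) (map (Int.castRingHom ℚ) f)) ≠ 0

lemma van_wronskian {n l : ℕ} {f : MvPolynomial (Fin (n + 1)) ℤ} {r : Fin (n + 1) → ℕ}
    (x : Fin (n + 1) → ℚ) {δ Θ : ℝ} (hδ : 0 ≤ δ) (hr : ∀ i, 0 < r i)
    (hrδ : ∀ i j, i < j → (r i : ℝ) ≤ δ * r j) (e : Fin l → Fin n →₀ ℕ)
    (he : ∀ i, ∑ j, e i j ≤ r 0)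
    (hvan : Van (fun i => 1 / (r i : ℝ)) Θ (shift x (map (Int.castRingHom ℚ) f))) :
    Van (fun i => 1 / (r i : ℝ)) (∑ k : Fin l, max 0 (Θ - δ - (k : ℕ) / r 0))
      (shift x (map (Int.castRingHom ℚ)
        (Matrix.of fun i k : Fin l => hasse (Finsupp.cons (k : ℕ) (e i)) f).det)) := by
  have hw : ∀ i, 0 ≤ 1 / (r i : ℝ) := fun i => by positivity
  rw [RingHom.map_det, ← AlgHom.coe_toRingHom, RingHom.map_det]
  refine Van.det hw fun i k => ?_
  change Van _ _ (shift x (map (Int.castRingHom ℚ) (hasse (Finsupp.cons (k : ℕ) (e i)) f)))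
  rcases le_total (Θ - δ - (k : ℕ) / r 0) 0 with h | h
  · rw [max_eq_left h]
    exact van_of_nonpos hw le_rfl _
  rw [max_eq_right h]
  intro τ hτ
  rw [map_hasse, coeff_shift_hasse]
  refine mul_eq_zero_of_right _ (hvan _ ?_)
  have h1 : ∑ i_1 : Fin (n + 1), (((τ + Finsupp.cons (k : ℕ) (e i)) i_1 : ℕ) : ℝ) * (1 / (r i_1 : ℝ)) =
      ∑ i_1 : Fin (n + 1), (τ i_1 : ℝ) * (1 / (r i_1 : ℝ)) +
      ((k : ℕ) / r 0 + ∑ j : Fin n, (e i j : ℝ) * (1 / r j.succ)) := by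
    have h2 : ((k : ℕ) / r 0 + ∑ j : Fin n, (e i j : ℝ) * (1 / r j.succ)) =
        ∑ j : Fin (n + 1), ((Finsupp.cons (k : ℕ) (e i) j : ℕ) : ℝ) * (1 / (r j : ℝ)) := by
      rw [Fin.sum_univ_succ]
      simp [div_eq_mul_inv]
    rw [h2, ← Finset.sum_add_distrib]
    refine Finset.sum_congr rfl fun j _ => ?_
    rw [Finsupp.add_apply]
    push_cast
    ring
  have h0 : (0 : ℝ) < r 0 := by exact_mod_cast hr 0
  have h3 : ∑ j : Fin n, (e i j : ℝ) * (1 / r j.succ) ≤ δ := by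
    calc ∑ j : Fin n, (e i j : ℝ) * (1 / r j.succ) ≤ ∑ j : Fin n, (e i j : ℝ) * (δ / r 0) := by
          refine Finset.sum_le_sum fun j _ => mul_le_mul_of_nonneg_left ?_ (by positivity)
          have h4 : (0 : ℝ) < r j.succ := by exact_mod_cast hr _
          rw [div_le_div_iff₀ h4 h0, one_mul]
          exact hrδ 0 j.succ (Fin.succ_pos j)
      _ = ((∑ j, e i j : ℕ) : ℝ) * (δ / r 0) := by push_cast; rw [Finset.sum_mul]
      _ ≤ δ := by
          rw [mul_div_assoc', div_le_iff₀ h0, mul_comm]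
          exact mul_le_mul_of_nonneg_left (by exact_mod_cast he i) hδ
  rw [h1]
  linarith

lemma l1_wronskian_le {n l : ℕ} {f : MvPolynomial (Fin (n + 1)) ℤ} {r : Fin (n + 1) → ℕ}
    (hlr : l ≤ r 0 + 1)
    (hf : ∀ i, degreeOf i f ≤ r i) (e : Fin l → Fin n →₀ ℕ) :
    l1 (Matrix.of fun i k : Fin l => hasse (Finsupp.cons (k : ℕ) (e i)) f).det ≤
      (4 ^ (∑ i, r i) * l1 f) ^ l := by
  refine (l1_det_le _ (2 ^ (∑ i, r i) * l1 f) fun i k => l1_hasse_le _ f r hf).trans ?_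
  have h1 : (l.factorial : ℝ) ≤ (2 ^ (∑ i, r i)) ^ l := by
    have h2 : l ≤ 2 ^ (∑ i, r i) := by
      have h3 : r 0 ≤ ∑ i, r i := Finset.single_le_sum (fun _ _ => Nat.zero_le _) (Finset.mem_univ 0)
      have h4 : ∑ i, r i < 2 ^ (∑ i, r i) := Nat.lt_two_pow_self
      omega
    have h5 : l.factorial ≤ (2 ^ (∑ i, r i)) ^ l :=
      (Nat.factorial_le_pow l).trans (Nat.pow_le_pow_left h2 l)
    exact_mod_cast h5
  have h6 : (0 : ℝ) ≤ (2 ^ (∑ i, r i) * l1 f) ^ l :=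
    pow_nonneg (mul_nonneg (by positivity) (l1_nonneg f)) l
  refine (mul_le_mul_of_nonneg_right h1 h6).trans ?_
  rw [← mul_pow, ← mul_assoc, ← mul_pow]
  norm_num

theorem rothBound_succ {n : ℕ} {Θ Θ' δ' : ℝ} (hΘ : 0 < Θ) (hΘ1 : Θ ≤ 1) (hΘ' : Θ' = Θ ^ 2 / 64)
    (h : RothBound n Θ' δ') {δ : ℝ} (hδ0 : 0 < δ) (hδ : 2 * δ ≤ δ') (hδΘ : δ ≤ Θ ^ 2 / 128) :
    RothBound (n + 1) Θ δ := by
  intro r u v A f hA hr hrδ huv hv hAh h4 hf hdeg hl1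
  by_contra! hcon
  set x : Fin (n + 1) → ℚ := fun i => (u i : ℚ) / v i with hx
  have hvan : Van (fun i => 1 / (r i : ℝ)) Θ (shift x (map (Int.castRingHom ℚ) f)) :=
    fun τ hτ => hcon τ hτ
  obtain ⟨l, hl, hlr, e, he, p, q, hp, hq, hW⟩ := exists_wronskian_eq_box hf (hdeg 0)
  have hvanW := van_wronskian x hδ0.le hr hrδ e he hvan
  have hl1W := l1_wronskian_le hlr hdeg e
  have hdegW : ∀ i, degreeOf i (Matrix.of fun i k : Fin l =>
      hasse (Finsupp.cons (k : ℕ) (e i)) f).det ≤ l * r i :=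
    fun i => degreeOf_det_le _ i _ fun j k => (degreeOf_hasse_le _ _ _).trans (hdeg i)
  rw [hW, shift_box] at hvanW
  obtain ⟨U, V, a, b, ha, hb, hU, hV, hUdeg, hU1, hV1⟩ := exists_factors hp hq hW
  have hA0 : 0 < A := by linarith
  have hl0 : (0 : ℝ) < l := by exact_mod_cast hl
  have hl1W' : l1 (Matrix.of fun i k : Fin l => hasse (Finsupp.cons (k : ℕ) (e i)) f).det ≤
      A ^ (2 * δ * l) := by
    refine hl1W.trans ?_
    have : (4 ^ (∑ i, r i) * l1 f) ≤ A ^ δ * A ^ δ := mul_le_mul h4 hl1 (l1_nonneg _) (by positivity)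
    refine (pow_le_pow_left₀ (mul_nonneg (by positivity) (l1_nonneg _)) this l).trans ?_
    rw [← Real.rpow_add hA0, ← Real.rpow_mul_natCast hA0.le]
    rw [two_mul]
  have hU0 : U ≠ 0 := by
    rintro rfl
    rw [map_zero, eq_comm, mul_eq_zero] at hU
    exact hU.elim (by simpa using ha) hp
  have hV0 : V ≠ 0 := by
    rintro rfl
    rw [Polynomial.map_zero, eq_comm, mul_eq_zero] at hV
    exact hV.elim (by simpa using hb) hq
  -- the factor in the first variable
  have hk := (pow_rootMultiplicity_le (huv 0) (hv 0) hV0 hV1).trans hl1W'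
  rw [hV] at hk
  have hq' : Polynomial.rootMultiplicity ((u 0 : ℚ) / v 0) (Polynomial.C b * q) =
      Polynomial.rootMultiplicity ((u 0 : ℚ) / v 0) q := by
    rw [Polynomial.rootMultiplicity_mul (mul_ne_zero (by simpa using hb) hq),
      Polynomial.rootMultiplicity_C, zero_add]
  rw [hq'] at hk
  set k := Polynomial.rootMultiplicity ((u 0 : ℚ) / v 0) q with hkdef
  have hr0 : (0 : ℝ) < r 0 := by exact_mod_cast hr 0
  have hk' : (k : ℝ) * (1 / r 0) ≤ 2 * δ * l := by
    have h1 : A ^ ((k : ℝ) * (1 / r 0)) ≤ A ^ (2 * δ * l) := by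
      refine le_trans ?_ hk
      have hh0 : (0 : ℝ) ≤ ((max |u 0| |v 0| : ℤ) : ℝ) := by
        exact_mod_cast le_max_of_le_left (abs_nonneg _)
      calc A ^ ((k : ℝ) * (1 / r 0)) ≤ (((max |u 0| |v 0| : ℤ) : ℝ) ^ r 0) ^ ((k : ℝ) * (1 / r 0)) :=
            Real.rpow_le_rpow hA0.le (hAh 0) (by positivity)
        _ = ((max |u 0| |v 0| : ℤ) : ℝ) ^ k := by
            rw [← Real.rpow_natCast, ← Real.rpow_mul hh0, ← Real.rpow_natCast]
            congr 1
            field_simp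
    exact (Real.rpow_le_rpow_left_iff hA).1 h1
  have hqk : (Polynomial.taylor (x 0) q).coeff k ≠ 0 := by
    intro h0
    have h1 : (Polynomial.X : Polynomial ℚ) ^ (k + 1) ∣ Polynomial.taylor (x 0) q := by
      rw [Polynomial.X_pow_dvd_iff]
      intro d hd
      rcases Nat.lt_succ_iff_lt_or_eq.1 hd with hd | rfl
      · have h2 := Polynomial.X_sub_C_pow_dvd_iff.1 (Polynomial.pow_rootMultiplicity_dvd q (x 0))
        exact Polynomial.X_pow_dvd_iff.1 h2 d hd
      · exact h0
    rw [Polynomial.taylor_apply, ← Polynomial.X_sub_C_pow_dvd_iff,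
      ← Polynomial.le_rootMultiplicity_iff hq] at h1
    exact absurd h1 (Nat.not_succ_le_self k)
  -- the factor in the other variables
  obtain ⟨τ, hτ, hτ0⟩ := h (fun i => l * r i.succ) (fun i => u i.succ) (fun i => v i.succ) (A ^ l) U
    (one_lt_pow₀ hA hl.ne') (fun i => Nat.mul_pos hl (hr _))
    (fun i j hij => by
      have h1 := hrδ i.succ j.succ (Fin.succ_lt_succ_iff.2 hij)
      have h2 : (0 : ℝ) ≤ r j.succ := by positivity
      push_cast
      nlinarith [mul_nonneg hl0.le h2])
    (fun i => huv _) (fun i => hv _)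
    (fun i => by
      rw [mul_comm, pow_mul]
      exact pow_le_pow_left₀ hA0.le (hAh i.succ) l)
    (by
      rw [← Finset.mul_sum, mul_comm, pow_mul, ← Real.rpow_natCast_mul hA0.le, mul_comm,
        Real.rpow_mul_natCast hA0.le]
      refine pow_le_pow_left₀ (by positivity) ?_ l
      refine le_trans ?_ (h4.trans (Real.rpow_le_rpow_of_exponent_le hA.le (by linarith)))
      refine pow_le_pow_right₀ (by norm_num) ?_
      rw [Fin.sum_univ_succ r]
      exact Nat.le_add_left _ _)
    hU0 (fun i => (hUdeg i).trans (hdegW _))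
    (by
      refine (hU1.trans hl1W').trans ?_
      rw [← Real.rpow_natCast_mul hA0.le]
      refine Real.rpow_le_rpow_of_exponent_le hA.le ?_
      nlinarith)
  rw [hU, map_mul, show shift (fun i : Fin n => (u i.succ : ℚ) / v i.succ) (C a) = C a by simp [shift],
    coeff_C_mul] at hτ0
  have hτ1 : coeff τ (shift (fun i : Fin n => x i.succ) p) ≠ 0 := right_ne_zero_of_mul hτ0
  refine mul_ne_zero hτ1 hqk ?_
  rw [← coeff_box]
  refine hvanW _ ?_
  rw [Fin.sum_univ_succ]
  simp only [Finsupp.cons_zero, Finsupp.cons_succ]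
  have h5 : ∑ i : Fin n, (τ i : ℝ) * (1 / (r i.succ : ℝ)) < l * Θ' := by
    have h6 : ∑ i : Fin n, (τ i : ℝ) * (1 / (r i.succ : ℝ)) =
        l * ∑ i : Fin n, (τ i : ℝ) * (1 / ((l * r i.succ : ℕ) : ℝ)) := by
      rw [Finset.mul_sum]
      refine Finset.sum_congr rfl fun i _ => ?_
      have h7 : (0 : ℝ) < r i.succ := by exact_mod_cast hr _
      push_cast
      field_simp
    rw [h6]
    exact mul_lt_mul_of_pos_left hτ hl0
  have h8 : Θ / 2 ≤ Θ - δ := by nlinarith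
  have h9 := sum_max_ge (θ := Θ - δ) (by linarith) (by linarith) (hr 0) hlr
  have h10 : (Θ / 2) ^ 2 ≤ (Θ - δ) ^ 2 := pow_le_pow_left₀ (by linarith) h8 2
  refine lt_of_lt_of_le ?_ h9
  have h11 : l * ((Θ / 2) ^ 2 / 8) ≤ l * ((Θ - δ) ^ 2 / 8) := by gcongr
  have h12 : 2 * δ * l ≤ l * (Θ ^ 2 / 64) := by nlinarith
  rw [hΘ'] at h5
  nlinarith

/-- **Roth's lemma.** -/
theorem exists_rothBound (n : ℕ) : ∀ Θ : ℝ, 0 < Θ → ∃ δ : ℝ, 0 < δ ∧ RothBound n Θ δ := by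
  induction n with
  | zero =>
    intro Θ hΘ
    refine ⟨1, one_pos, ?_⟩
    intro r u v A f hA hr hrδ huv hv hAh h4 hf hdeg hl1
    refine ⟨0, by simpa using hΘ, ?_⟩
    have h0 : shift (fun i => (u i : ℚ) / v i) (map (Int.castRingHom ℚ) f) ≠ 0 := by
      rw [Ne, shift_eq_zero_iff, ← map_zero (map (Int.castRingHom ℚ))]
      exact (map_injective _ Int.cast_injective).ne hf
    obtain ⟨τ, hτ⟩ := ne_zero_iff.1 h0
    rwa [Subsingleton.elim τ 0] at hτ
  | succ n ih =>
    intro Θ hΘ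
    set Θ₁ := min Θ 1 with hΘ₁
    have h1 : 0 < Θ₁ := lt_min hΘ one_pos
    obtain ⟨δ', hδ', hR⟩ := ih (Θ₁ ^ 2 / 64) (by positivity)
    refine ⟨min (δ' / 2) (Θ₁ ^ 2 / 128), lt_min (by linarith) (by positivity), ?_⟩
    have hR' := rothBound_succ (δ := min (δ' / 2) (Θ₁ ^ 2 / 128)) h1 (min_le_right _ _) rfl hR
      (lt_min (by linarith) (by positivity))
      (by have := min_le_left (δ' / 2) (Θ₁ ^ 2 / 128); linarith) (min_le_right _ _)
    intro r u v A f hA hr hrδ huv hv hAh h4 hf hdeg hl1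
    obtain ⟨τ, hτ, hτ0⟩ := hR' r u v A f hA hr hrδ huv hv hAh h4 hf hdeg hl1
    exact ⟨τ, hτ.trans_le (min_le_left _ _), hτ0⟩

end RothLemma

section Count

variable {m : ℕ} {r : Fin m → ℕ}

/-- The deviation from the mean of a coordinate. -/
noncomputable def dev (t : (i : Fin m) → Fin (r i + 1)) (i : Fin m) : ℝ := (t i : ℕ) / r i - 1 / 2

lemma dev_rev (hr : ∀ i, 0 < r i) (t : (i : Fin m) → Fin (r i + 1)) (i : Fin m) :
    dev (Function.update t i (t i).rev) i = - dev t i := by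
  have h0 : (0 : ℝ) < r i := by exact_mod_cast hr i
  have h1 : (((t i).rev : ℕ) : ℝ) = r i - (t i : ℕ) := by
    rw [Fin.val_rev, Nat.cast_sub (by omega)]
    push_cast; ring
  rw [dev, dev, Function.update_self, h1]
  field_simp
  ring

lemma sum_dev_mul_dev (hr : ∀ i, 0 < r i) {i j : Fin m} (hij : i ≠ j) :
    ∑ t : (i : Fin m) → Fin (r i + 1), dev t i * dev t j = 0 := by
  have hinv : Function.Involutive fun t : (i : Fin m) → Fin (r i + 1) =>
      Function.update t i (t i).rev := by
    intro t
    simp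
  let e : Equiv.Perm ((i : Fin m) → Fin (r i + 1)) := hinv.toPerm
  have h := Equiv.sum_comp e fun t : (i : Fin m) → Fin (r i + 1) => dev t i * dev t j
  have h1 : ∀ t : (i : Fin m) → Fin (r i + 1), dev (e t) i * dev (e t) j = -(dev t i * dev t j) := by
    intro t
    have h2 : dev (e t) j = dev t j := by
      change dev (Function.update t i (t i).rev) j = _
      rw [dev, dev, Function.update_of_ne hij.symm]
    rw [h2]
    change dev (Function.update t i (t i).rev) i * _ = _
    rw [dev_rev hr, neg_mul]
  simp only [h1, Finset.sum_neg_distrib] at h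
  linarith

lemma dev_sq_le (hr : ∀ i, 0 < r i) (t : (i : Fin m) → Fin (r i + 1)) (i : Fin m) :
    dev t i * dev t i ≤ 1 / 4 := by
  have h0 : (0 : ℝ) < r i := by exact_mod_cast hr i
  have h1 : ((t i : ℕ) : ℝ) / r i ≤ 1 := by
    rw [div_le_one h0]
    exact_mod_cast Nat.le_of_lt_succ (t i).2
  have h2 : 0 ≤ ((t i : ℕ) : ℝ) / r i := by positivity
  rw [dev]
  nlinarith

lemma sum_sum_dev_sq_le (hr : ∀ i, 0 < r i) :
    ∑ t : (i : Fin m) → Fin (r i + 1), (∑ i, dev t i) ^ 2 ≤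
      Fintype.card ((i : Fin m) → Fin (r i + 1)) * (m / 4) := by
  have h1 : ∀ t : (i : Fin m) → Fin (r i + 1), (∑ i, dev t i) ^ 2 =
      ∑ i, ∑ j, dev t i * dev t j := fun t => by rw [sq, Finset.sum_mul_sum]
  simp only [h1]
  rw [Finset.sum_comm]
  have h2 : ∀ i : Fin m, ∑ t : (i : Fin m) → Fin (r i + 1), ∑ j, dev t i * dev t j ≤
      Fintype.card ((i : Fin m) → Fin (r i + 1)) * (1 / 4) := by
    intro i
    rw [Finset.sum_comm, Finset.sum_eq_single i (fun j _ hj => sum_dev_mul_dev hr hj.symm) (by simp)]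
    refine (Finset.sum_le_card_nsmul _ _ (1 / 4) fun t _ => dev_sq_le hr t i).trans ?_
    rw [nsmul_eq_mul, Finset.card_univ]
  refine (Finset.sum_le_card_nsmul _ _ _ fun i _ => h2 i).trans (le_of_eq ?_)
  rw [nsmul_eq_mul, Finset.card_univ, Fintype.card_fin]
  ring

lemma card_weight_lt_le (hr : ∀ i, 0 < r i) {ε : ℝ} (hε : 0 < ε) (hm : 0 < m) :
    (Fintype.card {t : (i : Fin m) → Fin (r i + 1) //
      ∑ i, ((t i : ℕ) : ℝ) * (1 / r i) < m * (1 / 2 - ε)} : ℝ) * (4 * ε ^ 2 * m) ≤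
      Fintype.card ((i : Fin m) → Fin (r i + 1)) := by
  classical
  have hm' : (0 : ℝ) < m := by exact_mod_cast hm
  have h1 : (Fintype.card {t : (i : Fin m) → Fin (r i + 1) //
      ∑ i, ((t i : ℕ) : ℝ) * (1 / r i) < m * (1 / 2 - ε)} : ℝ) * (ε * m) ^ 2 ≤
      ∑ t : (i : Fin m) → Fin (r i + 1), (∑ i, dev t i) ^ 2 := by
    rw [Fintype.card_subtype, ← nsmul_eq_mul]
    refine (Finset.card_nsmul_le_sum _ (fun t => (∑ i, dev t i) ^ 2) _ fun t ht => ?_).trans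
      (Finset.sum_le_sum_of_subset_of_nonneg (Finset.filter_subset _ _) fun _ _ _ => sq_nonneg _)
    have h2 := (Finset.mem_filter.1 ht).2
    have h3 : ∑ i, dev t i = ∑ i, ((t i : ℕ) : ℝ) * (1 / r i) - m / 2 := by
      simp only [dev, Finset.sum_sub_distrib, div_eq_mul_inv, one_mul]
      simp
    rw [h3]
    have h4 : 0 < ε * m := by positivity
    nlinarith
  have h5 := h1.trans (sum_sum_dev_sq_le hr)
  have h6 : (Fintype.card {t : (i : Fin m) → Fin (r i + 1) //
      ∑ i, ((t i : ℕ) : ℝ) * (1 / r i) < m * (1 / 2 - ε)} : ℝ) * (4 * ε ^ 2 * m) * (m / 4) ≤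
      Fintype.card ((i : Fin m) → Fin (r i + 1)) * (m / 4) := by
    refine le_trans (le_of_eq ?_) h5
    ring
  exact le_of_mul_le_mul_right h6 (by positivity)

end Count

section ModByMonic

open Polynomial

/-- A bound for the growth of the remainders of powers of `X` modulo `g`. -/
noncomputable def growth (g : ℤ[X]) : ℤ := 1 + ∑ d ∈ g.support, |g.coeff d|

lemma one_le_growth (g : ℤ[X]) : 1 ≤ growth g := by
  have : 0 ≤ ∑ d ∈ g.support, |g.coeff d| := Finset.sum_nonneg fun _ _ => abs_nonneg _
  rw [growth]; omega

lemma abs_coeff_lt_growth (g : ℤ[X]) (d : ℕ) : 1 + |g.coeff d| ≤ growth g := by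
  rw [growth]
  by_cases h : d ∈ g.support
  · have := Finset.single_le_sum (f := fun d => |g.coeff d|) (fun _ _ => abs_nonneg _) h
    omega
  · have : 0 ≤ ∑ d ∈ g.support, |g.coeff d| := Finset.sum_nonneg fun _ _ => abs_nonneg _
    rw [notMem_support_iff.1 h]
    simp only [abs_zero]
    omega

lemma abs_coeff_X_pow_modByMonic_le {g : ℤ[X]} (hg : g.Monic) (hD : 0 < g.natDegree) (k d : ℕ) :
    |(X ^ k %ₘ g).coeff d| ≤ growth g ^ k := by
  have hg1 := one_le_growth g
  have hne : g ≠ 1 := by rintro rfl; simp at hD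
  induction k generalizing d with
  | zero =>
    have : (1 : ℤ[X]) %ₘ g = 1 := (modByMonic_eq_self_iff hg).2 (by
      rw [degree_one]; exact natDegree_pos_iff_degree_pos.1 hD)
    rw [pow_zero, this, coeff_one]
    split_ifs <;> simp
  | succ k ih =>
    set p := X ^ k %ₘ g with hp
    have hdegp : p.natDegree < g.natDegree := natDegree_modByMonic_lt _ hg hne
    have h1 : X ^ (k + 1) %ₘ g = X * p - C (p.coeff (g.natDegree - 1)) * g := by
      refine (div_modByMonic_unique (X * (X ^ k /ₘ g) + C (p.coeff (g.natDegree - 1))) _ hg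
        ⟨?_, ?_⟩).2
      · have := modByMonic_add_div (X ^ k : ℤ[X]) g
        rw [pow_succ, ← hp] at *
        linear_combination X * this
      · rw [degree_eq_natDegree hg.ne_zero, degree_lt_iff_coeff_zero]
        · intro N hN
          rcases N with _ | N
          · omega
          rw [coeff_sub, coeff_X_mul, coeff_C_mul]
          rcases hN.lt_or_eq with h | h
          · rw [coeff_eq_zero_of_natDegree_lt (by omega : p.natDegree < N),
              coeff_eq_zero_of_natDegree_lt h]
            simp
          · rw [← h, hg.coeff_natDegree, show g.natDegree - 1 = N by omega]
            simp
    rw [h1, coeff_sub, coeff_C_mul]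
    have h2 : |(X * p).coeff d| ≤ growth g ^ k := by
      rcases d with _ | d
      · simp only [mul_coeff_zero, coeff_X_zero, zero_mul, abs_zero]; positivity
      · rw [coeff_X_mul]; exact ih d
    have h3 := ih (g.natDegree - 1)
    have h4 := abs_coeff_lt_growth g d
    have h5 : 0 ≤ growth g ^ k := by positivity
    calc |(X * p).coeff d - p.coeff (g.natDegree - 1) * g.coeff d|
        ≤ |(X * p).coeff d| + |p.coeff (g.natDegree - 1)| * |g.coeff d| := by
          rw [← abs_mul]; exact abs_sub _ _
      _ ≤ growth g ^ k + growth g ^ k * |g.coeff d| :=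
          add_le_add h2 (mul_le_mul_of_nonneg_right h3 (abs_nonneg _))
      _ = growth g ^ k * (1 + |g.coeff d|) := by ring
      _ ≤ growth g ^ (k + 1) := by
          rw [pow_succ]; exact mul_le_mul_of_nonneg_left h4 h5

lemma pow_eq_sum_modByMonic {R : Type*} [CommRing R] {g : ℤ[X]} (hg : g.Monic)
    (hD : 0 < g.natDegree) {ξ : R} (hξ : aeval ξ g = 0) (k : ℕ) :
    ξ ^ k = ∑ d : Fin g.natDegree, ((X ^ k %ₘ g).coeff d : ℤ) * ξ ^ (d : ℕ) := by
  have hne : g ≠ 1 := by rintro rfl; simp at hD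
  have h1 : ξ ^ k = aeval ξ (X ^ k %ₘ g : ℤ[X]) := by
    have := congrArg (aeval ξ) (modByMonic_add_div (X ^ k : ℤ[X]) g)
    rw [map_add, map_mul, hξ, zero_mul, add_zero, map_pow, aeval_X] at this
    exact this.symm
  rw [h1, aeval_eq_sum_range' (natDegree_modByMonic_lt _ hg hne), Finset.sum_range]
  exact Finset.sum_congr rfl fun d _ => by rw [zsmul_eq_mul]

end ModByMonic

section Auxiliary

open MvPolynomial

attribute [local instance] Matrix.seminormedAddCommGroup

lemma exists_int_solution {I J : Type*} [Fintype I] [Fintype J] (A : Matrix J I ℤ) (hJ : 0 < Fintype.card J)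
    (hIJ : 2 * Fintype.card J ≤ Fintype.card I) {B : ℝ} (hB : 1 ≤ B) (hA : ∀ j i, |(A j i : ℝ)| ≤ B) :
    ∃ c : I → ℤ, c ≠ 0 ∧ A.mulVec c = 0 ∧ ∀ i, |(c i : ℝ)| ≤ Fintype.card I * B := by
  obtain ⟨c, hc0, hc, hcB⟩ := Int.Matrix.exists_ne_zero_int_vec_norm_le A (by omega) hJ
  refine ⟨c, hc0, hc, fun i => ?_⟩
  have h1 : |(c i : ℝ)| ≤ ‖c‖ := by
    have := norm_le_pi_norm c i
    rwa [Int.norm_eq_abs] at this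
  have hI : (1 : ℝ) ≤ Fintype.card I := by
    have : 1 ≤ Fintype.card I := by omega
    exact_mod_cast this
  have h2 : ‖A‖ ≤ B := by
    rw [Matrix.norm_le_iff (by linarith)]
    intro j i
    rw [Int.norm_eq_abs]
    exact hA j i
  have h3 : (Fintype.card I : ℝ) * max 1 ‖A‖ ≤ Fintype.card I * B := by
    gcongr
    exact max_le hB h2
  refine (h1.trans hcB).trans ?_
  have h4 : (1 : ℝ) ≤ Fintype.card I * max 1 ‖A‖ :=
    one_le_mul_of_one_le_of_one_le hI (le_max_left _ _)
  refine le_trans (Real.rpow_le_rpow_of_exponent_le h4 (y := (_ : ℝ)) (z := 1) ?_) (by simpa using h3)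
  have h5 : 2 * (Fintype.card J : ℝ) ≤ Fintype.card I := by exact_mod_cast hIJ
  have h6 : (0 : ℝ) < Fintype.card J := by exact_mod_cast hJ
  rw [div_le_one (by linarith)]
  linarith

variable {m : ℕ}

/-- The polynomial with prescribed coefficients in a box. -/
noncomputable def boxPoly (r : Fin m → ℕ) (c : ((i : Fin m) → Fin (r i + 1)) → ℤ) :
    MvPolynomial (Fin m) ℤ :=
  ∑ t, monomial (Finsupp.equivFunOnFinite.symm fun i => (t i : ℕ)) (c t)

lemma coeff_boxPoly (r : Fin m → ℕ) (c : ((i : Fin m) → Fin (r i + 1)) → ℤ)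
    (t : (i : Fin m) → Fin (r i + 1)) :
    coeff (Finsupp.equivFunOnFinite.symm fun i => (t i : ℕ)) (boxPoly r c) = c t := by
  classical
  rw [boxPoly, coeff_sum, Finset.sum_eq_single t]
  · simp
  · intro t' _ ht
    rw [coeff_monomial, if_neg]
    intro h
    refine ht (funext fun i => Fin.ext ?_)
    exact DFunLike.congr_fun h i
  · simp

lemma degreeOf_boxPoly_le (r : Fin m → ℕ) (c : ((i : Fin m) → Fin (r i + 1)) → ℤ) (i : Fin m) :
    degreeOf i (boxPoly r c) ≤ r i := by
  refine (degreeOf_sum_le _ _ _).trans (Finset.sup_le fun t _ => ?_)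
  rw [degreeOf_le_iff]
  intro e he
  rw [Finset.mem_singleton.1 (support_monomial_subset he)]
  exact Nat.le_of_lt_succ (t i).2

lemma l1_boxPoly_le (r : Fin m → ℕ) (c : ((i : Fin m) → Fin (r i + 1)) → ℤ) {B : ℝ}
    (hB : ∀ t, |(c t : ℝ)| ≤ B) :
    l1 (boxPoly r c) ≤ Fintype.card ((i : Fin m) → Fin (r i + 1)) * B := by
  refine (l1_sum_le _ _).trans ?_
  simp only [l1_monomial]
  refine (Finset.sum_le_card_nsmul _ _ B fun t _ => hB t).trans ?_
  rw [nsmul_eq_mul, Finset.card_univ]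

lemma coeff_shift_boxPoly {R : Type*} [CommRing R] (r : Fin m → ℕ)
    (c : ((i : Fin m) → Fin (r i + 1)) → ℤ) (ξ : R) (τ : Fin m →₀ ℕ) :
    coeff τ (shift (fun _ => ξ) (map (Int.castRingHom R) (boxPoly r c))) =
      ∑ t, (c t : R) * ((∏ i, ((t i : ℕ).choose (τ i) : R)) * ξ ^ (∑ i, ((t i : ℕ) - τ i))) := by
  rw [boxPoly, map_sum, map_sum, coeff_sum]
  refine Finset.sum_congr rfl fun t _ => ?_
  rw [map_monomial, coeff_shift_monomial, Finset.prod_mul_distrib, Finset.prod_pow_eq_pow_sum]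
  rfl

lemma card_box_le (r : Fin m → ℕ) :
    (Fintype.card ((i : Fin m) → Fin (r i + 1)) : ℝ) ≤ 2 ^ (∑ i, r i) := by
  rw [Fintype.card_pi, ← Finset.prod_pow_eq_pow_sum]
  push_cast
  refine Finset.prod_le_prod (fun _ _ => by positivity) fun i _ => ?_
  rw [Fintype.card_fin]
  have : r i + 1 ≤ 2 ^ r i := Nat.lt_two_pow_self
  exact_mod_cast this

/-- Polynomials with small coefficients vanishing to high order at the diagonal points given by the
roots of a monic polynomial. -/
theorem exists_auxiliary {g : Polynomial ℤ} (hg : g.Monic) (hD : 0 < g.natDegree) :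
    ∃ C : ℝ, 1 ≤ C ∧ ∀ ε : ℝ, 0 < ε → ∀ m : ℕ, (g.natDegree : ℝ) ≤ 2 * ε ^ 2 * m →
      ∀ r : Fin m → ℕ, (∀ i, 0 < r i) → ∃ f : MvPolynomial (Fin m) ℤ, f ≠ 0 ∧
        (∀ i, degreeOf i f ≤ r i) ∧ l1 f ≤ C ^ (∑ i, r i) ∧
        ∀ {R : Type} [CommRing R] (ξ : R), Polynomial.aeval ξ g = 0 → ∀ τ : Fin m →₀ ℕ,
          ∑ i, (τ i : ℝ) * (1 / r i) < m * (1 / 2 - ε) →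
          coeff τ (shift (fun _ => ξ) (map (Int.castRingHom R) f)) = 0 := by
  classical
  set G : ℝ := (growth g : ℝ) with hG
  have hG1 : 1 ≤ G := by rw [hG]; exact_mod_cast one_le_growth g
  refine ⟨8 * G, by linarith, fun ε hε m hm r hr => ?_⟩
  have hDR : (0 : ℝ) < g.natDegree := by exact_mod_cast hD
  have hm0 : 0 < m := by
    rcases Nat.eq_zero_or_pos m with rfl | h
    · simp at hm; omega
    · exact h
  have hm0' : (0 : ℝ) < m := by exact_mod_cast hm0
  rcases le_or_gt ((m : ℝ) * (1 / 2 - ε)) 0 with hs | hs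
  · refine ⟨1, one_ne_zero, fun i => by simp, ?_, fun ξ _ τ hτ => ?_⟩
    · rw [l1_one]; exact one_le_pow₀ (by linarith)
    · have : 0 ≤ ∑ i, (τ i : ℝ) * (1 / r i) := Finset.sum_nonneg fun i _ => by positivity
      linarith
  let I := (i : Fin m) → Fin (r i + 1)
  let T := {t : I // ∑ i, ((t i : ℕ) : ℝ) * (1 / r i) < m * (1 / 2 - ε)}
  let M : Matrix (T × Fin g.natDegree) I ℤ := fun td e =>
    (∏ i, ((e i : ℕ).choose (td.1.1 i : ℕ) : ℤ)) *
      (Polynomial.X ^ (∑ i, ((e i : ℕ) - (td.1.1 i : ℕ))) %ₘ g).coeff td.2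
  have hT0 : 0 < Fintype.card T := Fintype.card_pos_iff.2 ⟨⟨fun _ => 0, by simpa using hs⟩⟩
  have hcount := card_weight_lt_le hr hε hm0
  change (Fintype.card T : ℝ) * _ ≤ Fintype.card I at hcount
  have hcard : 2 * Fintype.card (T × Fin g.natDegree) ≤ Fintype.card I := by
    rw [Fintype.card_prod, Fintype.card_fin]
    have : (2 : ℝ) * (Fintype.card T * g.natDegree) ≤ Fintype.card I := by
      refine le_trans ?_ hcount
      have h1 : (0 : ℝ) < Fintype.card T := by exact_mod_cast hT0
      nlinarith
    exact_mod_cast this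
  have hM : ∀ j i, |(M j i : ℝ)| ≤ (2 * G) ^ (∑ i, r i) := by
    intro td e
    have h1 : ∏ i, ((e i : ℕ).choose (td.1.1 i : ℕ)) ≤ 2 ^ (∑ i, r i) := by
      rw [← Finset.prod_pow_eq_pow_sum]
      refine Finset.prod_le_prod' fun i _ => (Nat.choose_le_two_pow _ _).trans ?_
      exact Nat.pow_le_pow_right (by norm_num) (Nat.le_of_lt_succ (e i).2)
    have h1' : |((∏ i, ((e i : ℕ).choose (td.1.1 i : ℕ) : ℤ) : ℤ) : ℝ)| ≤ 2 ^ (∑ i, r i) := by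
      rw [abs_of_nonneg (by exact_mod_cast Nat.zero_le _)]
      exact_mod_cast h1
    have h2 := abs_coeff_X_pow_modByMonic_le hg hD (∑ i, ((e i : ℕ) - (td.1.1 i : ℕ))) td.2
    have h2' : |(((Polynomial.X ^ (∑ i, ((e i : ℕ) - (td.1.1 i : ℕ))) %ₘ g).coeff td.2 : ℤ) : ℝ)| ≤
        G ^ (∑ i, r i) := by
      have h3 : G ^ (∑ i, ((e i : ℕ) - (td.1.1 i : ℕ))) ≤ G ^ (∑ i, r i) := by
        refine pow_le_pow_right₀ hG1 (Finset.sum_le_sum fun i _ => ?_)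
        have := (e i).2
        omega
      refine le_trans ?_ h3
      rw [hG]
      exact_mod_cast h2
    simp only [M]
    rw [Int.cast_mul, abs_mul, mul_pow]
    exact mul_le_mul h1' h2' (abs_nonneg _) (by positivity)
  obtain ⟨c, hc0, hc, hcB⟩ := exists_int_solution M
    (by rw [Fintype.card_prod, Fintype.card_fin]; positivity) hcard
    (one_le_pow₀ (by linarith)) hM
  refine ⟨boxPoly r c, ?_, degreeOf_boxPoly_le r c, ?_, fun {R} _ ξ hξ τ hτ => ?_⟩
  · intro h0
    refine hc0 (funext fun t => ?_)
    rw [← coeff_boxPoly r c t, h0, coeff_zero]; rfl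
  · refine (l1_boxPoly_le r c hcB).trans ?_
    have h1 := card_box_le r
    calc (Fintype.card I : ℝ) * (Fintype.card I * (2 * G) ^ (∑ i, r i))
        ≤ 2 ^ (∑ i, r i) * (2 ^ (∑ i, r i) * (2 * G) ^ (∑ i, r i)) := by gcongr
      _ = (8 * G) ^ (∑ i, r i) := by rw [← mul_pow, ← mul_pow]; congr 1; ring
  · rw [coeff_shift_boxPoly]
    by_cases hτr : ∀ i, τ i ≤ r i
    · let t₀ : I := fun i => ⟨τ i, Nat.lt_succ_of_le (hτr i)⟩
      have ht₀ : ∑ i, ((t₀ i : ℕ) : ℝ) * (1 / r i) < m * (1 / 2 - ε) := hτ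
      have h1 : ∀ d : Fin g.natDegree, ∑ t : I, M (⟨t₀, ht₀⟩, d) t * c t = 0 :=
        fun d => congrFun hc (⟨t₀, ht₀⟩, d)
      have h2 : ∀ t : I, (c t : R) * ((∏ i, ((t i : ℕ).choose (τ i) : R)) *
          ξ ^ (∑ i, ((t i : ℕ) - τ i))) =
          ∑ d : Fin g.natDegree, ((M (⟨t₀, ht₀⟩, d) t * c t : ℤ) : R) * ξ ^ (d : ℕ) := by
        intro t
        rw [pow_eq_sum_modByMonic hg hD hξ, Finset.mul_sum, Finset.mul_sum]
        refine Finset.sum_congr rfl fun d _ => ?_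
        simp only [M, t₀]
        push_cast
        ring
      rw [Finset.sum_congr rfl fun t _ => h2 t, Finset.sum_comm]
      refine Finset.sum_eq_zero fun d _ => ?_
      rw [← Finset.sum_mul, ← Int.cast_sum, h1 d]
      simp
    · push Not at hτr
      obtain ⟨i, hi⟩ := hτr
      refine Finset.sum_eq_zero fun t _ => ?_
      rw [Finset.prod_eq_zero (Finset.mem_univ i)]
      · simp
      · rw [Nat.choose_eq_zero_of_lt (by have := (t i).2; omega)]; simp

end Auxiliary

section Numerator

open MvPolynomial

variable {n : ℕ}

/-- The homogeneous form of the coefficients of a shifted polynomial. -/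
noncomputable def homShift {R : Type*} [CommRing R] (r : Fin n → ℕ) (u v : Fin n → R)
    (f : MvPolynomial (Fin n) R) (τ : Fin n →₀ ℕ) : R :=
  ∑ e ∈ f.support, coeff e f *
    ∏ i, (((e i).choose (τ i) : R) * (u i ^ (e i - τ i) * v i ^ (r i - (e i - τ i))))

lemma homShift_eq {K : Type*} [Field K] {r : Fin n → ℕ} (u : Fin n → K) {v : Fin n → K}
    (hv : ∀ i, v i ≠ 0) {f : MvPolynomial (Fin n) K} (hf : ∀ i, degreeOf i f ≤ r i)
    (τ : Fin n →₀ ℕ) :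
    homShift r u v f τ = (∏ i, v i ^ r i) * coeff τ (shift (fun i => u i / v i) f) := by
  rw [coeff_shift, homShift, Finset.mul_sum]
  refine Finset.sum_congr rfl fun e he => ?_
  rw [mul_left_comm, ← Finset.prod_mul_distrib]
  congr 1
  refine Finset.prod_congr rfl fun i _ => ?_
  have h1 : e i ≤ r i := (degreeOf_le_iff.1 (hf i)) e he
  have h2 : v i ^ r i = v i ^ (r i - (e i - τ i)) * v i ^ (e i - τ i) := by
    rw [← pow_add]; congr 1; omega
  have := hv i
  rw [h2, div_pow]
  field_simp

lemma homShift_map {R S : Type*} [CommRing R] [CommRing S] {φ : R →+* S}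
    (hφ : Function.Injective φ) (r : Fin n → ℕ) (u v : Fin n → R)
    (f : MvPolynomial (Fin n) R) (τ : Fin n →₀ ℕ) :
    φ (homShift r u v f τ) = homShift r (fun i => φ (u i)) (fun i => φ (v i)) (map φ f) τ := by
  rw [homShift, homShift, support_map_of_injective _ hφ]
  simp [coeff_map]

lemma degreeOf_shift_le {R : Type*} [CommRing R] (x : Fin n → R) (f : MvPolynomial (Fin n) R)
    (i : Fin n) : degreeOf i (shift x f) ≤ degreeOf i f :=
  degreeOf_le_iff.2 fun _ he => le_of_coeff_shift_ne_zero (mem_support_iff.1 he) i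

lemma abs_homShift_le {r : Fin n → ℕ} (u v : Fin n → ℤ) {f : MvPolynomial (Fin n) ℤ}
    (hf : ∀ i, degreeOf i f ≤ r i) (τ : Fin n →₀ ℕ) :
    |((homShift r u v f τ : ℤ) : ℝ)| ≤
      l1 f * (2 ^ (∑ i, r i) * ∏ i, ((max |u i| |v i| : ℤ) : ℝ) ^ r i) := by
  rw [homShift, Int.cast_sum, l1, Finset.sum_mul]
  refine (Finset.abs_sum_le_sum_abs _ _).trans (Finset.sum_le_sum fun e he => ?_)
  rw [Int.cast_mul, abs_mul]
  refine mul_le_mul_of_nonneg_left ?_ (abs_nonneg _)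
  rw [Int.cast_prod, Finset.abs_prod, ← Finset.prod_pow_eq_pow_sum, ← Finset.prod_mul_distrib]
  refine Finset.prod_le_prod (fun _ _ => abs_nonneg _) fun i _ => ?_
  have h1 : e i ≤ r i := (degreeOf_le_iff.1 (hf i)) e he
  have h2 : (((e i).choose (τ i) : ℕ) : ℝ) ≤ 2 ^ r i := by
    have : (e i).choose (τ i) ≤ 2 ^ r i :=
      (Nat.choose_le_two_pow _ _).trans (Nat.pow_le_pow_right (by norm_num) h1)
    exact_mod_cast this
  have h3 : ((max |u i| |v i| : ℤ) : ℝ) ^ r i = ((max |u i| |v i| : ℤ) : ℝ) ^ (e i - τ i) *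
      ((max |u i| |v i| : ℤ) : ℝ) ^ (r i - (e i - τ i)) := by
    rw [← pow_add]; congr 1; omega
  push_cast at h3 ⊢
  rw [abs_mul, abs_mul, abs_pow, abs_pow, h3, abs_of_nonneg (by positivity)]
  gcongr
  · exact le_max_left _ _
  · exact le_max_right _ _

/-- The product of the `p`-adic absolute values of a nonzero integer over finitely many primes. -/
lemma one_le_abs_mul_prod_padicNorm (P : Finset Nat.Primes) {N : ℤ} (hN : N ≠ 0) :
    1 ≤ |(N : ℝ)| * ∏ p ∈ P, ‖(N : ℚ_[(p : ℕ)])‖ := by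
  have h1 : ∏ p ∈ P, ((p : ℕ) : ℤ) ^ padicValInt p N ∣ N := by
    refine Finset.prod_dvd_of_coprime (fun p _ q _ hpq => ?_) fun p _ => padicValInt_dvd N
    refine IsCoprime.pow (Nat.isCoprime_iff_coprime.2 ((Nat.coprime_primes p.2 q.2).2 ?_))
    exact fun h => hpq (Subtype.ext h)
  have h2 : ∏ p ∈ P, ‖(N : ℚ_[(p : ℕ)])‖ = (∏ p ∈ P, ((p : ℕ) : ℝ) ^ padicValInt p N)⁻¹ := by
    rw [← Finset.prod_inv_distrib]
    refine Finset.prod_congr rfl fun p _ => ?_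
    rw [Padic.norm_eq_zpow_neg_valuation (by exact_mod_cast hN), Padic.valuation_intCast, zpow_neg,
      zpow_natCast]
  have h3 : ∏ p ∈ P, ((p : ℕ) : ℝ) ^ padicValInt p N ≤ |(N : ℝ)| := by
    have := Int.le_of_dvd (abs_pos.2 hN) ((dvd_abs _ _).2 h1)
    exact_mod_cast this
  have h4 : 0 < ∏ p ∈ P, ((p : ℕ) : ℝ) ^ padicValInt p N :=
    Finset.prod_pos fun p _ => pow_pos (by exact_mod_cast p.2.pos) _
  rw [h2, ← div_eq_mul_inv, le_div_iff₀ h4, one_mul]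
  exact h3

lemma norm_homShift_le {p : ℕ} [Fact p.Prime] {r : Fin n → ℕ} (hr : ∀ i, 0 < r i)
    (u v : Fin n → ℤ) (hv : ∀ i, v i ≠ 0) {f : MvPolynomial (Fin n) ℤ}
    (hf : ∀ i, degreeOf i f ≤ r i) (ξ : ℤ_[p]) {s A μ : ℝ} (hA : 1 < A) (hμ : 0 ≤ μ)
    (hvan : ∀ τ : Fin n →₀ ℕ, ∑ i, (τ i : ℝ) * (1 / r i) < s →
      coeff τ (shift (fun _ => ξ) (map (Int.castRingHom ℤ_[p]) f)) = 0)
    (hh : ∀ i, A ≤ ((max |u i| |v i| : ℤ) : ℝ) ^ r i)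
    (happ : ∀ i, ‖((u i : ℤ_[p]) - v i * ξ)‖ ≤ ((max |u i| |v i| : ℤ) : ℝ) ^ (-μ))
    (τ : Fin n →₀ ℕ) {Θ : ℝ} (hτ : ∑ i, (τ i : ℝ) * (1 / r i) ≤ Θ) :
    ‖((homShift r u v f τ : ℤ) : ℚ_[p])‖ ≤ A ^ (-(μ * (s - Θ))) := by
  have hinj : Function.Injective (Int.castRingHom ℚ_[p]) := Int.cast_injective
  have hinj' : Function.Injective (algebraMap ℤ_[p] ℚ_[p]) := IsFractionRing.injective _ _
  set F := shift (fun _ : Fin n => ξ) (map (Int.castRingHom ℤ_[p]) f) with hF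
  have hv' : ∀ i, (v i : ℚ_[p]) ≠ 0 := fun i => by exact_mod_cast hv i
  have hFd : ∀ i, degreeOf i F ≤ r i := fun i =>
    (degreeOf_shift_le _ _ i).trans ((degreeOf_le_iff.2 fun e he =>
      degreeOf_le_iff.1 (hf i) e (support_map_subset _ _ he)))
  have h1 : ((homShift r u v f τ : ℤ) : ℚ_[p]) =
      algebraMap ℤ_[p] ℚ_[p] (homShift r (fun i => (u i : ℤ_[p]) - v i * ξ) (fun i => (v i : ℤ_[p])) F τ) := by
    rw [← eq_intCast (Int.castRingHom ℚ_[p]), homShift_map hinj, homShift_map hinj']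
    rw [homShift_eq _ (by simpa using hv), homShift_eq _ (by simpa using hv), hF, map_shift,
      shift_shift, map_map]
    · have h2 : (fun i => Int.castRingHom ℚ_[p] (u i) / Int.castRingHom ℚ_[p] (v i)) =
          (fun i => algebraMap ℤ_[p] ℚ_[p] ((u i : ℤ_[p]) - v i * ξ) /
            algebraMap ℤ_[p] ℚ_[p] (v i : ℤ_[p])) + fun _ => algebraMap ℤ_[p] ℚ_[p] ξ := by
        ext i
        simp only [eq_intCast, map_sub, map_mul, map_intCast, Pi.add_apply]
        have := hv' i
        field_simp
        ring
      have h3 : (algebraMap ℤ_[p] ℚ_[p]).comp (Int.castRingHom ℤ_[p]) = Int.castRingHom ℚ_[p] :=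
        RingHom.ext_int _ _
      rw [h2, h3]
      simp
    · intro i
      refine (degreeOf_le_iff.2 fun e he => ?_)
      exact degreeOf_le_iff.1 (hFd i) e (support_map_subset _ _ he)
    · intro i
      refine (degreeOf_le_iff.2 fun e he => ?_)
      exact degreeOf_le_iff.1 (hf i) e (support_map_subset _ _ he)
  rw [h1]
  change ‖((homShift r _ _ F τ : ℤ_[p]) : ℚ_[p])‖ ≤ _
  rw [PadicInt.padic_norm_e_of_padicInt, homShift]
  have hA0 : 0 < A := by linarith
  refine IsUltrametricDist.norm_sum_le_of_forall_le_of_nonneg (by positivity) fun e he => ?_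
  rw [norm_mul]
  refine (mul_le_of_le_one_left (norm_nonneg _) (PadicInt.norm_le_one _)).trans ?_
  by_cases hτe : ∀ i, τ i ≤ e i
  swap
  · push Not at hτe
    obtain ⟨i, hi⟩ := hτe
    rw [Finset.prod_eq_zero (Finset.mem_univ i)]
    · rw [norm_zero]; positivity
    · rw [Nat.choose_eq_zero_of_lt hi]; simp
  have hs : s ≤ ∑ i, (e i : ℝ) * (1 / r i) := by
    by_contra! h
    exact mem_support_iff.1 he (hvan e h)
  have h5 : ∀ i, ‖((e i).choose (τ i) : ℤ_[p]) * (((u i : ℤ_[p]) - v i * ξ) ^ (e i - τ i) *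
      (v i : ℤ_[p]) ^ (r i - (e i - τ i)))‖ ≤ A ^ (-μ * ((e i : ℝ) * (1 / r i) - τ i * (1 / r i))) := by
    intro i
    rw [norm_mul, norm_mul, norm_pow]
    refine (mul_le_of_le_one_left (by positivity) (PadicInt.norm_le_one _)).trans ?_
    refine (mul_le_of_le_one_right (by positivity) (PadicInt.norm_le_one _)).trans ?_
    set h : ℝ := ((max |u i| |v i| : ℤ) : ℝ) with hh'
    have hri : (0 : ℝ) < r i := by exact_mod_cast hr i
    have hh0 : 0 < h := by
      have : 0 < |v i| := abs_pos.2 (hv i)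
      rw [hh']; exact_mod_cast lt_of_lt_of_le this (le_max_right _ _)
    have h6 : A ^ (1 / (r i : ℝ)) ≤ h := by
      calc A ^ (1 / (r i : ℝ)) ≤ (h ^ r i) ^ (1 / (r i : ℝ)) :=
            Real.rpow_le_rpow hA0.le (hh i) (by positivity)
        _ = h := by
            rw [← Real.rpow_natCast, ← Real.rpow_mul hh0.le, mul_one_div_cancel hri.ne', Real.rpow_one]
    have h7 : h ^ (-μ) ≤ (A ^ (1 / (r i : ℝ))) ^ (-μ) :=
      Real.rpow_le_rpow_of_nonpos (by positivity) h6 (by linarith)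
    calc _ ≤ ((A ^ (1 / (r i : ℝ))) ^ (-μ)) ^ (e i - τ i) :=
          pow_le_pow_left₀ (norm_nonneg _) ((happ i).trans h7) _
      _ = _ := by
          rw [← Real.rpow_natCast, ← Real.rpow_mul hA0.le, ← Real.rpow_mul hA0.le,
            Nat.cast_sub (hτe i)]
          congr 1; ring
  rw [norm_prod]
  refine (Finset.prod_le_prod (fun _ _ => norm_nonneg _) fun i _ => h5 i).trans ?_
  rw [← Real.rpow_sum_of_pos hA0, ← Finset.mul_sum, Finset.sum_sub_distrib]
  refine Real.rpow_le_rpow_of_exponent_le hA.le ?_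
  nlinarith

end Numerator

section Core

open MvPolynomial

lemma sum_exponents_mul_le {n : ℕ} (P : Finset Nat.Primes) (ξ : (p : Nat.Primes) → ℤ_[(p : ℕ)])
    {μ : Nat.Primes → ℝ} (hμ : ∀ p ∈ P, 0 ≤ μ p) {Θ δ s A η : ℝ} (hroth : RothBound n Θ δ)
    {r : Fin n → ℕ} {u v : Fin n → ℤ} {f : MvPolynomial (Fin n) ℤ} (hA : 1 < A)
    (hr : ∀ i, 0 < r i) (hrδ : ∀ i j, i < j → (r i : ℝ) ≤ δ * r j)
    (huv : ∀ i, IsCoprime (u i) (v i)) (hv : ∀ i, v i ≠ 0)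
    (hlow : ∀ i, A ≤ ((max |u i| |v i| : ℤ) : ℝ) ^ r i)
    (hupp : ∀ i, ((max |u i| |v i| : ℤ) : ℝ) ^ r i ≤ A ^ (1 + η))
    (h4 : (4 : ℝ) ^ (∑ i, r i) ≤ A ^ δ) (hf : f ≠ 0) (hdeg : ∀ i, degreeOf i f ≤ r i)
    (hl1 : l1 f ≤ A ^ δ)
    (hvan : ∀ p ∈ P, ∀ τ : Fin n →₀ ℕ, ∑ i, (τ i : ℝ) * (1 / r i) < s →
      coeff τ (shift (fun _ => ξ p) (map (Int.castRingHom ℤ_[(p : ℕ)]) f)) = 0)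
    (happ : ∀ i, ∀ p ∈ P, ‖((u i : ℤ_[(p : ℕ)]) - v i * ξ p)‖ ≤
      ((max |u i| |v i| : ℤ) : ℝ) ^ (-μ p)) :
    (∑ p ∈ P, μ p) * (s - Θ) ≤ 2 * δ + n * (1 + η) := by
  obtain ⟨τ, hτ, hne⟩ := hroth r u v A f hA hr hrδ huv hv hlow h4 hf hdeg hl1
  have hA0 : 0 < A := by linarith
  have hN : homShift r u v f τ ≠ 0 := by
    intro h0
    have h1 := homShift_map (φ := Int.castRingHom ℚ) Int.cast_injective r u v f τ
    rw [homShift_eq _ (by simpa using hv), h0, map_zero] at h1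
    · refine mul_ne_zero (Finset.prod_ne_zero_iff.2 fun i _ => pow_ne_zero _ ?_) hne h1.symm
      simpa using hv i
    · intro i
      refine (degreeOf_le_iff.2 fun e he => ?_)
      exact degreeOf_le_iff.1 (hdeg i) e (support_map_subset _ _ he)
  have h1 := one_le_abs_mul_prod_padicNorm P hN
  have h2 : ∏ p ∈ P, ‖((homShift r u v f τ : ℤ) : ℚ_[(p : ℕ)])‖ ≤
      A ^ (-((∑ p ∈ P, μ p) * (s - Θ))) := by
    refine (Finset.prod_le_prod (fun _ _ => norm_nonneg _) fun p hp =>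
      norm_homShift_le hr u v hv hdeg (ξ p) hA (hμ p hp) (hvan p hp) hlow
        (fun i => happ i p hp) τ hτ.le).trans ?_
    rw [← Real.rpow_sum_of_pos hA0, Finset.sum_neg_distrib, ← Finset.sum_mul]
  have h3 : |((homShift r u v f τ : ℤ) : ℝ)| ≤ A ^ (2 * δ + n * (1 + η)) := by
    refine (abs_homShift_le u v hdeg τ).trans ?_
    have h5 : (2 : ℝ) ^ (∑ i, r i) ≤ A ^ δ :=
      (pow_le_pow_left₀ (by norm_num) (by norm_num) _).trans h4
    have h6 : ∏ i, ((max |u i| |v i| : ℤ) : ℝ) ^ r i ≤ A ^ (n * (1 + η)) := by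
      refine (Finset.prod_le_prod (fun i _ => hA0.le.trans (hlow i)) fun i _ => hupp i).trans ?_
      rw [Finset.prod_const, Finset.card_univ, Fintype.card_fin, ← Real.rpow_natCast,
        ← Real.rpow_mul hA0.le, mul_comm]
    have h7 : 0 ≤ ∏ i, ((max |u i| |v i| : ℤ) : ℝ) ^ r i :=
      Finset.prod_nonneg fun i _ => hA0.le.trans (hlow i)
    calc _ ≤ A ^ δ * (A ^ δ * A ^ (n * (1 + η))) := by gcongr
      _ = _ := by rw [← Real.rpow_add hA0, ← Real.rpow_add hA0]; congr 1; ring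
  have h8 : (1 : ℝ) ≤ A ^ (2 * δ + n * (1 + η) + -((∑ p ∈ P, μ p) * (s - Θ))) := by
    rw [Real.rpow_add hA0]
    exact h1.trans (mul_le_mul h3 h2 (Finset.prod_nonneg fun _ _ => norm_nonneg _) (by positivity))
  by_contra! h
  have := Real.rpow_lt_one_of_one_lt_of_neg hA (z := 2 * δ + n * (1 + η) + -((∑ p ∈ P, μ p) * (s - Θ)))
    (by linarith)
  linarith

lemma exists_lacunary {S : Type*} (ℓ : S → ℝ) (h : ∀ B, ∃ s, B < ℓ s) (K B : ℝ) (m : ℕ) :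
    ∃ t : Fin m → S, (∀ i, B < ℓ (t i)) ∧ ∀ i j, i < j → K * ℓ (t j) ≤ ℓ (t i) := by
  induction m with
  | zero => exact ⟨Fin.elim0, fun i => i.elim0, fun i => i.elim0⟩
  | succ m ih =>
    obtain ⟨t, ht, ht'⟩ := ih
    obtain ⟨s, hs⟩ := h (|B| + ∑ j, |K * ℓ (t j)|)
    have h0 : 0 ≤ ∑ j, |K * ℓ (t j)| := Finset.sum_nonneg fun _ _ => abs_nonneg _
    refine ⟨Fin.cons s t, fun i => ?_, fun i j hij => ?_⟩
    · refine Fin.cases ?_ (fun i => ?_) i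
      · simp only [Fin.cons_zero]
        have := le_abs_self B
        linarith
      · simpa using ht i
    · revert hij
      refine Fin.cases ?_ (fun j => ?_) j
      · intro hij; exact absurd hij (by simp)
      · refine Fin.cases ?_ (fun i => ?_) i
        · intro _
          simp only [Fin.cons_zero, Fin.cons_succ]
          have h1 := Finset.single_le_sum (f := fun j => |K * ℓ (t j)|)
            (fun _ _ => abs_nonneg _) (Finset.mem_univ j)
          have h2 := le_abs_self (K * ℓ (t j))
          have := abs_nonneg B
          linarith
        · intro hij
          simpa using ht' i j (by simpa using hij)

lemma exists_exponents {m : ℕ} (hm : 0 < m) {L : Fin m → ℝ} {δ η C : ℝ} (hδ : 0 < δ) (hη : 0 < η) (hη1 : η ≤ 1)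
    (hC : 1 ≤ C) (hL0 : ∀ i, 0 < L i) (hLC : ∀ i, 2 * m * Real.log C ≤ δ * L i)
    (hL : ∀ i j, i < j → 2 / δ * L j ≤ L i) :
    ∃ (r : Fin m → ℕ) (A : ℝ), 1 < A ∧ (∀ i, 0 < r i) ∧
      (∀ i j, i < j → (r i : ℝ) ≤ δ * r j) ∧ (∀ i, A ≤ Real.exp (L i) ^ r i) ∧
      (∀ i, Real.exp (L i) ^ r i ≤ A ^ (1 + η)) ∧ C ^ (∑ i, r i) ≤ A ^ δ := by
  set X : ℝ := 2 / η * ∑ i, L i with hX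
  have hXL : ∀ i, 2 / η ≤ X / L i := fun i => by
    rw [le_div_iff₀ (hL0 i), hX]
    exact mul_le_mul_of_nonneg_left
      (Finset.single_le_sum (fun i _ => (hL0 i).le) (Finset.mem_univ i)) (by positivity)
  have h2 : ∀ i, 2 ≤ X / L i := fun i => le_trans (by rw [le_div_iff₀ hη]; linarith) (hXL i)
  have hX0 : 0 < X := by
    have := h2 ⟨0, hm⟩
    by_contra! h
    have := div_nonpos_of_nonpos_of_nonneg h (hL0 ⟨0, hm⟩).le
    linarith
  have hle : ∀ i, (⌊X / L i⌋₊ : ℝ) ≤ X / L i := fun i => Nat.floor_le (by linarith [h2 i])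
  have hge : ∀ i, X / L i - 1 < ⌊X / L i⌋₊ := fun i => by
    have := Nat.lt_floor_add_one (X / L i); linarith
  have hmul : ∀ i, X / L i * L i = X := fun i => div_mul_cancel₀ _ (hL0 i).ne'
  have hLX : ∀ i, L i ≤ η / 2 * X := fun i => by
    have := hXL i
    rw [div_le_div_iff₀ hη (hL0 i)] at this
    linarith
  have hA0 : 0 < Real.exp (X * (1 - η / 2)) := Real.exp_pos _
  refine ⟨fun i => ⌊X / L i⌋₊, Real.exp (X * (1 - η / 2)), ?_, fun i => ?_, fun i j hij => ?_,
    fun i => ?_, fun i => ?_, ?_⟩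
  · exact Real.one_lt_exp_iff.2 (mul_pos hX0 (by linarith))
  · exact Nat.floor_pos.2 (by linarith [h2 i])
  · have h3 := hL i j hij
    have h4 : X / L i ≤ δ / 2 * (X / L j) := by
      rw [div_le_iff₀ (hL0 i)]
      have : δ / 2 * (X / L j) * (2 / δ * L j) = X := by
        have := (hL0 j).ne'
        field_simp
      have h5 : 0 ≤ δ / 2 * (X / L j) := by have := h2 j; positivity
      calc X = δ / 2 * (X / L j) * (2 / δ * L j) := this.symm
        _ ≤ _ := mul_le_mul_of_nonneg_left h3 h5
    have h6 : X / L j ≤ 2 * ⌊X / L j⌋₊ := by linarith [hge j, h2 j]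
    calc _ ≤ X / L i := hle i
      _ ≤ δ / 2 * (X / L j) := h4
      _ ≤ δ / 2 * (2 * ⌊X / L j⌋₊) := by gcongr
      _ = _ := by ring
  · rw [← Real.exp_nat_mul]
    refine Real.exp_le_exp.2 ?_
    have := mul_le_mul_of_nonneg_right (hge i).le (hL0 i).le
    linarith [hmul i, hLX i]
  · rw [← Real.exp_nat_mul, ← Real.exp_mul]
    refine Real.exp_le_exp.2 ?_
    have := mul_le_mul_of_nonneg_right (hle i) (hL0 i).le
    have h7 : 0 ≤ X * (η / 2 * (1 - η)) := by
      have : 0 ≤ 1 - η := by linarith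
      positivity
    nlinarith [hmul i]
  · rw [← Real.exp_mul, ← Real.exp_log (show 0 < C by linarith), ← Real.exp_nat_mul]
    refine Real.exp_le_exp.2 ?_
    push_cast
    have hlog : 0 ≤ Real.log C := Real.log_nonneg hC
    have hm' : (0 : ℝ) < m := by exact_mod_cast hm
    rw [Finset.sum_mul]
    have h8 : ∀ i ∈ Finset.univ, (⌊X / L i⌋₊ : ℝ) * Real.log C ≤ X * δ / (2 * m) := by
      intro i _
      refine (mul_le_mul_of_nonneg_right (hle i) hlog).trans ?_
      rw [div_mul_eq_mul_div, div_le_div_iff₀ (hL0 i) (by positivity)]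
      nlinarith [mul_le_mul_of_nonneg_left (hLC i) hX0.le]
    refine (Finset.sum_le_sum h8).trans ?_
    rw [Finset.sum_const, Finset.card_univ, Fintype.card_fin, nsmul_eq_mul]
    have : (m : ℝ) * (X * δ / (2 * m)) = X * δ / 2 := by field_simp
    rw [this]
    nlinarith [mul_pos hX0 hδ]

lemma RothBound.mono {n : ℕ} {Θ δ δ' : ℝ} (h : RothBound n Θ δ) (hδ : δ' ≤ δ) : RothBound n Θ δ' := by
  intro r u v A f hA hr hrδ huv hv hlow h4 hf hdeg hl1
  have h1 : A ^ δ' ≤ A ^ δ := Real.rpow_le_rpow_of_exponent_le hA.le hδ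
  exact h r u v A f hA hr (fun i j hij => (hrδ i j hij).trans (by gcongr)) huv hv hlow
    (h4.trans h1) hf hdeg (hl1.trans h1)

/-- Ridout's theorem with prescribed exponents at each prime. -/
theorem exists_height_bound (P : Finset Nat.Primes) (ξ : (p : Nat.Primes) → ℤ_[(p : ℕ)])
    {g : Polynomial ℤ} (hg : g.Monic) (hroot : ∀ p ∈ P, Polynomial.aeval (ξ p) g = 0)
    {μ : Nat.Primes → ℝ} (hμ : ∀ p ∈ P, 0 ≤ μ p) (hsum : 2 < ∑ p ∈ P, μ p) :
    ∃ B : ℝ, ∀ u v : ℤ, IsCoprime u v → v ≠ 0 →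
      (∀ p ∈ P, ‖((u : ℤ_[(p : ℕ)]) - v * ξ p)‖ ≤ ((max |u| |v| : ℤ) : ℝ) ^ (-μ p)) →
      ((max |u| |v| : ℤ) : ℝ) ≤ B := by
  by_contra! hB
  set M := ∑ p ∈ P, μ p with hM
  have hD : 0 < g.natDegree := by
    rw [Nat.pos_iff_ne_zero]
    intro h0
    have h1 : g = 1 := hg.natDegree_eq_zero.1 h0
    obtain ⟨p, hp⟩ : P.Nonempty := by
      rw [Finset.nonempty_iff_ne_empty]
      rintro rfl
      simp at hM; linarith
    simpa [h1] using hroot p hp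
  obtain ⟨C, hC, hC'⟩ := exists_auxiliary hg hD
  set ε : ℝ := min 1 ((M / 2 - 1) / (2 * (2 * M + 3))) with hε
  have hε0 : 0 < ε := lt_min one_pos (by apply div_pos <;> linarith)
  have hεM : 1 + 3 * ε < M * (1 / 2 - 2 * ε) := by
    have h1 : ε ≤ (M / 2 - 1) / (2 * (2 * M + 3)) := min_le_right _ _
    rw [le_div_iff₀ (by linarith)] at h1
    nlinarith
  obtain ⟨m, hm⟩ : ∃ m : ℕ, (g.natDegree : ℝ) / (2 * ε ^ 2) ≤ m := exists_nat_ge _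
  have hm' : (g.natDegree : ℝ) ≤ 2 * ε ^ 2 * m := by
    rw [div_le_iff₀ (by positivity)] at hm; linarith
  have hm0 : 0 < m := by
    rcases Nat.eq_zero_or_pos m with rfl | h
    · simp at hm'; omega
    · exact h
  have hm0' : (0 : ℝ) < m := by exact_mod_cast hm0
  obtain ⟨δ₀, hδ₀, hroth₀⟩ := exists_rothBound m (ε * m) (by positivity)
  set δ := min δ₀ (ε * m) with hδ
  have hδ0 : 0 < δ := lt_min hδ₀ (by positivity)
  have hroth : RothBound m (ε * m) δ := hroth₀.mono (min_le_left _ _)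
  let S := {w : ℤ × ℤ // IsCoprime w.1 w.2 ∧ w.2 ≠ 0 ∧ ∀ p ∈ P,
    ‖((w.1 : ℤ_[(p : ℕ)]) - w.2 * ξ p)‖ ≤ ((max |w.1| |w.2| : ℤ) : ℝ) ^ (-μ p)}
  let ℓ : S → ℝ := fun w => Real.log ((max |w.1.1| |w.1.2| : ℤ) : ℝ)
  have hpos : ∀ w : S, (0 : ℝ) < ((max |w.1.1| |w.1.2| : ℤ) : ℝ) := fun w => by
    have : 0 < |w.1.2| := abs_pos.2 w.2.2.1
    exact_mod_cast lt_of_lt_of_le this (le_max_right _ _)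
  have hexp : ∀ w : S, Real.exp (ℓ w) = ((max |w.1.1| |w.1.2| : ℤ) : ℝ) := fun w =>
    Real.exp_log (hpos w)
  have hunb : ∀ B, ∃ s, B < ℓ s := fun B => by
    obtain ⟨u, v, h1, h2, h3, h4⟩ := hB (Real.exp B)
    refine ⟨⟨(u, v), h1, h2, h3⟩, ?_⟩
    rw [← Real.exp_lt_exp, hexp]
    exact h4
  set C₁ := max 4 C with hC₁
  obtain ⟨t, ht, ht'⟩ := exists_lacunary ℓ hunb (2 / δ) (max 0 (2 * m * Real.log C₁ / δ)) m
  obtain ⟨r, A, hA, hr, hrδ, hlow, hupp, hCA⟩ := exists_exponents hm0 (L := fun i => ℓ (t i)) (C := C₁)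
    hδ0 hε0 (min_le_left _ _) (hC.trans (le_max_right _ _))
    (fun i => lt_of_le_of_lt (le_max_left _ _) (ht i))
    (fun i => by
      have := (lt_of_le_of_lt (le_max_right _ _) (ht i)).le
      rw [div_le_iff₀ hδ0] at this
      linarith) ht'
  obtain ⟨f, hf, hdeg, hl1, hvan⟩ := hC' ε hε0 m hm' r hr
  simp only [hexp] at hlow hupp
  have := sum_exponents_mul_le P ξ hμ hroth hA hr hrδ (fun i => (t i).2.1) (fun i => (t i).2.2.1)
    hlow hupp ((pow_le_pow_left₀ (by norm_num) (le_max_left _ _) _).trans hCA) hf hdeg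
    (hl1.trans ((pow_le_pow_left₀ (by linarith) (le_max_right _ _) _).trans hCA))
    (fun p hp => hvan (ξ p) (hroot p hp)) (fun i p hp => (t i).2.2.2 p hp)
  have hδm : δ ≤ ε * m := min_le_right _ _
  nlinarith [mul_lt_mul_of_pos_right hεM hm0']

end Core

section Ridout

lemma exists_monic_root (P : Finset Nat.Primes) {θ : (p : Nat.Primes) → ℤ_[(p : ℕ)]}
    (hθ : ∀ p ∈ P, IsIntegral ℤ (θ p)) :
    ∃ g : Polynomial ℤ, g.Monic ∧ ∀ p ∈ P, Polynomial.aeval (θ p) g = 0 := by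
  choose! G hG hG' using hθ
  refine ⟨∏ p ∈ P, G p, Polynomial.monic_prod_of_monic _ _ hG, fun p hp => ?_⟩
  rw [map_prod]
  exact Finset.prod_eq_zero hp (hG' p hp)

lemma exists_discrete_exponents {ι : Type*} (P : Finset ι) {κ : ℝ} (hκ : 2 < κ) :
    ∃ K : ℕ, 0 < K ∧ ∀ z : ι → ℝ, (∀ p ∈ P, 0 ≤ z p) → κ ≤ ∑ p ∈ P, z p →
      ∃ n : ι → ℕ, (∀ p, n p < 3 * K + 1) ∧ (∀ p ∈ P, (n p : ℝ) / K ≤ z p) ∧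
        2 < ∑ p ∈ P, (n p : ℝ) / K := by
  obtain ⟨K, hK⟩ := exists_nat_gt ((P.card : ℝ) / (κ - 2))
  have hK0' : (0 : ℝ) < K := lt_of_le_of_lt (div_nonneg (by positivity) (by linarith)) hK
  have hK0 : 0 < K := by exact_mod_cast hK0'
  rw [div_lt_iff₀ (by linarith)] at hK
  refine ⟨K, hK0, fun z hz hsum => ⟨fun p => min ⌊K * z p⌋₊ (3 * K), fun p => by
    exact Nat.lt_succ_of_le (min_le_right _ _), fun p hp => ?_, ?_⟩⟩
  · rw [div_le_iff₀ hK0']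
    have h0 : 0 ≤ K * z p := mul_nonneg hK0'.le (hz p hp)
    have h1 : ((min ⌊K * z p⌋₊ (3 * K) : ℕ) : ℝ) ≤ ⌊K * z p⌋₊ := by exact_mod_cast min_le_left _ _
    linarith [Nat.floor_le h0]
  · by_cases h : ∃ p ∈ P, 3 ≤ z p
    · obtain ⟨p, hp, h3⟩ := h
      have h4 : min ⌊K * z p⌋₊ (3 * K) = 3 * K := by
        refine min_eq_right (Nat.le_floor ?_)
        push_cast
        nlinarith
      have h5 := Finset.single_le_sum (f := fun p => ((min ⌊K * z p⌋₊ (3 * K) : ℕ) : ℝ) / K)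
        (fun _ _ => by positivity) hp
      refine lt_of_lt_of_le ?_ h5
      simp only [h4]
      rw [lt_div_iff₀ hK0']
      push_cast
      linarith
    · push Not at h
      have h6 : ∀ p ∈ P, z p - 1 / K ≤ ((min ⌊K * z p⌋₊ (3 * K) : ℕ) : ℝ) / K := by
        intro p hp
        have h7 : min ⌊K * z p⌋₊ (3 * K) = ⌊K * z p⌋₊ := by
          refine min_eq_left (Nat.floor_le_of_le ?_)
          push_cast
          nlinarith [h p hp]
        rw [h7, le_div_iff₀ hK0', sub_mul, one_div_mul_cancel hK0'.ne']
        linarith [Nat.lt_floor_add_one (K * z p)]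
      refine lt_of_lt_of_le ?_ (Finset.sum_le_sum h6)
      rw [Finset.sum_sub_distrib, Finset.sum_const, nsmul_eq_mul]
      have : (P.card : ℝ) * (1 / K) < κ - 2 := by
        rw [mul_one_div, div_lt_iff₀ hK0']; linarith
      linarith

lemma exists_common_bound {ι : Type*} [Finite ι] {α : Type*} (h : α → ℝ) (S : ι → Set α)
    (hS : ∀ i, ∃ B, ∀ a ∈ S i, h a ≤ B) : ∃ B, 1 ≤ B ∧ ∀ i, ∀ a ∈ S i, h a ≤ B := by
  cases nonempty_fintype ι
  choose B hB using hS
  refine ⟨1 + ∑ i, |B i|, by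
    have := Finset.sum_nonneg fun i (_ : i ∈ Finset.univ) => abs_nonneg (B i)
    linarith, fun i a ha => ?_⟩
  have h1 := Finset.single_le_sum (f := fun i => |B i|) (fun _ _ => abs_nonneg _) (Finset.mem_univ i)
  have h2 := le_abs_self (B i)
  have h3 := hB i a ha
  linarith

/-- Ridout's theorem for finitely many finite places. -/
theorem ridout (P : Finset Nat.Primes) {θ : (p : Nat.Primes) → ℤ_[(p : ℕ)]}
    (hθ : ∀ p ∈ P, IsIntegral ℤ (θ p)) {κ : ℝ} (hκ : 2 < κ) :
    ∃ B : ℝ, ∀ u v : ℤ, IsCoprime u v → (∀ p ∈ P, (u : ℤ_[(p : ℕ)]) - v * θ p ≠ 0) →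
      ∏ p ∈ P, ‖(u : ℤ_[(p : ℕ)]) - v * θ p‖ ≤ ((max |u| |v| : ℤ) : ℝ) ^ (-κ) →
      ((max |u| |v| : ℤ) : ℝ) ≤ B := by
  classical
  obtain ⟨g, hg, hroot⟩ := exists_monic_root P hθ
  obtain ⟨K, hK, hK'⟩ := exists_discrete_exponents P hκ
  let μ : (P → Fin (3 * K + 1)) → Nat.Primes → ℝ := fun n p =>
    if h : p ∈ P then ((n ⟨p, h⟩ : ℕ) : ℝ) / K else 0
  obtain ⟨B, hB1, hB⟩ := exists_common_bound (fun w : ℤ × ℤ => ((max |w.1| |w.2| : ℤ) : ℝ))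
    (fun n : P → Fin (3 * K + 1) => {w | 2 < ∑ p ∈ P, μ n p ∧ IsCoprime w.1 w.2 ∧ w.2 ≠ 0 ∧
      ∀ p ∈ P, ‖((w.1 : ℤ_[(p : ℕ)]) - w.2 * θ p)‖ ≤ ((max |w.1| |w.2| : ℤ) : ℝ) ^ (-μ n p)})
    (fun n => by
      by_cases h : 2 < ∑ p ∈ P, μ n p
      · obtain ⟨B, hB⟩ := exists_height_bound P θ hg hroot (μ := μ n) (fun p _ => by
          simp only [μ]
          split_ifs
          positivity) h
        exact ⟨B, fun w hw => hB w.1 w.2 hw.2.1 hw.2.2.1 hw.2.2.2⟩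
      · exact ⟨0, fun w hw => absurd hw.1 h⟩)
  refine ⟨B, fun u v huv hne hprod => ?_⟩
  set H : ℝ := ((max |u| |v| : ℤ) : ℝ) with hH
  rcases le_or_gt H 1 with h1 | h1
  · linarith
  have hv : v ≠ 0 := by
    rintro rfl
    have := Int.isUnit_iff_abs_eq.1 (isCoprime_zero_right.1 huv)
    rw [hH, this] at h1
    norm_num at h1
  have hlog : 0 < Real.log H := Real.log_pos h1
  have hnpos : ∀ p ∈ P, 0 < ‖(u : ℤ_[(p : ℕ)]) - v * θ p‖ := fun p hp => norm_pos_iff.2 (hne p hp)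
  let z : Nat.Primes → ℝ := fun p => -Real.log ‖(u : ℤ_[(p : ℕ)]) - v * θ p‖ / Real.log H
  have hz : ∀ p ∈ P, ‖(u : ℤ_[(p : ℕ)]) - v * θ p‖ = H ^ (-z p) := fun p hp => by
    rw [Real.rpow_def_of_pos (by linarith)]
    simp only [z]
    rw [neg_div, neg_neg, mul_div_cancel₀ _ hlog.ne', Real.exp_log (hnpos p hp)]
  obtain ⟨n, hn, hnz, hnsum⟩ := hK' z (fun p hp => by
    refine div_nonneg (neg_nonneg.2 (Real.log_nonpos (norm_nonneg _) (PadicInt.norm_le_one _))) hlog.le) (by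
    rw [Finset.prod_congr rfl hz, ← Real.rpow_sum_of_pos (by linarith), Real.rpow_le_rpow_left_iff h1,
      Finset.sum_neg_distrib] at hprod
    linarith)
  have hμ : ∀ p ∈ P, μ (fun p => ⟨n p, hn p⟩) p = (n p : ℝ) / K := fun p hp => by simp [μ, hp]
  refine hB (fun p => ⟨n p, hn p⟩) (u, v) ⟨?_, huv, hv, fun p hp => ?_⟩
  · rwa [Finset.sum_congr rfl hμ]
  · rw [hμ p hp]
    simp only
    rw [hz p hp]
    exact Real.rpow_le_rpow_of_exponent_le h1.le (neg_le_neg (hnz p hp))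

lemma exists_pos_le_of_bounded (P : Finset Nat.Primes) (θ : (p : Nat.Primes) → ℤ_[(p : ℕ)]) (B : ℝ) :
    ∃ c₀ : ℝ, 0 < c₀ ∧ ∀ u v : ℤ, (∀ p ∈ P, (u : ℤ_[(p : ℕ)]) - v * θ p ≠ 0) →
      ((max |u| |v| : ℤ) : ℝ) ≤ B → c₀ ≤ ∏ p ∈ P, ‖(u : ℤ_[(p : ℕ)]) - v * θ p‖ := by
  let T : Set (ℤ × ℤ) := {w | (∀ p ∈ P, (w.1 : ℤ_[(p : ℕ)]) - w.2 * θ p ≠ 0) ∧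
    ((max |w.1| |w.2| : ℤ) : ℝ) ≤ B}
  have hT : T.Finite := by
    refine (((Set.finite_Icc (-⌊B⌋) ⌊B⌋).prod (Set.finite_Icc (-⌊B⌋) ⌊B⌋))).subset ?_
    rintro ⟨u, v⟩ ⟨-, h⟩
    have h' := Int.le_floor.2 h
    exact ⟨abs_le.1 ((le_max_left _ _).trans h'), abs_le.1 ((le_max_right _ _).trans h')⟩
  let F : ℤ × ℤ → ℝ := fun w => ∏ p ∈ P, ‖(w.1 : ℤ_[(p : ℕ)]) - w.2 * θ p‖
  have hF : ∀ w ∈ T, 0 < F w := fun w hw => Finset.prod_pos fun p hp => norm_pos_iff.2 (hw.1 p hp)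
  rcases T.eq_empty_or_nonempty with h | h
  · exact ⟨1, one_pos, fun u v h1 h2 => absurd (show (u, v) ∈ T from ⟨h1, h2⟩) (by simp [h])⟩
  · obtain ⟨w, hw, hmin⟩ := Set.exists_min_image T F hT h
    exact ⟨F w, hF w hw, fun u v h1 h2 => hmin (u, v) ⟨h1, h2⟩⟩

lemma exists_forall_mul_rpow_lt {K ε b : ℝ} (hε : 0 < ε) (hb : 0 < b) :
    ∃ Q : ℕ, ∀ q : ℕ, Q < q → K * (q : ℝ) ^ (-ε) < b := by
  have h := ((tendsto_rpow_neg_atTop hε).comp tendsto_natCast_atTop_atTop).const_mul K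
  rw [mul_zero] at h
  obtain ⟨Q, hQ⟩ := Filter.eventually_atTop.1 (h.eventually (gt_mem_nhds hb))
  exact ⟨Q, fun q hq => hQ q hq.le⟩

/-- Ridout's theorem for pairs of integers that need not be coprime. -/
theorem exists_modulus_bound (P : Finset Nat.Primes) {θ : (p : Nat.Primes) → ℤ_[(p : ℕ)]}
    (hθ : ∀ p ∈ P, IsIntegral ℤ (θ p)) {K c : ℝ} (hK : 1 ≤ K) (hc0 : 0 < c) (hc : c < 1 / 2) :
    ∃ Q : ℕ, ∀ q : ℕ, Q < q → ∀ u v : ℤ, (∀ p ∈ P, (u : ℤ_[(p : ℕ)]) - v * θ p ≠ 0) →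
      ((max |u| |v| : ℤ) : ℝ) ≤ K * (q : ℝ) ^ c →
      K / q < ∏ p ∈ P, ‖(u : ℤ_[(p : ℕ)]) - v * θ p‖ := by
  have hK0 : 0 < K := by linarith
  obtain ⟨κ, hκ2, hκc⟩ : ∃ κ, 2 < κ ∧ κ < 1 / c :=
    exists_between (by rw [lt_div_iff₀ hc0]; linarith)
  rw [lt_div_iff₀ hc0] at hκc
  obtain ⟨B, hB⟩ := ridout P hθ hκ2
  obtain ⟨c₀, hc₀, hc₀'⟩ := exists_pos_le_of_bounded P θ B
  obtain ⟨Q₁, hQ₁⟩ := exists_forall_mul_rpow_lt (K := K) (ε := 1) (b := 1) one_pos one_pos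
  obtain ⟨Q₂, hQ₂⟩ := exists_forall_mul_rpow_lt (K := K * K ^ κ) (ε := 1 - κ * c) (b := 1)
    (by linarith) one_pos
  obtain ⟨Q₃, hQ₃⟩ := exists_forall_mul_rpow_lt (K := K * K) (ε := 1 - c) (b := c₀) (by linarith) hc₀
  refine ⟨Q₁ + Q₂ + Q₃, fun q hq u v hne hsize => ?_⟩
  replace hQ₁ := hQ₁ q (by omega)
  replace hQ₂ := hQ₂ q (by omega)
  replace hQ₃ := hQ₃ q (by omega)
  have hq0 : (0 : ℝ) < q := by
    have : 0 < q := by omega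
    exact_mod_cast this
  by_contra! hprod
  by_cases h0 : Int.gcd u v = 0
  · obtain ⟨rfl, rfl⟩ := Int.gcd_eq_zero_iff.1 h0
    rcases P.eq_empty_or_nonempty with rfl | ⟨p, hp⟩
    · rw [Real.rpow_neg_one, ← div_eq_mul_inv] at hQ₁
      simp at hprod
      linarith
    · simpa using hne p hp
  obtain ⟨u', v', hcop, hu, hv⟩ := Int.exists_gcd_one (Nat.pos_of_ne_zero h0)
  set d := Int.gcd u v with hd
  have hcop' : IsCoprime u' v' := Int.isCoprime_iff_gcd_eq_one.2 hcop
  have hd1 : (1 : ℝ) ≤ d := by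
    have : 1 ≤ d := Nat.pos_of_ne_zero h0
    exact_mod_cast this
  have hfac : ∀ p : Nat.Primes, (u : ℤ_[(p : ℕ)]) - v * θ p = (d : ℤ_[(p : ℕ)]) * (u' - v' * θ p) := by
    intro p
    have e1 : (u : ℤ_[(p : ℕ)]) = u' * d := by rw [hu]; push_cast; ring
    have e2 : (v : ℤ_[(p : ℕ)]) = v' * d := by rw [hv]; push_cast; ring
    rw [e1, e2]
    ring
  have hne' : ∀ p ∈ P, (u' : ℤ_[(p : ℕ)]) - v' * θ p ≠ 0 := fun p hp h =>
    hne p hp (by rw [hfac, h, mul_zero])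
  set H : ℝ := ((max |u'| |v'| : ℤ) : ℝ) with hH
  have hH1 : 1 ≤ H := by
    have : 1 ≤ max |u'| |v'| := by
      by_contra! h
      have h1 : u' = 0 := abs_nonpos_iff.1 (by have := le_max_left |u'| |v'|; omega)
      have h2 : v' = 0 := abs_nonpos_iff.1 (by have := le_max_right |u'| |v'|; omega)
      simp [h1, h2] at hcop
    rw [hH]; exact_mod_cast this
  have hdH : d * H ≤ K * (q : ℝ) ^ c := by
    refine le_trans (le_of_eq ?_) hsize
    rw [hH, hu, hv, abs_mul, abs_mul]
    push_cast
    rw [← max_mul_of_nonneg _ _ (abs_nonneg _), Nat.abs_cast]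
    ring
  have hd0 : (d : ℤ) ≠ 0 := by exact_mod_cast h0
  have hdn := one_le_abs_mul_prod_padicNorm P hd0
  set W := ∏ p ∈ P, ‖(u' : ℤ_[(p : ℕ)]) - v' * θ p‖ with hW
  have hW0 : 0 ≤ W := Finset.prod_nonneg fun _ _ => norm_nonneg _
  have hsplit : ∏ p ∈ P, ‖(u : ℤ_[(p : ℕ)]) - v * θ p‖ =
      (∏ p ∈ P, ‖((d : ℤ) : ℚ_[(p : ℕ)])‖) * W := by
    rw [hW, ← Finset.prod_mul_distrib]
    refine Finset.prod_congr rfl fun p _ => ?_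
    rw [hfac, norm_mul, ← PadicInt.padic_norm_e_of_padicInt (d : ℤ_[(p : ℕ)])]
    simp
  have hbound : W ≤ d * (K / q) := by
    rw [hsplit] at hprod
    have hdabs : |((d : ℤ) : ℝ)| = d := by simp
    rw [hdabs] at hdn
    calc W ≤ (d * ∏ p ∈ P, ‖((d : ℤ) : ℚ_[(p : ℕ)])‖) * W := le_mul_of_one_le_left hW0 hdn
      _ = d * ((∏ p ∈ P, ‖((d : ℤ) : ℚ_[(p : ℕ)])‖) * W) := by ring
      _ ≤ _ := by gcongr
  have hH0 : 0 < H := by linarith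
  have hHB : H ≤ B := by
    refine hB u' v' hcop' hne' (hbound.trans ?_)
    rw [Real.rpow_neg hH0.le, ← one_div, le_div_iff₀ (by positivity)]
    have e1 : (d : ℝ) * H ^ κ ≤ (d * H) ^ κ := by
      rw [Real.mul_rpow (by positivity) hH0.le]
      gcongr
      calc (d : ℝ) = (d : ℝ) ^ (1 : ℝ) := (Real.rpow_one _).symm
        _ ≤ _ := Real.rpow_le_rpow_of_exponent_le hd1 (by linarith)
    have e2 : (d * H) ^ κ ≤ K ^ κ * (q : ℝ) ^ (κ * c) := by
      calc _ ≤ (K * (q : ℝ) ^ c) ^ κ := Real.rpow_le_rpow (by positivity) hdH (by linarith)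
        _ = _ := by rw [Real.mul_rpow hK0.le (by positivity), ← Real.rpow_mul hq0.le, mul_comm c]
    calc d * (K / q) * H ^ κ = K / q * (d * H ^ κ) := by ring
      _ ≤ K / q * (K ^ κ * (q : ℝ) ^ (κ * c)) :=
        mul_le_mul_of_nonneg_left (e1.trans e2) (by positivity)
      _ = K * K ^ κ * (q : ℝ) ^ (-(1 - κ * c)) := by
        rw [neg_sub, Real.rpow_sub hq0, Real.rpow_one]; ring
      _ ≤ 1 := hQ₂.le
  have h1 := hc₀' u' v' hne' hHB
  have h2 : (d : ℝ) * (K / q) ≤ K * K * (q : ℝ) ^ (-(1 - c)) := by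
    calc (d : ℝ) * (K / q) ≤ (K * (q : ℝ) ^ c) * (K / q) := by
          gcongr; exact (le_mul_of_one_le_right (by positivity) hH1).trans hdH
      _ = _ := by rw [neg_sub, Real.rpow_sub hq0, Real.rpow_one]; ring
  linarith

end Ridout

section Reduction

lemma prod_padicNorm_natCast {P : Finset Nat.Primes} {q : ℕ} (hq : q ≠ 0)
    (hqP : ∀ l : Nat.Primes, (l : ℕ) ∣ q → l ∈ P) :
    ∏ p ∈ P, ‖(q : ℤ_[(p : ℕ)])‖ = 1 / q := by
  classical
  have h1 : ∏ p ∈ P, ‖(q : ℤ_[(p : ℕ)])‖ = (∏ p ∈ P, ((p : ℕ) : ℝ) ^ q.factorization p)⁻¹ := by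
    rw [← Finset.prod_inv_distrib]
    refine Finset.prod_congr rfl fun p _ => ?_
    rw [← PadicInt.padic_norm_e_of_padicInt, PadicInt.coe_natCast,
      Padic.norm_eq_zpow_neg_valuation (by exact_mod_cast hq), Padic.valuation_natCast, zpow_neg,
      zpow_natCast, Nat.factorization_def _ p.2]
  have h2 : ∏ p ∈ P, (p : ℕ) ^ q.factorization p = q := by
    conv_rhs => rw [← Nat.prod_factorization_pow_eq_self hq]
    rw [Finsupp.prod_of_support_subset _ (s := P.image fun p : Nat.Primes => (p : ℕ))]
    · exact (Finset.prod_image (f := fun l => l ^ q.factorization l)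
        fun p _ p' _ h => Subtype.ext h).symm
    · intro l hl
      rw [Nat.support_factorization, Nat.mem_primeFactors] at hl
      exact Finset.mem_image.2 ⟨⟨l, hl.1⟩, hqP ⟨l, hl.1⟩ hl.2.1, rfl⟩
    · simp
  rw [h1, one_div]
  congr 1
  exact_mod_cast h2

lemma exists_forall_sub_int_mul_ne_zero (P : Finset Nat.Primes) {α β : (p : Nat.Primes) → ℤ_[(p : ℕ)]}
    (hne : ∀ p ∈ P, ¬ (α p = 0 ∧ β p = 0)) : ∃ k : ℤ, ∀ p ∈ P, β p - k * α p ≠ 0 := by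
  have hfin : (⋃ p ∈ P, {k : ℤ | β p - k * α p = 0}).Finite := by
    refine Set.Finite.biUnion P.finite_toSet fun p hp => Set.Subsingleton.finite fun k hk l hl => ?_
    rw [Set.mem_ofPred_eq, sub_eq_zero] at hk hl
    by_cases hα : α p = 0
    · exact absurd ⟨hα, by rw [hk, hα, mul_zero]⟩ (hne p hp)
    · have := mul_right_cancel₀ hα (hk.symm.trans hl)
      exact_mod_cast this
  obtain ⟨k, hk⟩ := hfin.exists_notMem
  refine ⟨k, fun p hp h => hk ?_⟩
  exact Set.mem_biUnion hp h

lemma exists_integral_multiple {p : ℕ} [Fact p.Prime] {α β : ℤ_[p]} (hα : IsAlgebraic ℤ α)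
    (hβ : IsAlgebraic ℤ β) : ∃ a : ℤ, a ≠ 0 ∧ ∀ b : ℤ, β ≠ 0 →
      ∃ θ : ℤ_[p], IsIntegral ℤ θ ∧ β * θ = b * a * α := by
  have hinj : Function.Injective (algebraMap ℤ_[p] ℚ_[p]) := IsFractionRing.injective _ _
  have h1 : IsAlgebraic ℤ (algebraMap ℤ_[p] ℚ_[p] α / algebraMap ℤ_[p] ℚ_[p] β) := by
    rw [div_eq_mul_inv]
    exact (hα.algebraMap).mul (hβ.algebraMap).inv
  obtain ⟨a, ha, haint⟩ := h1.exists_integral_multiple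
  refine ⟨a, ha, fun b hβ0 => ?_⟩
  have haint' := haint.smul b
  obtain ⟨θ, hθ⟩ := IsIntegrallyClosed.algebraMap_eq_of_integral
    (haint'.tower_top (A := ℤ_[p]))
  refine ⟨θ, ?_, hinj ?_⟩
  · rw [← hθ] at haint'
    exact (isIntegral_algebraMap_iff hinj).1 haint'
  · have h0 : algebraMap ℤ_[p] ℚ_[p] β ≠ 0 := by rwa [Ne, map_eq_zero_iff _ hinj]
    rw [map_mul, hθ]
    simp only [zsmul_eq_mul, map_mul, map_intCast]
    field_simp

lemma exists_common_integral_multiple (P : Finset Nat.Primes) {α β : (p : Nat.Primes) → ℤ_[(p : ℕ)]}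
    (halg : ∀ p ∈ P, IsAlgebraic ℤ (α p) ∧ IsAlgebraic ℤ (β p)) (hβ : ∀ p ∈ P, β p ≠ 0) :
    ∃ (a : ℤ) (θ : (p : Nat.Primes) → ℤ_[(p : ℕ)]), a ≠ 0 ∧ ∀ p ∈ P, IsIntegral ℤ (θ p) ∧
      β p * θ p = a * α p := by
  classical
  have h1 : ∀ p ∈ P, ∃ a : ℤ, a ≠ 0 ∧ ∀ b : ℤ, β p ≠ 0 →
      ∃ θ : ℤ_[(p : ℕ)], IsIntegral ℤ θ ∧ β p * θ = b * a * α p :=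
    fun p hp => exists_integral_multiple (halg p hp).1 (halg p hp).2
  choose! a ha h using h1
  have h2 : ∀ p ∈ P, ∃ θ : ℤ_[(p : ℕ)], IsIntegral ℤ θ ∧ β p * θ = ((∏ p ∈ P, a p : ℤ) : ℤ_[(p : ℕ)]) * α p := by
    intro p hp
    obtain ⟨θ, hθ, hθ'⟩ := h p hp (∏ p ∈ P.erase p, a p) (hβ p hp)
    refine ⟨θ, hθ, hθ'.trans ?_⟩
    rw [← Finset.prod_erase_mul _ _ hp]
    push_cast
    ring
  choose! θ hθ using h2
  exact ⟨∏ p ∈ P, a p, θ, Finset.prod_ne_zero_iff.2 ha, hθ⟩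

end Reduction

end Roth

/-- Let `P` be a finite set of primes and, for each `p ∈ P`, let
`α_p, β_p ∈ ℤ_p` be algebraic over `ℚ` and not both zero.  For every fixed `c < 1/2` there
is a bound `Q` such that `M(q, q^c) = 0` for all `q > Q` whose prime factors all lie
in `P`. -/
theorem Mcount_eq_zero_eventually
    (P : Finset Nat.Primes) (α β : (p : Nat.Primes) → ℤ_[(p : ℕ)])
    (halg : ∀ p ∈ P, IsAlgebraic ℤ (α p) ∧ IsAlgebraic ℤ (β p))
    (hne : ∀ p ∈ P, ¬ (α p = 0 ∧ β p = 0))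
    (c : ℝ) (hc : c < 1 / 2) :
    ∃ Q : ℕ, ∀ q : ℕ, Q < q → (∀ l : Nat.Primes, (l : ℕ) ∣ q → l ∈ P) →
      Mcount P α β q ((q : ℝ) ^ c) = 0 := by
  obtain ⟨k, hk⟩ := Roth.exists_forall_sub_int_mul_ne_zero P hne
  have hkalg : ∀ p ∈ P, IsAlgebraic ℤ (α p) ∧ IsAlgebraic ℤ (β p - k * α p) := fun p hp =>
    ⟨(halg p hp).1, (halg p hp).2.sub ((isAlgebraic_intCast k).mul (halg p hp).1)⟩
  obtain ⟨a, θ, ha, hθ⟩ := Roth.exists_common_integral_multiple P hkalg hk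
  set D : ℝ := ∏ p ∈ P, ‖β p - k * α p‖ with hD
  have hD0 : 0 < D := Finset.prod_pos fun p hp => norm_pos_iff.2 (hk p hp)
  obtain ⟨K, hK1, hKa, hKk, hKD⟩ : ∃ K : ℝ, 1 ≤ K ∧ |(a : ℝ)| ≤ K ∧ 1 + |(k : ℝ)| ≤ K ∧ 1 / D ≤ K := by
    have h1 := abs_nonneg (a : ℝ)
    have h2 := abs_nonneg (k : ℝ)
    have h3 : 0 < 1 / D := by positivity
    exact ⟨1 + |(a : ℝ)| + |(k : ℝ)| + 1 / D, by linarith, by linarith, by linarith, by linarith⟩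
  obtain ⟨Q, hQ⟩ := Roth.exists_modulus_bound P (fun p hp => (hθ p hp).1) (K := K) (c := max c (1 / 4))
    hK1 (lt_max_of_lt_right (by norm_num)) (max_lt hc (by norm_num))
  refine ⟨Q, fun q hq hqP => ?_⟩
  have hq0 : q ≠ 0 := by omega
  have hq1 : (1 : ℝ) ≤ q := by exact_mod_cast Nat.pos_of_ne_zero hq0
  rw [Mcount]
  convert Set.ncard_empty (ℤ × ℤ)
  rw [Set.eq_empty_iff_forall_notMem]
  rintro ⟨u, v⟩ ⟨hdvd, hnz, hu, hv⟩
  simp only at hdvd hnz hu hv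
  have hqc : (q : ℝ) ^ c ≤ (q : ℝ) ^ max c (1 / 4) :=
    Real.rpow_le_rpow_of_exponent_le hq1 (le_max_left _ _)
  have hkey : ∀ p ∈ P, (β p - k * α p) * (((a * u : ℤ) : ℤ_[(p : ℕ)]) - ((v - k * u : ℤ) : ℤ_[(p : ℕ)]) * θ p) =
      a * (u * β p - v * α p) := by
    intro p hp
    have := (hθ p hp).2
    push_cast
    linear_combination (-(v - k * u : ℤ_[(p : ℕ)])) * this
  have ha' : ∀ p : Nat.Primes, (a : ℤ_[(p : ℕ)]) ≠ 0 := fun p => by exact_mod_cast ha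
  refine absurd (hQ q hq (a * u) (v - k * u) (fun p hp h0 => ?_) ?_) (not_lt.2 ?_)
  · have := hkey p hp
    rw [h0, mul_zero] at this
    exact mul_ne_zero (ha' p) (hnz p hp) this.symm
  · have hR : 0 ≤ (q : ℝ) ^ max c (1 / 4) := by positivity
    push_cast
    refine max_le ?_ ?_
    · rw [abs_mul]
      exact mul_le_mul hKa (hu.trans hqc) (abs_nonneg _) (by linarith)
    · calc |(v : ℝ) - k * u| ≤ |(v : ℝ)| + |(k : ℝ)| * |(u : ℝ)| := by
            rw [← abs_mul]; exact abs_sub _ _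
        _ ≤ (q : ℝ) ^ max c (1 / 4) + |(k : ℝ)| * (q : ℝ) ^ max c (1 / 4) := by
            gcongr
            · exact hv.trans hqc
            · exact hu.trans hqc
        _ = (1 + |(k : ℝ)|) * (q : ℝ) ^ max c (1 / 4) := by ring
        _ ≤ _ := by gcongr
  · have h1 : D * ∏ p ∈ P, ‖((a * u : ℤ) : ℤ_[(p : ℕ)]) - ((v - k * u : ℤ) : ℤ_[(p : ℕ)]) * θ p‖ ≤ 1 / q := by
      rw [← Roth.prod_padicNorm_natCast hq0 hqP, hD, ← Finset.prod_mul_distrib]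
      refine Finset.prod_le_prod (fun _ _ => by positivity) fun p hp => ?_
      rw [← norm_mul, hkey p hp, norm_mul]
      refine (mul_le_of_le_one_left (norm_nonneg _) (PadicInt.norm_le_one _)).trans ?_
      obtain ⟨x, hx⟩ := hdvd p hp
      rw [hx, norm_mul]
      exact mul_le_of_le_one_right (norm_nonneg _) (PadicInt.norm_le_one _)
    rw [← le_div_iff₀' hD0] at h1
    refine h1.trans ?_
    rw [div_div, mul_comm, ← div_div]
    gcongr
end
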